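/- Let Σ be a complete connected translating graph in ℝ³ (in the direction of any unit vector v). Then for every q ∈ ℝ³ and every r > 0, the weighted area of Σ inside the ball B_r(q) is bounded by the weighted area of the boundary sphere: ∫_{Σ ∩ B_r(q)} e^{z} dℋ²(p) ≤ ∫_{∂B_r(q)} e^{z} dℋ²(p), where z = ⟨p, e₃⟩ and ℋ² is 2-dimensional Hausdorff measure on ℝ³. -/

import Mathlib

open MeasureTheory Metric Real EuclideanSpace
open scoped RealInnerProductSpace ENNReal NNReal

noncomputable section

abbrev E3 : Type := EuclideanSpace ℝ (Fin 3)

def e1 : E3 := EuclideanSpace.single 0 1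
def e2 : E3 := EuclideanSpace.single 1 1
def e3 : E3 := EuclideanSpace.single 2 1

/-- First partial derivative of `u` in the first variable. -/
def pds (u : ℝ × ℝ → ℝ) (p : ℝ × ℝ) : ℝ := fderiv ℝ u p (1, 0)

/-- First partial derivative of `u` in the second variable. -/
def pdt (u : ℝ × ℝ → ℝ) (p : ℝ × ℝ) : ℝ := fderiv ℝ u p (0, 1)

/-- `S` is a translating graph in the direction of the unit vector `v`, with respect to the
orthonormal basis `(a, b, v)` of `ℝ³`, over the open connected domain `Ω ⊆ ℝ²`, given by the
smooth function `u : Ω → ℝ` solving the translator equation. -/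
structure IsTranslatingGraph (a b v : E3) (Ω : Set (ℝ × ℝ)) (u : ℝ × ℝ → ℝ)
    (S : Set E3) : Prop where
  norm_a : ‖a‖ = 1
  norm_b : ‖b‖ = 1
  norm_v : ‖v‖ = 1
  inner_ab : ⟪a, b⟫ = 0
  inner_av : ⟪a, v⟫ = 0
  inner_bv : ⟪b, v⟫ = 0
  isOpen_dom : IsOpen Ω
  isConnected_dom : IsConnected Ω
  smooth : ContDiffOn ℝ (⊤ : ℕ∞) u Ω
  pde : ∀ p ∈ Ω,
    (1 + (pdt u p) ^ 2) * pds (fun q => pds u q) p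
      - 2 * pds u p * pdt u p * pdt (fun q => pds u q) p
      + (1 + (pds u p) ^ 2) * pdt (fun q => pdt u q) p
    = (1 + (pds u p) ^ 2 + (pdt u p) ^ 2) *
        (⟪e3, v⟫ - pds u p * ⟪e3, a⟫ - pdt u p * ⟪e3, b⟫)
  graph_eq : S = {q : E3 | ∃ p ∈ Ω, q = p.1 • a + p.2 • b + u p • v}

/-- Entropy of a surface. -/
def entropy (S : Set E3) : ℝ≥0∞ :=
  ⨆ (x₀ : E3) (s₀ : ℝ) (_ : 0 < s₀),
    (ENNReal.ofReal (4 * π * s₀))⁻¹ *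
      ∫⁻ q in S, ENNReal.ofReal (Real.exp (-‖q - x₀‖ ^ 2 / (4 * s₀))) ∂(μH[2])

/-- Number of connected components (as a cardinal). -/
def numComponents (A : Set E3) : Cardinal := Cardinal.mk (ConnectedComponents A)

def vθ (θ : ℝ) : E3 := Real.sin θ • e3 + Real.cos θ • e2
def bθ (θ : ℝ) : E3 := Real.cos θ • e3 - Real.sin θ • e2


/-- The point of the translating graph over parameter `p`, for the basis `(e₁, b_θ, v_θ)`. -/
def graphPtθ (θ : ℝ) (u : ℝ × ℝ → ℝ) (p : ℝ × ℝ) : E3 :=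
  p.1 • e1 + p.2 • bθ θ + u p • vθ θ

/-- The Gauss map of a translating graph in the direction `v_θ`, as a function of the
parameter `p ∈ Ω`: `N = (v_θ − u_s e₁ − u_t b_θ)/√(1+u_s²+u_t²)`. -/
def gaussMapθ (θ : ℝ) (u : ℝ × ℝ → ℝ) (p : ℝ × ℝ) : E3 :=
  (Real.sqrt (1 + (pds u p) ^ 2 + (pdt u p) ^ 2))⁻¹ •
    (vθ θ - pds u p • e1 - pdt u p • bθ θ)

section

open Filter Topology

/-- The linear form with coefficients `a`, `b` on the plane. -/
def lin (a b : ℝ) : ℝ × ℝ →L[ℝ] ℝ :=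
  a • ContinuousLinearMap.fst ℝ ℝ ℝ + b • ContinuousLinearMap.snd ℝ ℝ ℝ

@[simp] lemma lin_apply (a b : ℝ) (x : ℝ × ℝ) : lin a b x = a * x.1 + b * x.2 := by
  simp [lin]

/-- A function on the plane together with candidates for its first and second partial
derivatives. -/
structure J2 where
  f : ℝ × ℝ → ℝ
  s : ℝ × ℝ → ℝ
  t : ℝ × ℝ → ℝ
  ss : ℝ × ℝ → ℝ
  st : ℝ × ℝ → ℝ
  tt : ℝ × ℝ → ℝ

namespace J2

/-- The candidates are the derivatives at every point of `U`, and are continuous there. -/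
structure On (g : J2) (U : Set (ℝ × ℝ)) : Prop where
  hf : ∀ x ∈ U, HasFDerivAt g.f (lin (g.s x) (g.t x)) x
  hs : ∀ x ∈ U, HasFDerivAt g.s (lin (g.ss x) (g.st x)) x
  ht : ∀ x ∈ U, HasFDerivAt g.t (lin (g.st x) (g.tt x)) x
  css : ∀ x ∈ U, ContinuousAt g.ss x
  cst : ∀ x ∈ U, ContinuousAt g.st x
  ctt : ∀ x ∈ U, ContinuousAt g.tt x

lemma On.mono {g : J2} {U V : Set (ℝ × ℝ)} (h : g.On U) (hVU : V ⊆ U) : g.On V :=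
  ⟨fun x hx => h.hf x (hVU hx), fun x hx => h.hs x (hVU hx), fun x hx => h.ht x (hVU hx),
    fun x hx => h.css x (hVU hx), fun x hx => h.cst x (hVU hx), fun x hx => h.ctt x (hVU hx)⟩

instance : Add J2 := ⟨fun g h => ⟨fun x => g.f x + h.f x, fun x => g.s x + h.s x,
  fun x => g.t x + h.t x, fun x => g.ss x + h.ss x, fun x => g.st x + h.st x,
  fun x => g.tt x + h.tt x⟩⟩

instance : SMul ℝ J2 := ⟨fun c g => ⟨fun x => c * g.f x, fun x => c * g.s x,
  fun x => c * g.t x, fun x => c * g.ss x, fun x => c * g.st x, fun x => c * g.tt x⟩⟩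

lemma add_f (g h : J2) (x) : (g + h).f x = g.f x + h.f x := rfl
lemma add_s (g h : J2) (x) : (g + h).s x = g.s x + h.s x := rfl
lemma add_t (g h : J2) (x) : (g + h).t x = g.t x + h.t x := rfl
lemma add_ss (g h : J2) (x) : (g + h).ss x = g.ss x + h.ss x := rfl
lemma add_st (g h : J2) (x) : (g + h).st x = g.st x + h.st x := rfl
lemma add_tt (g h : J2) (x) : (g + h).tt x = g.tt x + h.tt x := rfl
lemma smul_f (c : ℝ) (g : J2) (x) : (c • g).f x = c * g.f x := rfl
lemma smul_s (c : ℝ) (g : J2) (x) : (c • g).s x = c * g.s x := rfl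
lemma smul_t (c : ℝ) (g : J2) (x) : (c • g).t x = c * g.t x := rfl
lemma smul_ss (c : ℝ) (g : J2) (x) : (c • g).ss x = c * g.ss x := rfl
lemma smul_st (c : ℝ) (g : J2) (x) : (c • g).st x = c * g.st x := rfl
lemma smul_tt (c : ℝ) (g : J2) (x) : (c • g).tt x = c * g.tt x := rfl

lemma hasFDerivAt_add {p q : ℝ × ℝ → ℝ} {a b a' b' : ℝ} {x : ℝ × ℝ}
    (hp : HasFDerivAt p (lin a b) x) (hq : HasFDerivAt q (lin a' b') x) :
    HasFDerivAt (fun y => p y + q y) (lin (a + a') (b + b')) x := by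
  refine (hp.add hq).congr_fderiv ?_
  ext <;> simp

lemma hasFDerivAt_const_mul {p : ℝ × ℝ → ℝ} {a b : ℝ} {x : ℝ × ℝ} (c : ℝ)
    (hp : HasFDerivAt p (lin a b) x) :
    HasFDerivAt (fun y => c * p y) (lin (c * a) (c * b)) x := by
  refine (hp.const_mul c).congr_fderiv ?_
  ext <;> simp

lemma hasFDerivAt_mul {p q : ℝ × ℝ → ℝ} {a b a' b' : ℝ} {x : ℝ × ℝ}
    (hp : HasFDerivAt p (lin a b) x) (hq : HasFDerivAt q (lin a' b') x) :
    HasFDerivAt (fun y => p y * q y)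
      (lin (a * q x + p x * a') (b * q x + p x * b')) x := by
  refine (hp.mul hq).congr_fderiv ?_
  ext <;> simp <;> ring

lemma hasFDerivAt_comp {p : ℝ × ℝ → ℝ} {a b r : ℝ} {x : ℝ × ℝ} {φ : ℝ → ℝ}
    (hφ : HasDerivAt φ r (p x)) (hp : HasFDerivAt p (lin a b) x) :
    HasFDerivAt (fun y => φ (p y)) (lin (r * a) (r * b)) x := by
  refine (hφ.comp_hasFDerivAt x hp).congr_fderiv ?_
  ext <;> simp

lemma On.add {g h : J2} {U : Set (ℝ × ℝ)} (hg : g.On U) (hh : h.On U) : (g + h).On U :=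
  ⟨fun x hx => hasFDerivAt_add (hg.hf x hx) (hh.hf x hx),
   fun x hx => hasFDerivAt_add (hg.hs x hx) (hh.hs x hx),
   fun x hx => hasFDerivAt_add (hg.ht x hx) (hh.ht x hx),
   fun x hx => (hg.css x hx).add (hh.css x hx),
   fun x hx => (hg.cst x hx).add (hh.cst x hx),
   fun x hx => (hg.ctt x hx).add (hh.ctt x hx)⟩

lemma On.smul {g : J2} {U : Set (ℝ × ℝ)} (c : ℝ) (hg : g.On U) : (c • g).On U :=
  ⟨fun x hx => hasFDerivAt_const_mul c (hg.hf x hx),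
   fun x hx => hasFDerivAt_const_mul c (hg.hs x hx),
   fun x hx => hasFDerivAt_const_mul c (hg.ht x hx),
   fun x hx => continuousAt_const.mul (hg.css x hx),
   fun x hx => continuousAt_const.mul (hg.cst x hx),
   fun x hx => continuousAt_const.mul (hg.ctt x hx)⟩

lemma On.cf {g : J2} {U : Set (ℝ × ℝ)} (hg : g.On U) {x} (hx : x ∈ U) : ContinuousAt g.f x :=
  (hg.hf x hx).continuousAt
lemma On.cs {g : J2} {U : Set (ℝ × ℝ)} (hg : g.On U) {x} (hx : x ∈ U) : ContinuousAt g.s x :=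
  (hg.hs x hx).continuousAt
lemma On.ct {g : J2} {U : Set (ℝ × ℝ)} (hg : g.On U) {x} (hx : x ∈ U) : ContinuousAt g.t x :=
  (hg.ht x hx).continuousAt

/-- Composition with a function of one variable, given with its first two derivatives. -/
def comp (φ φ' φ'' : ℝ → ℝ) (g : J2) : J2 where
  f x := φ (g.f x)
  s x := φ' (g.f x) * g.s x
  t x := φ' (g.f x) * g.t x
  ss x := φ'' (g.f x) * g.s x * g.s x + φ' (g.f x) * g.ss x
  st x := φ'' (g.f x) * g.s x * g.t x + φ' (g.f x) * g.st x
  tt x := φ'' (g.f x) * g.t x * g.t x + φ' (g.f x) * g.tt x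

lemma On.comp {g : J2} {U : Set (ℝ × ℝ)} {φ φ' φ'' : ℝ → ℝ} (hg : g.On U)
    (h1 : ∀ y, HasDerivAt φ (φ' y) y) (h2 : ∀ y, HasDerivAt φ' (φ'' y) y)
    (h3 : Continuous φ'') : (J2.comp φ φ' φ'' g).On U := by
  have c2 : Continuous φ' := continuous_iff_continuousAt.2 fun y => (h2 y).continuousAt
  refine ⟨fun x hx => hasFDerivAt_comp (h1 _) (hg.hf x hx), fun x hx => ?_, fun x hx => ?_,
    fun x hx => ?_, fun x hx => ?_, fun x hx => ?_⟩
  · refine (hasFDerivAt_mul (hasFDerivAt_comp (h2 _) (hg.hf x hx)) (hg.hs x hx)).congr_fderiv ?_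
    simp only [J2.comp]; congr 1; ring
  · refine (hasFDerivAt_mul (hasFDerivAt_comp (h2 _) (hg.hf x hx)) (hg.ht x hx)).congr_fderiv ?_
    simp only [J2.comp]
  all_goals
    have k1 : ContinuousAt (fun x => φ' (g.f x)) x := c2.continuousAt.comp (hg.cf hx)
    have k2 : ContinuousAt (fun x => φ'' (g.f x)) x := h3.continuousAt.comp (hg.cf hx)
  · exact ((k2.mul (hg.cs hx)).mul (hg.cs hx)).add (k1.mul (hg.css x hx))
  · exact ((k2.mul (hg.cs hx)).mul (hg.ct hx)).add (k1.mul (hg.cst x hx))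
  · exact ((k2.mul (hg.ct hx)).mul (hg.ct hx)).add (k1.mul (hg.ctt x hx))

/-- Components of the Hessian for the flat metric `e^{2αt}(ds² + dt²)`. -/
def Hss (α : ℝ) (g : J2) (x : ℝ × ℝ) : ℝ := g.ss x + α * g.t x
def Hst (α : ℝ) (g : J2) (x : ℝ × ℝ) : ℝ := g.st x - α * g.s x
def Htt (α : ℝ) (g : J2) (x : ℝ × ℝ) : ℝ := g.tt x - α * g.t x

/-- The Hessian of the flat metric is positive semidefinite on `U`. -/
def Psd (α : ℝ) (g : J2) (U : Set (ℝ × ℝ)) : Prop :=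
  ∀ x ∈ U, ∀ a b : ℝ,
    0 ≤ g.Hss α x * a ^ 2 + 2 * g.Hst α x * (a * b) + g.Htt α x * b ^ 2

end J2

open J2

lemma second_deriv_nonpos_of_isLocalMax {h h' : ℝ → ℝ} {D : ℝ}
    (h1 : ∀ᶠ τ in 𝓝 (0 : ℝ), HasDerivAt h (h' τ) τ) (h2 : HasDerivAt h' D 0)
    (hmax : IsLocalMax h 0) : D ≤ 0 := by
  by_contra hD
  push Not at hD
  have e : deriv h =ᶠ[𝓝 0] h' := h1.mono fun τ hτ => hτ.deriv
  have d0 : h' 0 = 0 := by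
    rw [← h1.self_of_nhds.deriv]; exact hmax.deriv_eq_zero
  have dd : deriv (deriv h) 0 = D := by rw [e.deriv_eq]; exact h2.deriv
  have hmin : IsLocalMin h 0 := isLocalMin_of_deriv_deriv_pos (by rw [dd]; exact hD)
    (by rw [h1.self_of_nhds.deriv]; exact d0) h1.self_of_nhds.continuousAt
  have hc : h =ᶠ[𝓝 0] fun _ => h 0 := by
    filter_upwards [hmin, hmax] with τ a b using le_antisymm b a
  have h0 : deriv h =ᶠ[𝓝 0] fun _ => 0 := by
    have := hc.deriv
    simpa using this
  have : deriv (deriv h) 0 = 0 := by rw [h0.deriv_eq]; simp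
  linarith

lemma isLocalMax_jet {F : J2} {U : Set (ℝ × ℝ)} {x : ℝ × ℝ} (hU : U ∈ 𝓝 x) (hF : F.On U)
    (hmax : IsLocalMax F.f x) :
    F.s x = 0 ∧ F.t x = 0 ∧
      ∀ a b : ℝ, a ^ 2 * F.ss x + 2 * a * b * F.st x + b ^ 2 * F.tt x ≤ 0 := by
  have hx := mem_of_mem_nhds hU
  have h0 := hmax.hasFDerivAt_eq_zero (hF.hf x hx)
  have hs : F.s x = 0 := by simpa using congrArg (fun l => l (1, 0)) h0
  have ht : F.t x = 0 := by simpa using congrArg (fun l => l (0, 1)) h0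
  refine ⟨hs, ht, fun a b => ?_⟩
  have hline : ∀ τ : ℝ, HasDerivAt (fun τ : ℝ => x + τ • (a, b)) (a, b) τ := fun τ => by
    simpa using ((hasDerivAt_id τ).smul_const (a, b)).const_add x
  have hcont : Tendsto (fun τ : ℝ => x + τ • (a, b)) (𝓝 0) (𝓝 x) := by
    have := (hline 0).continuousAt.tendsto
    simpa using this
  refine second_deriv_nonpos_of_isLocalMax (h := fun τ => F.f (x + τ • (a, b)))
    (h' := fun τ => F.s (x + τ • (a, b)) * a + F.t (x + τ • (a, b)) * b) ?_ ?_ ?_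
  · filter_upwards [hcont hU] with τ hτ
    simpa [Function.comp_def] using (hF.hf _ hτ).comp_hasDerivAt τ (hline τ)
  · have e0 : x + (0 : ℝ) • (a, b) = x := by simp
    have k1 := (hF.hs _ (by rw [e0]; exact hx)).comp_hasDerivAt (0 : ℝ) (hline 0)
    have k2 := (hF.ht _ (by rw [e0]; exact hx)).comp_hasDerivAt (0 : ℝ) (hline 0)
    have := (k1.mul_const a).add (k2.mul_const b)
    refine this.congr_deriv ?_
    simp; ring
  · have : ∀ᶠ τ in 𝓝 (0 : ℝ), F.f (x + τ • (a, b)) ≤ F.f x := hcont hmax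
    simpa [IsLocalMax, IsMaxFilter] using this

/-- Data of a translator graph in adapted coordinates. -/
structure TGraph (α β : ℝ) (Ω : Set (ℝ × ℝ)) (u : J2) : Prop where
  isOpen : IsOpen Ω
  on : u.On Ω
  pde : ∀ x ∈ Ω, (1 + u.t x ^ 2) * u.ss x - 2 * u.s x * u.t x * u.st x
    + (1 + u.s x ^ 2) * u.tt x = (1 + u.s x ^ 2 + u.t x ^ 2) * (β - α * u.t x)
  closed : IsClosed {p : (ℝ × ℝ) × ℝ | p.1 ∈ Ω ∧ p.2 = u.f p.1}

/-- `D²f(f^⊥, f^⊥) + α f_t |∇f|²`. -/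
def J2.Q (α : ℝ) (f : J2) (x : ℝ × ℝ) : ℝ :=
  f.t x ^ 2 * f.ss x - 2 * f.s x * f.t x * f.st x + f.s x ^ 2 * f.tt x
    + α * f.t x * (f.s x ^ 2 + f.t x ^ 2)

lemma J2.Q_eq (α : ℝ) (f : J2) (x : ℝ × ℝ) :
    f.Q α x = f.Hss α x * f.t x ^ 2 + 2 * f.Hst α x * (f.t x * -f.s x)
      + f.Htt α x * (-f.s x) ^ 2 := by
  simp only [J2.Q, J2.Hss, J2.Hst, J2.Htt]; ring

lemma TGraph.touching_ineq {α β : ℝ} {Ω : Set (ℝ × ℝ)} {u : J2} (hu : TGraph α β Ω u)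
    {f : J2} {U : Set (ℝ × ℝ)} (hU : IsOpen U) (hf : f.On U) {x : ℝ × ℝ} (hxU : x ∈ U)
    (hxΩ : x ∈ Ω) {ε n : ℝ}
    (hmax : IsLocalMax (fun y => f.f y + -ε * (u.f y - n) ^ 2) x) :
    0 ≤ 2 * ε * (f.s x ^ 2 + f.t x ^ 2)
      + (2 * ε * (u.f x - n)) * ((2 * ε * (u.f x - n)) ^ 2 + (f.s x ^ 2 + f.t x ^ 2)) * β
      - α * (2 * ε * (u.f x - n)) ^ 2 * f.t x
      - (2 * ε * (u.f x - n)) ^ 2 * (f.ss x + f.tt x) - f.Q α x := by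
  set F : J2 := f + (-ε) • (J2.comp (fun y => (y - n) ^ 2) (fun y => 2 * (y - n)) (fun _ => 2) u)
    with hFdef
  have hF : F.On (U ∩ Ω) := by
    refine (hf.mono Set.inter_subset_left).add (On.smul _ (On.comp
      (hu.on.mono Set.inter_subset_right) (fun y => ?_) (fun y => ?_) continuous_const))
    · simpa using ((hasDerivAt_id y).sub_const n).fun_pow 2
    · simpa using ((hasDerivAt_id y).sub_const n).const_mul 2
  obtain ⟨e1, e2, e3⟩ := isLocalMax_jet ((hU.inter hu.isOpen).mem_nhds ⟨hxU, hxΩ⟩) hF hmax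
  have k1 := e3 1 0
  have k2 := e3 0 1
  have k3 := e3 (-u.t x) (u.s x)
  have hp := hu.pde x hxΩ
  simp only [hFdef, add_s, add_t, add_ss, add_st, add_tt, smul_s, smul_t, smul_ss, smul_st,
    smul_tt, J2.comp] at e1 e2 k1 k2 k3
  set m := 2 * ε * (u.f x - n) with hm
  have fs : f.s x = m * u.s x := by rw [hm]; linarith
  have ft : f.t x = m * u.t x := by rw [hm]; linarith
  have key : (f.ss x + f.tt x) + (u.t x ^ 2 * f.ss x - 2 * u.s x * u.t x * f.st x
      + u.s x ^ 2 * f.tt x) - 2 * ε * (u.s x ^ 2 + u.t x ^ 2)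
      - m * ((1 + u.s x ^ 2 + u.t x ^ 2) * (β - α * u.t x)) ≤ 0 := by
    rw [← hp, hm]; linarith
  have key2 := mul_nonneg_of_nonpos_of_nonpos (show -m ^ 2 ≤ 0 by nlinarith [sq_nonneg m]) key
  simp only [J2.Q, fs, ft]
  nlinarith [key2]

lemma TGraph.not_tendsto_of_notMem {α β : ℝ} {Ω : Set (ℝ × ℝ)} {u : J2} (hu : TGraph α β Ω u)
    {c : ℝ × ℝ} (hc : c ∉ Ω) {x : ℕ → ℝ × ℝ} (hx : ∀ k, x k ∈ Ω)
    (hlim : Tendsto x atTop (𝓝 c)) (R : ℝ) : ∀ᶠ k in atTop, R < |u.f (x k)| := by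
  by_contra hcon
  rw [Filter.not_eventually] at hcon
  obtain ⟨φ, hφ, hφR⟩ := Filter.extraction_of_frequently_atTop hcon
  have hmem : ∀ k, u.f (x (φ k)) ∈ Set.Icc (-R) R := fun k => by
    have := hφR k
    push Not at this
    exact abs_le.1 this
  obtain ⟨w, -, ψ, hψ, hw⟩ := isCompact_Icc.tendsto_subseq hmem
  have : (c, w) ∈ {p : (ℝ × ℝ) × ℝ | p.1 ∈ Ω ∧ p.2 = u.f p.1} := by
    refine hu.closed.mem_of_tendsto (b := atTop) (f := fun k => (x (φ (ψ k)), u.f (x (φ (ψ k)))))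
      ?_ ?_
    · exact Tendsto.prodMk_nhds (hlim.comp (hφ.tendsto_atTop.comp hψ.tendsto_atTop)) hw
    · exact Eventually.of_forall fun k => ⟨hx _, rfl⟩
  exact hc this.1

lemma TGraph.exists_max {α β : ℝ} {Ω : Set (ℝ × ℝ)} {u : J2} (hu : TGraph α β Ω u)
    {f : ℝ × ℝ → ℝ} {N : Set (ℝ × ℝ)} (hN : IsCompact N) (hf : ContinuousOn f N) {ε : ℝ}
    (hε : 0 < ε) (n : ℝ) (hne : (N ∩ Ω).Nonempty) :
    ∃ y ∈ N ∩ Ω, ∀ x ∈ N ∩ Ω, f x + -ε * (u.f x - n) ^ 2 ≤ f y + -ε * (u.f y - n) ^ 2 := by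
  obtain ⟨x0, hx0N, hx0Ω⟩ := hne
  obtain ⟨M, hM⟩ := (hN.image_of_continuousOn hf).bddAbove
  set A := f x0 + -ε * (u.f x0 - n) ^ 2 with hA
  have hMA : 0 ≤ M - A := by
    have := hM ⟨x0, hx0N, rfl⟩
    nlinarith [mul_nonneg hε.le (sq_nonneg (u.f x0 - n))]
  set R := √((M - A) / ε) with hR
  have hR2 : ε * R ^ 2 = M - A := by
    rw [hR, Real.sq_sqrt (by positivity)]; field_simp
  have hR0 : 0 ≤ R := Real.sqrt_nonneg _
  have hcase : ∀ x ∈ N ∩ Ω, u.f x ∉ Set.Icc (n - R) (n + R) → f x + -ε * (u.f x - n) ^ 2 ≤ A := by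
    intro x hx hxR
    have h1 := hM ⟨x, hx.1, rfl⟩
    have h2 : R ^ 2 ≤ (u.f x - n) ^ 2 := by
      by_contra hlt
      push Not at hlt
      apply hxR
      have := abs_le.1 (abs_le_of_sq_le_sq hlt.le hR0)
      constructor <;> linarith [this.1, this.2]
    nlinarith [mul_le_mul_of_nonneg_left h2 hε.le]
  set P := {p : (ℝ × ℝ) × ℝ | p.1 ∈ Ω ∧ p.2 = u.f p.1} ∩ N ×ˢ Set.Icc (n - R) (n + R)
  have hP : IsCompact P := (hN.prod isCompact_Icc).inter_left hu.closed
  have hx0P : (x0, u.f x0) ∈ P := by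
    refine ⟨⟨hx0Ω, rfl⟩, hx0N, ?_⟩
    have h1 := hM ⟨x0, hx0N, rfl⟩
    have h2 : (u.f x0 - n) ^ 2 ≤ R ^ 2 := by
      have : ε * (u.f x0 - n) ^ 2 ≤ ε * R ^ 2 := by rw [hR2, hA]; linarith
      exact le_of_mul_le_mul_left this hε
    have := abs_le.1 (abs_le_of_sq_le_sq h2 hR0)
    constructor <;> simp only <;> linarith [this.1, this.2]
  have hcont : ContinuousOn (fun p : (ℝ × ℝ) × ℝ => f p.1 + -ε * (p.2 - n) ^ 2) P := by
    refine ContinuousOn.add (hf.comp continuousOn_fst fun p hp => hp.2.1) ?_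
    fun_prop
  obtain ⟨⟨y, w⟩, hyP, hymax⟩ := hP.exists_isMaxOn ⟨_, hx0P⟩ hcont
  obtain ⟨⟨hyΩ, hyw⟩, hyN, hyR⟩ := hyP
  simp only at hyΩ hyw hyN hyR
  subst hyw
  refine ⟨y, ⟨hyN, hyΩ⟩, fun x hx => ?_⟩
  have hAy : A ≤ f y + -ε * (u.f y - n) ^ 2 := hymax hx0P
  by_cases hxR : u.f x ∈ Set.Icc (n - R) (n + R)
  · exact hymax (show (x, u.f x) ∈ P from ⟨⟨hx.2, rfl⟩, hx.1, hxR⟩)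
  · exact (hcase x hx hxR).trans hAy

/-- A strict touching of the complement of the domain from outside is impossible. -/
lemma TGraph.touching {α β : ℝ} {Ω : Set (ℝ × ℝ)} {u : J2} (hu : TGraph α β Ω u)
    {f : J2} {U N : Set (ℝ × ℝ)} (hU : IsOpen U) (hf : f.On U) {c : ℝ × ℝ}
    (hc : c ∉ Ω) (hcl : c ∈ closure Ω) (hN : IsCompact N) (hNc : N ∈ 𝓝 c) (hNU : N ⊆ U)
    (hstrict : ∀ x ∈ N, x ∉ Ω → x ≠ c → f.f x < f.f c) : f.Q α c ≤ 0 := by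
  by_contra hQ
  push Not at hQ
  have hcN := mem_of_mem_nhds hNc
  have hcU := hNU hcN
  set G := f.s c ^ 2 + f.t c ^ 2 with hG
  have hG0 : 0 ≤ G := by positivity
  set ε := f.Q α c / (4 * (G + 1)) with hε
  have hε0 : 0 < ε := by positivity
  have hεG : 2 * ε * G < f.Q α c := by
    rw [hε]
    have : 2 * (f.Q α c / (4 * (G + 1))) * G = f.Q α c * (G / (2 * (G + 1))) := by
      field_simp; ring
    rw [this]
    have h2 : G / (2 * (G + 1)) < 1 := by rw [div_lt_one (by positivity)]; linarith
    nlinarith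
  have hfN : ContinuousOn f.f N := fun x hx => (hf.cf (hNU hx)).continuousWithinAt
  obtain ⟨M, hM⟩ := (hN.image_of_continuousOn hfN).bddAbove
  obtain ⟨x', hx'Ω, hx'lim⟩ := mem_closure_iff_seq_limit.1 hcl
  obtain ⟨k0, hk0⟩ := eventually_atTop.1 (hx'lim hNc)
  set x : ℕ → ℝ × ℝ := fun k => x' (k + k0) with hx
  have hxΩ : ∀ k, x k ∈ Ω := fun k => hx'Ω _
  have hxN : ∀ k, x k ∈ N := fun k => hk0 _ (Nat.le_add_left _ _)
  have hxlim : Tendsto x atTop (𝓝 c) := hx'lim.comp (tendsto_add_atTop_nat k0)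
  choose y hyNΩ hymax using fun k =>
    hu.exists_max hN hfN hε0 (u.f (x k)) ⟨x k, hxN k, hxΩ k⟩
  have hval : ∀ k, f.f (x k) ≤ f.f (y k) + -ε * (u.f (y k) - u.f (x k)) ^ 2 := fun k => by
    have := hymax k (x k) ⟨hxN k, hxΩ k⟩
    simpa using this
  obtain ⟨y0, hy0N, φ, hφ, hylim⟩ := hN.tendsto_subseq fun k => (hyNΩ k).1
  have hxφ : Tendsto (fun k => x (φ k)) atTop (𝓝 c) := hxlim.comp hφ.tendsto_atTop
  have hfx : Tendsto (fun k => f.f (x (φ k))) atTop (𝓝 (f.f c)) := (hf.cf hcU).tendsto.comp hxφ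
  have hfy : Tendsto (fun k => f.f (y (φ k))) atTop (𝓝 (f.f y0)) :=
    (hf.cf (hNU hy0N)).tendsto.comp hylim
  have hy0Ω : y0 ∉ Ω := by
    intro hy0
    have huy : Tendsto (fun k => u.f (y (φ k))) atTop (𝓝 (u.f y0)) :=
      (hu.on.cf hy0).tendsto.comp hylim
    have b1 : ∀ᶠ k in atTop, |u.f (y (φ k))| < |u.f y0| + 1 :=
      (huy.abs).eventually_lt_const (by linarith)
    have b2 := hu.not_tendsto_of_notMem hc (fun k => hxΩ (φ k)) hxφ
      (|u.f y0| + 1 + √((M - f.f c + 1) / ε))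
    have b3 : ∀ᶠ k in atTop, f.f c - 1 < f.f (x (φ k)) :=
      hfx.eventually_const_lt (by linarith)
    obtain ⟨k, h1, h2, h3⟩ := (b1.and (b2.and b3)).exists
    have hMk := hM ⟨y (φ k), (hyNΩ _).1, rfl⟩
    have hv := hval (φ k)
    have hfc : f.f c ≤ M := hM ⟨c, hcN, rfl⟩
    set R := √((M - f.f c + 1) / ε)
    have hR2 : ε * R ^ 2 = M - f.f c + 1 := by
      rw [Real.sq_sqrt (div_nonneg (by linarith) hε0.le)]; field_simp
    have hR : R < |u.f (y (φ k)) - u.f (x (φ k))| := by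
      have := abs_sub_abs_le_abs_sub (u.f (x (φ k))) (u.f (y (φ k)))
      rw [abs_sub_comm] at this
      linarith
    have hsq : R ^ 2 < (u.f (y (φ k)) - u.f (x (φ k))) ^ 2 := by
      rw [← sq_abs (u.f (y (φ k)) - u.f (x (φ k)))]
      exact pow_lt_pow_left₀ hR (Real.sqrt_nonneg _) two_ne_zero
    nlinarith
  have hy0c : y0 = c := by
    by_contra hne
    have h1 := hstrict y0 hy0N hy0Ω hne
    have h2 : f.f c ≤ f.f y0 := le_of_tendsto_of_tendsto' hfx hfy fun k => by
      nlinarith [hval (φ k), mul_nonneg hε0.le (sq_nonneg (u.f (y (φ k)) - u.f (x (φ k))))]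
    linarith
  subst hy0c
  have hd : Tendsto (fun k => u.f (y (φ k)) - u.f (x (φ k))) atTop (𝓝 0) := by
    have hsq : Tendsto (fun k => (u.f (y (φ k)) - u.f (x (φ k))) ^ 2) atTop (𝓝 0) := by
      have hup : Tendsto (fun k => (f.f (y (φ k)) - f.f (x (φ k))) / ε) atTop (𝓝 0) := by
        simpa using (hfy.sub hfx).div_const ε
      refine squeeze_zero (fun k => sq_nonneg _) (fun k => ?_) hup
      rw [le_div_iff₀ hε0]
      linarith [hval (φ k)]
    have := (Real.continuous_sqrt.tendsto 0).comp hsq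
    simp only [Real.sqrt_zero, Function.comp_def, Real.sqrt_sq_eq_abs] at this
    exact (tendsto_zero_iff_abs_tendsto_zero _).2 this
  have hm : Tendsto (fun k => 2 * ε * (u.f (y (φ k)) - u.f (x (φ k)))) atTop (𝓝 0) := by
    simpa using hd.const_mul (2 * ε)
  have ev : ∀ᶠ k in atTop, 0 ≤ 2 * ε * (f.s (y (φ k)) ^ 2 + f.t (y (φ k)) ^ 2)
      + (2 * ε * (u.f (y (φ k)) - u.f (x (φ k)))) * ((2 * ε * (u.f (y (φ k)) - u.f (x (φ k)))) ^ 2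
        + (f.s (y (φ k)) ^ 2 + f.t (y (φ k)) ^ 2)) * β
      - α * (2 * ε * (u.f (y (φ k)) - u.f (x (φ k)))) ^ 2 * f.t (y (φ k))
      - (2 * ε * (u.f (y (φ k)) - u.f (x (φ k)))) ^ 2 * (f.ss (y (φ k)) + f.tt (y (φ k)))
      - f.Q α (y (φ k)) := by
    filter_upwards [hylim (eventually_mem_nhds_iff.2 hNc)] with k hk
    have hk : N ∈ 𝓝 (y (φ k)) := hk
    refine hu.touching_ineq hU hf (hNU (hyNΩ _).1) (hyNΩ _).2 ?_
    filter_upwards [hk, hu.isOpen.mem_nhds (hyNΩ (φ k)).2] with z hz1 hz2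
    exact hymax (φ k) z ⟨hz1, hz2⟩
  have ls := (hf.cs hcU).tendsto.comp hylim
  have lt := (hf.ct hcU).tendsto.comp hylim
  have lss := (hf.css _ hcU).tendsto.comp hylim
  have lst := (hf.cst _ hcU).tendsto.comp hylim
  have ltt := (hf.ctt _ hcU).tendsto.comp hylim
  have lG := (ls.pow 2).add (lt.pow 2)
  have lQ : Tendsto (fun k => f.Q α (y (φ k))) atTop (𝓝 (f.Q α y0)) :=
    ((((lt.pow 2).mul lss).sub (((ls.const_mul 2).mul lt).mul lst)).add
      ((ls.pow 2).mul ltt)).add ((lt.const_mul α).mul lG)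
  have lim := (((((lG.const_mul (2 * ε)).add ((hm.mul ((hm.pow 2).add lG)).mul_const β)).sub
      (((hm.pow 2).const_mul α).mul lt)).sub ((hm.pow 2).mul (lss.add ltt))).sub lQ)
  have := ge_of_tendsto lim ev
  simp only [ne_eq, OfNat.ofNat_ne_zero, not_false_eq_true, zero_pow, zero_add, zero_mul, mul_zero,
    add_zero, sub_zero] at this
  linarith

namespace J2

/-- The product of a function of `s` and a function of `t`. -/
def prod (p p' p'' q q' q'' : ℝ → ℝ) : J2 where
  f x := p x.1 * q x.2
  s x := p' x.1 * q x.2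
  t x := p x.1 * q' x.2
  ss x := p'' x.1 * q x.2
  st x := p' x.1 * q' x.2
  tt x := p x.1 * q'' x.2

lemma hasFDerivAt_prod {p q : ℝ → ℝ} {a b : ℝ} {x : ℝ × ℝ} (hp : HasDerivAt p a x.1)
    (hq : HasDerivAt q b x.2) :
    HasFDerivAt (fun x : ℝ × ℝ => p x.1 * q x.2) (lin (a * q x.2) (p x.1 * b)) x := by
  refine ((hp.comp_hasFDerivAt x hasFDerivAt_fst).mul
    (hq.comp_hasFDerivAt x hasFDerivAt_snd)).congr_fderiv ?_
  ext <;> simp; ring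

lemma prod_on {p p' p'' q q' q'' : ℝ → ℝ} (hp : ∀ y, HasDerivAt p (p' y) y)
    (hp' : ∀ y, HasDerivAt p' (p'' y) y) (cp : Continuous p'') (hq : ∀ y, HasDerivAt q (q' y) y)
    (hq' : ∀ y, HasDerivAt q' (q'' y) y) (cq : Continuous q'') (U : Set (ℝ × ℝ)) :
    (prod p p' p'' q q' q'').On U := by
  have c1 : Continuous p := continuous_iff_continuousAt.2 fun y => (hp y).continuousAt
  have c2 : Continuous p' := continuous_iff_continuousAt.2 fun y => (hp' y).continuousAt
  have c3 : Continuous q := continuous_iff_continuousAt.2 fun y => (hq y).continuousAt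
  have c4 : Continuous q' := continuous_iff_continuousAt.2 fun y => (hq' y).continuousAt
  refine ⟨fun x _ => hasFDerivAt_prod (hp _) (hq _), fun x _ => hasFDerivAt_prod (hp' _) (hq _),
    fun x _ => hasFDerivAt_prod (hp _) (hq' _), fun x _ => ?_, fun x _ => ?_, fun x _ => ?_⟩
  all_goals simp only [prod]; fun_prop

lemma hasDerivAt_exp_mul (γ y : ℝ) : HasDerivAt (fun y => exp (γ * y)) (γ * exp (γ * y)) y := by
  have := ((hasDerivAt_id y).const_mul γ).exp
  simp only [id] at this
  exact this.congr_deriv (by ring)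

/-- `p(s) e^{γt}`. -/
def pexp (γ : ℝ) (p p' p'' : ℝ → ℝ) : J2 :=
  prod p p' p'' (fun y => exp (γ * y)) (fun y => γ * exp (γ * y)) (fun y => γ * (γ * exp (γ * y)))

lemma pexp_on (γ : ℝ) {p p' p'' : ℝ → ℝ} (hp : ∀ y, HasDerivAt p (p' y) y)
    (hp' : ∀ y, HasDerivAt p' (p'' y) y) (cp : Continuous p'') (U : Set (ℝ × ℝ)) :
    (pexp γ p p' p'').On U :=
  prod_on hp hp' cp (hasDerivAt_exp_mul γ) (fun y => (hasDerivAt_exp_mul γ y).const_mul γ)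
    (by fun_prop) U

/-- The squared distance to `c`. -/
def sqd (c : ℝ × ℝ) : J2 :=
  prod (fun y => (y - c.1) ^ 2) (fun y => 2 * (y - c.1)) (fun _ => 2) (fun _ => 1)
    (fun _ => 0) (fun _ => 0)
  + prod (fun _ => 1) (fun _ => 0) (fun _ => 0) (fun y => (y - c.2) ^ 2) (fun y => 2 * (y - c.2))
    (fun _ => 2)

lemma hasDerivAt_sub_sq (a y : ℝ) : HasDerivAt (fun y => (y - a) ^ 2) (2 * (y - a)) y := by
  simpa using ((hasDerivAt_id y).sub_const a).fun_pow 2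

lemma hasDerivAt_two_mul_sub (a y : ℝ) : HasDerivAt (fun y => 2 * (y - a)) 2 y := by
  simpa using ((hasDerivAt_id y).sub_const a).const_mul 2

lemma sqd_on (c : ℝ × ℝ) (U : Set (ℝ × ℝ)) : (sqd c).On U :=
  (prod_on (hasDerivAt_sub_sq _) (hasDerivAt_two_mul_sub _) continuous_const
    (fun y => hasDerivAt_const y 1) (fun y => hasDerivAt_const y 0) continuous_const U).add
  (prod_on (fun y => hasDerivAt_const y 1) (fun y => hasDerivAt_const y 0) continuous_const
    (hasDerivAt_sub_sq _) (hasDerivAt_two_mul_sub _) continuous_const U)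

/-- A function whose Hessian for the flat metric is diagonal and positive. -/
def pert (α : ℝ) : J2 :=
  pexp (α + 1) (fun _ => 1) (fun _ => 0) (fun _ => 0)
  + pexp α (fun y => (y - 0) ^ 2) (fun y => 2 * (y - 0)) (fun _ => 2)

lemma pert_on (α : ℝ) (U : Set (ℝ × ℝ)) : (pert α).On U :=
  (pexp_on _ (fun y => hasDerivAt_const y 1) (fun y => hasDerivAt_const y 0) continuous_const U).add
  (pexp_on _ (hasDerivAt_sub_sq _) (hasDerivAt_two_mul_sub _) continuous_const U)

lemma pert_Hst (α : ℝ) (x : ℝ × ℝ) : (pert α).Hst α x = 0 := by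
  simp only [pert, Hst, add_st, add_s, pexp, prod]; ring

lemma pert_Hss_pos {α : ℝ} (hα : 0 ≤ α) (x : ℝ × ℝ) : 0 < (pert α).Hss α x := by
  have : (pert α).Hss α x = α * (α + 1) * exp ((α + 1) * x.2)
      + (2 + α ^ 2 * x.1 ^ 2) * exp (α * x.2) := by
    simp only [pert, Hss, add_ss, add_t, pexp, prod]; ring
  rw [this]; positivity

lemma pert_Htt_pos {α : ℝ} (hα : 0 ≤ α) (x : ℝ × ℝ) : 0 < (pert α).Htt α x := by
  have : (pert α).Htt α x = (α + 1) * exp ((α + 1) * x.2) := by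
    simp only [pert, Htt, add_tt, add_t, pexp, prod]; ring
  rw [this]; positivity

end J2

set_option maxHeartbeats 1000000 in
/-- Maximum principle: the complement of the domain cannot enter `{g > 0}` through the interior. -/
lemma TGraph.max_principle {α β : ℝ} {Ω : Set (ℝ × ℝ)} {u : J2} (hu : TGraph α β Ω u)
    (hα : 0 ≤ α) {g : J2} {U N : Set (ℝ × ℝ)} (hU : IsOpen U) (hg : g.On U) (hN : IsCompact N)
    (hNU : N ⊆ U) (hpsd : g.Psd α N) (hne : ∀ x ∈ N, g.s x ≠ 0 ∨ g.t x ≠ 0)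
    (hbd : ∀ x ∈ N, x ∉ Ω → 0 < g.f x → N ∈ 𝓝 x) : ∀ x ∈ N, x ∉ Ω → g.f x ≤ 0 := by
  by_contra hcon
  push Not at hcon
  obtain ⟨c0, hc0N, hc0Ω, hc0⟩ := hcon
  have hgN : ContinuousOn g.f N := fun x hx => (hg.cf (hNU hx)).continuousWithinAt
  set P := pert α with hP
  have hPon : P.On U := pert_on α U
  have hPN : ContinuousOn P.f N := fun x hx => (hPon.cf (hNU hx)).continuousWithinAt
  obtain ⟨M, hM⟩ := (hN.image_of_continuousOn (hPN.abs)).bddAbove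
  have hM' : ∀ x ∈ N, |P.f x| ≤ M := fun x hx => hM ⟨x, hx, rfl⟩
  have hM0 : 0 ≤ M := (abs_nonneg _).trans (hM' _ hc0N)
  have cg : ContinuousOn (fun x => g.s x ^ 2 + g.t x ^ 2) N := fun x hx =>
    (((hg.cs (hNU hx)).pow 2).add ((hg.ct (hNU hx)).pow 2)).continuousWithinAt
  have cP : ContinuousOn (fun x => P.s x ^ 2 + P.t x ^ 2) N := fun x hx =>
    (((hPon.cs (hNU hx)).pow 2).add ((hPon.ct (hNU hx)).pow 2)).continuousWithinAt
  obtain ⟨x1, hx1, hmin⟩ := hN.exists_isMinOn ⟨c0, hc0N⟩ cg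
  have hκ : 0 < g.s x1 ^ 2 + g.t x1 ^ 2 := by
    rcases hne x1 hx1 with h | h <;> positivity
  obtain ⟨M2, hM2⟩ := (hN.image_of_continuousOn cP).bddAbove
  have hM2' : ∀ x ∈ N, P.s x ^ 2 + P.t x ^ 2 ≤ M2 := fun x hx => hM2 ⟨x, hx, rfl⟩
  have hM20 : 0 ≤ M2 := (by positivity : (0 : ℝ) ≤ P.s c0 ^ 2 + P.t c0 ^ 2).trans (hM2' _ hc0N)
  obtain ⟨ε, hε, hε1, hε2⟩ : ∃ ε > 0, ε * (2 * M) < g.f c0 ∧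
      ε ^ 2 * M2 < g.s x1 ^ 2 + g.t x1 ^ 2 := by
    have l1 : ∀ᶠ ε in 𝓝[>] (0 : ℝ), ε * (2 * M) < g.f c0 := by
      apply Filter.Eventually.filter_mono nhdsWithin_le_nhds
      have : ContinuousAt (fun ε : ℝ => ε * (2 * M)) 0 := by fun_prop
      exact this.eventually_lt_const (by simpa using hc0)
    have l2 : ∀ᶠ ε in 𝓝[>] (0 : ℝ), ε ^ 2 * M2 < g.s x1 ^ 2 + g.t x1 ^ 2 := by
      apply Filter.Eventually.filter_mono nhdsWithin_le_nhds
      have : ContinuousAt (fun ε : ℝ => ε ^ 2 * M2) 0 := by fun_prop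
      exact this.eventually_lt_const (by simpa using hκ)
    obtain ⟨ε, h1, h2, h3⟩ := (l1.and (l2.and self_mem_nhdsWithin)).exists
    exact ⟨ε, h3, h1, h2⟩
  have hNC : IsCompact (N \ Ω) := hN.diff hu.isOpen
  obtain ⟨c, ⟨hcN, hcΩ⟩, hmax⟩ := hNC.exists_isMaxOn ⟨c0, hc0N, hc0Ω⟩
    (f := fun x => g.f x + ε * P.f x)
    ((hgN.add (continuousOn_const.mul hPN)).mono Set.sdiff_subset)
  have hcpos : 0 < g.f c := by
    have h1 : g.f c0 + ε * P.f c0 ≤ g.f c + ε * P.f c := hmax ⟨hc0N, hc0Ω⟩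
    have h2 := mul_le_mul_of_nonneg_left (neg_le_of_abs_le (hM' c0 hc0N)) hε.le
    have h3 := mul_le_mul_of_nonneg_left (le_of_abs_le (hM' c hcN)) hε.le
    linarith
  have hNc := hbd c hcN hcΩ hcpos
  set lam := min (P.Hss α c) (P.Htt α c) with hlam
  have hlam0 : 0 < lam := lt_min (pert_Hss_pos hα c) (pert_Htt_pos hα c)
  set μ := ε * lam / 4 with hμ
  have hμ0 : 0 < μ := by positivity
  set f : J2 := (g + ε • P) + (-μ) • sqd c with hf
  have hfon : f.On U := (hg.add (hPon.smul ε)).add ((sqd_on c U).smul _)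
  have fval : ∀ x, f.f x = g.f x + ε * P.f x + -μ * ((x.1 - c.1) ^ 2 + (x.2 - c.2) ^ 2) := by
    intro x; simp only [hf, add_f, smul_f, sqd, J2.prod]; ring
  have fs : f.s c = g.s c + ε * P.s c := by
    simp only [hf, add_s, smul_s, sqd, J2.prod]; ring
  have ft : f.t c = g.t c + ε * P.t c := by
    simp only [hf, add_t, smul_t, sqd, J2.prod]; ring
  have hgrad : 0 < f.s c ^ 2 + f.t c ^ 2 := by
    by_contra h0
    have h0s : f.s c = 0 := by nlinarith [sq_nonneg (f.s c), sq_nonneg (f.t c)]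
    have h0t : f.t c = 0 := by nlinarith [sq_nonneg (f.s c), sq_nonneg (f.t c)]
    rw [fs] at h0s
    rw [ft] at h0t
    have a1 : g.s c = -(ε * P.s c) := by linarith
    have a2 : g.t c = -(ε * P.t c) := by linarith
    have a3 : g.s x1 ^ 2 + g.t x1 ^ 2 ≤ g.s c ^ 2 + g.t c ^ 2 := hmin hcN
    rw [a1, a2] at a3
    nlinarith [mul_le_mul_of_nonneg_left (hM2' c hcN) (sq_nonneg ε)]
  have hsep : ∀ x ∈ N, x ∉ Ω → x ≠ c → f.f x < f.f c := by
    intro x hxN hxΩ hxc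
    have h1 : g.f x + ε * P.f x ≤ g.f c + ε * P.f c := hmax ⟨hxN, hxΩ⟩
    rw [fval, fval]
    have : 0 < (x.1 - c.1) ^ 2 + (x.2 - c.2) ^ 2 := by
      by_contra h0
      apply hxc
      ext <;> nlinarith [sq_nonneg (x.1 - c.1), sq_nonneg (x.2 - c.2)]
    nlinarith
  have hcl : c ∈ closure Ω := by
    by_contra hcl
    have hnb : (closure Ω)ᶜ ∈ 𝓝 c := isClosed_closure.isOpen_compl.mem_nhds hcl
    have hlm : IsLocalMax f.f c := by
      filter_upwards [hnb, hNc] with x hx1 hx2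
      by_cases hxc : x = c
      · rw [hxc]
      · exact (hsep x hx2 (fun h => hx1 (subset_closure h)) hxc).le
    obtain ⟨h1, h2, -⟩ := isLocalMax_jet (hU.mem_nhds (hNU hcN)) hfon hlm
    rw [h1, h2] at hgrad
    simp at hgrad
  have hQ := hu.touching hU hfon hcΩ hcl hN hNc hNU hsep
  rw [J2.Q_eq] at hQ
  have e1 : f.Hss α c = g.Hss α c + ε * P.Hss α c - 2 * μ := by
    simp only [hf, Hss, add_ss, add_t, smul_ss, smul_t, sqd, J2.prod]; ring
  have e2 : f.Hst α c = g.Hst α c := by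
    have := pert_Hst α c
    rw [← hP] at this
    simp only [Hst] at this
    simp only [hf, Hst, add_st, add_s, smul_st, smul_s, sqd, J2.prod]
    linear_combination ε * this
  have e3 : f.Htt α c = g.Htt α c + ε * P.Htt α c - 2 * μ := by
    simp only [hf, Htt, add_tt, add_t, smul_tt, smul_t, sqd, J2.prod]; ring
  rw [e1, e2, e3] at hQ
  have hp := hpsd c hcN (f.t c) (-f.s c)
  have q1 : ε * lam ≤ ε * P.Hss α c := mul_le_mul_of_nonneg_left (min_le_left _ _) hε.le
  have q2 : ε * lam ≤ ε * P.Htt α c := mul_le_mul_of_nonneg_left (min_le_right _ _) hε.le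
  have q3 : 2 * μ < ε * lam := by
    have : 0 < ε * lam := by positivity
    rw [hμ]; linarith
  nlinarith [mul_le_mul_of_nonneg_right q1 (sq_nonneg (f.t c)),
    mul_le_mul_of_nonneg_right q2 (sq_nonneg (f.s c)),
    mul_pos (sub_pos.2 q3) hgrad]

/-- Convex functions for the flat metric. -/
def FC (α : ℝ) (g : J2) : Prop := g.On Set.univ ∧ g.Psd α Set.univ

lemma FC.add {α : ℝ} {g h : J2} (hg : FC α g) (hh : FC α h) : FC α (g + h) := by
  refine ⟨hg.1.add hh.1, fun x _ a b => ?_⟩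
  have h1 := hg.2 x trivial a b
  have h2 := hh.2 x trivial a b
  simp only [Hss, Hst, Htt, add_ss, add_st, add_tt, add_s, add_t] at h1 h2 ⊢
  linarith

/-- The `C²` convex function `max x 0 ^ 3`. -/
lemma hasDerivAt_cube_pos (y : ℝ) :
    HasDerivAt (fun y : ℝ => max y 0 ^ 3) (3 * max y 0 ^ 2) y := by
  rcases lt_trichotomy y 0 with h | h | h
  · have : (fun y : ℝ => max y 0 ^ 3) =ᶠ[𝓝 y] fun _ => 0 := by
      filter_upwards [gt_mem_nhds h] with z hz
      simp [max_eq_right hz.le]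
    rw [max_eq_right h.le]
    simpa using (hasDerivAt_const y (0 : ℝ)).congr_of_eventuallyEq this
  · subst h
    simp only [max_self, ne_eq, OfNat.ofNat_ne_zero, not_false_eq_true, zero_pow, mul_zero]
    rw [hasDerivAt_iff_isLittleO_nhds_zero]
    simp only [zero_add, max_self, ne_eq, OfNat.ofNat_ne_zero, not_false_eq_true, zero_pow,
      sub_zero, smul_eq_mul, mul_zero]
    have h1 : (fun h : ℝ => max h 0 ^ 3) =O[𝓝 0] fun h : ℝ => h ^ 3 := by
      refine Asymptotics.isBigO_of_le _ fun h => ?_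
      rw [norm_pow, norm_pow]
      gcongr
      rcases le_total h 0 with h' | h' <;> simp [h']
    refine h1.trans_isLittleO ?_
    simpa using Asymptotics.isLittleO_pow_pow (𝕜 := ℝ) (m := 1) (n := 3) (by norm_num)
  · have : (fun y : ℝ => max y 0 ^ 3) =ᶠ[𝓝 y] fun y => y ^ 3 := by
      filter_upwards [lt_mem_nhds h] with z hz
      simp [max_eq_left hz.le]
    rw [max_eq_left h.le]
    simpa using (hasDerivAt_pow 3 y).congr_of_eventuallyEq this

lemma hasDerivAt_sq_pos (y : ℝ) :
    HasDerivAt (fun y : ℝ => 3 * max y 0 ^ 2) (6 * max y 0) y := by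
  rcases lt_trichotomy y 0 with h | h | h
  · have : (fun y : ℝ => 3 * max y 0 ^ 2) =ᶠ[𝓝 y] fun _ => 0 := by
      filter_upwards [gt_mem_nhds h] with z hz
      simp [max_eq_right hz.le]
    rw [max_eq_right h.le]
    simpa using (hasDerivAt_const y (0 : ℝ)).congr_of_eventuallyEq this
  · subst h
    simp only [max_self, mul_zero]
    rw [hasDerivAt_iff_isLittleO_nhds_zero]
    simp only [zero_add, max_self, ne_eq, OfNat.ofNat_ne_zero, not_false_eq_true, zero_pow,
      sub_zero, smul_eq_mul, mul_zero]
    have h1 : (fun h : ℝ => 3 * max h 0 ^ 2) =O[𝓝 0] fun h : ℝ => h ^ 2 := by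
      refine Asymptotics.IsBigO.const_mul_left (Asymptotics.isBigO_of_le _ fun h => ?_) 3
      rw [norm_pow, norm_pow]
      gcongr
      rcases le_total h 0 with h' | h' <;> simp [h']
    refine h1.trans_isLittleO ?_
    simpa using Asymptotics.isLittleO_pow_pow (𝕜 := ℝ) (m := 1) (n := 2) (by norm_num)
  · have : (fun y : ℝ => 3 * max y 0 ^ 2) =ᶠ[𝓝 y] fun y => 3 * y ^ 2 := by
      filter_upwards [lt_mem_nhds h] with z hz
      simp [max_eq_left hz.le]
    rw [max_eq_left h.le]
    have h2 := ((hasDerivAt_pow 2 y).const_mul 3).congr_of_eventuallyEq this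
    refine h2.congr_deriv ?_
    norm_num; ring

/-- Truncated cube `max (g - b) 0 ^ 3`. -/
def J2.cut (b : ℝ) (g : J2) : J2 :=
  J2.comp (fun y => max (y - b) 0 ^ 3) (fun y => 3 * max (y - b) 0 ^ 2)
    (fun y => 6 * max (y - b) 0) g

lemma J2.On.cut {g : J2} {U : Set (ℝ × ℝ)} (b : ℝ) (hg : g.On U) : (g.cut b).On U :=
  hg.comp (fun y => (hasDerivAt_cube_pos (y - b)).comp_sub_const y b)
    (fun y => (hasDerivAt_sq_pos (y - b)).comp_sub_const y b) (by fun_prop)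

lemma J2.Psd.cut {α : ℝ} {g : J2} {U : Set (ℝ × ℝ)} (b : ℝ) (hg : g.Psd α U) :
    (g.cut b).Psd α U := by
  intro x hx p q
  have h1 := hg x hx p q
  simp only [Hss, Hst, Htt, J2.cut, J2.comp] at h1 ⊢
  have h2 : 0 ≤ 3 * max (g.f x - b) 0 ^ 2 := by positivity
  have h3 : 0 ≤ 6 * max (g.f x - b) 0 := by positivity
  nlinarith [mul_nonneg h2 h1, mul_nonneg h3 (sq_nonneg (g.s x * p + g.t x * q))]

lemma FC.cut {α : ℝ} {g : J2} (b : ℝ) (hg : FC α g) : FC α (g.cut b) :=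
  ⟨hg.1.cut b, hg.2.cut b⟩

lemma J2.cut_f (b : ℝ) (g : J2) (x : ℝ × ℝ) : (g.cut b).f x = max (g.f x - b) 0 ^ 3 := rfl

/-- `e^{αt} h(s)` with `h'' + α² h ≥ 0`. -/
lemma FC_pexp {α : ℝ} {p p' p'' : ℝ → ℝ} (hp : ∀ y, HasDerivAt p (p' y) y)
    (hp' : ∀ y, HasDerivAt p' (p'' y) y) (cp : Continuous p'')
    (h : ∀ y, 0 ≤ p'' y + α ^ 2 * p y) : FC α (pexp α p p' p'') := by
  refine ⟨pexp_on α hp hp' cp _, fun x _ a b => ?_⟩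
  have : 0 ≤ (p'' x.1 + α ^ 2 * p x.1) * exp (α * x.2) * a ^ 2 := by
    have := h x.1; positivity
  simp only [Hss, Hst, Htt, pexp, J2.prod]
  nlinarith

/-- Constant function. -/
def J2.const (C : ℝ) : J2 :=
  ⟨fun _ => C, fun _ => 0, fun _ => 0, fun _ => 0, fun _ => 0, fun _ => 0⟩

lemma FC_const (α C : ℝ) : FC α (J2.const C) := by
  have h0 : ∀ (C : ℝ) x, HasFDerivAt (fun _ : ℝ × ℝ => C) (lin 0 0) x := fun C x => by
    refine (hasFDerivAt_const C x).congr_fderiv ?_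
    ext <;> simp
  refine ⟨⟨fun x _ => h0 C x, fun x _ => h0 0 x, fun x _ => h0 0 x, fun x _ => continuousAt_const,
    fun x _ => continuousAt_const, fun x _ => continuousAt_const⟩, fun x _ a b => ?_⟩
  simp [J2.const, Hss, Hst, Htt]

/-- `e^{αt}(A cos(α(s-σ)) + B sin(α(s-σ))) + C`. -/
def sinu (α σ A B C : ℝ) : J2 :=
  pexp α (fun y => A * cos (α * (y - σ)) + B * sin (α * (y - σ)))
    (fun y => α * (-A * sin (α * (y - σ)) + B * cos (α * (y - σ))))
    (fun y => -α ^ 2 * (A * cos (α * (y - σ)) + B * sin (α * (y - σ)))) + J2.const C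

lemma sinu_f (α σ A B C : ℝ) (x : ℝ × ℝ) : (sinu α σ A B C).f x =
    (A * cos (α * (x.1 - σ)) + B * sin (α * (x.1 - σ))) * exp (α * x.2) + C := rfl

lemma FC_sinu (α σ A B C : ℝ) : FC α (sinu α σ A B C) := by
  have hl : ∀ y, HasDerivAt (fun y => α * (y - σ)) α y := fun y => by
    simpa using ((hasDerivAt_id y).sub_const σ).const_mul α
  refine (FC_pexp (fun y => ?_) (fun y => ?_) (by fun_prop) (fun y => ?_)).add (FC_const _ _)
  · refine (((hl y).cos.const_mul A).add ((hl y).sin.const_mul B)).congr_deriv ?_; ring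
  · refine ((((hl y).sin.const_mul (-A)).add ((hl y).cos.const_mul B)).const_mul α).congr_deriv ?_
    ring
  · apply le_of_eq; ring

lemma sinu_grad {α σ A B C : ℝ} (hα : 0 < α) (h : A ≠ 0 ∨ B ≠ 0) (x : ℝ × ℝ) :
    (sinu α σ A B C).s x ≠ 0 ∨ (sinu α σ A B C).t x ≠ 0 := by
  by_contra hcon
  push Not at hcon
  obtain ⟨h1, h2⟩ := hcon
  simp only [sinu, add_s, add_t, pexp, J2.prod, J2.const, add_zero] at h1 h2
  have he := (exp_pos (α * x.2)).ne'
  have k1 : -A * sin (α * (x.1 - σ)) + B * cos (α * (x.1 - σ)) = 0 := by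
    simpa [hα.ne', he] using h1
  have k2 : A * cos (α * (x.1 - σ)) + B * sin (α * (x.1 - σ)) = 0 := by
    simpa [hα.ne', he] using h2
  have hsc := sin_sq_add_cos_sq (α * (x.1 - σ))
  set S := sin (α * (x.1 - σ))
  set D := cos (α * (x.1 - σ))
  have hA : A = 0 := by linear_combination -A * hsc - S * k1 + D * k2
  have hB : B = 0 := by linear_combination -B * hsc + D * k1 + S * k2
  rcases h with h | h <;> contradiction

/-- A chart of the plane in which the flat metric is Euclidean. -/
def IsChart (α : ℝ) (Φ : OpenPartialHomeomorph (ℝ × ℝ) (ℝ × ℝ)) : Prop :=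
  ∀ A B C : ℝ, ∃ g : J2, FC α g ∧ (∀ x, g.f x = A * (Φ x).1 + B * (Φ x).2 + C) ∧
    ((A ≠ 0 ∨ B ≠ 0) → ∀ x, g.s x ≠ 0 ∨ g.t x ≠ 0)

lemma isChart_refl : IsChart 0 (OpenPartialHomeomorph.refl (ℝ × ℝ)) := by
  intro A B C
  refine ⟨⟨fun x => A * x.1 + B * x.2 + C, fun _ => A, fun _ => B, fun _ => 0, fun _ => 0,
    fun _ => 0⟩, ⟨⟨fun x _ => ?_, fun x _ => ?_, fun x _ => ?_, fun x _ => continuousAt_const,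
    fun x _ => continuousAt_const, fun x _ => continuousAt_const⟩, fun x _ a b => ?_⟩,
    fun x => rfl, fun h x => h⟩
  · have := (lin A B).hasFDerivAt (x := x)
    simpa [funext_iff] using this.add_const C
  · refine (hasFDerivAt_const A x).congr_fderiv ?_
    ext <;> simp
  · refine (hasFDerivAt_const B x).congr_fderiv ?_
    ext <;> simp
  · simp [Hss, Hst, Htt]

/-- The polar chart centred at `σ`. -/
def polarChart (α σ : ℝ) (hα : 0 < α) : OpenPartialHomeomorph (ℝ × ℝ) (ℝ × ℝ) where
  toFun x := (exp (α * x.2) * cos (α * (x.1 - σ)), exp (α * x.2) * sin (α * (x.1 - σ)))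
  invFun p := (σ + (polarCoord p).2 / α, log (polarCoord p).1 / α)
  source := {x | α * (x.1 - σ) ∈ Set.Ioo (-π) π}
  target := polarCoord.source
  map_source' x hx := polarCoord.symm.map_source (x := (exp (α * x.2), α * (x.1 - σ)))
    ⟨exp_pos _, hx⟩
  map_target' p hp := by
    have := (polarCoord.map_source hp).2
    simpa [mul_div_cancel₀ _ hα.ne'] using this
  left_inv' x hx := by
    have h : polarCoord (exp (α * x.2) * cos (α * (x.1 - σ)), exp (α * x.2) * sin (α * (x.1 - σ)))
        = (exp (α * x.2), α * (x.1 - σ)) :=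
      polarCoord.right_inv (x := (exp (α * x.2), α * (x.1 - σ))) ⟨exp_pos _, hx⟩
    rw [h]
    ext <;> simp [hα.ne']
  right_inv' p hp := by
    have h1 : 0 < (polarCoord p).1 := (polarCoord.map_source hp).1
    have h2 : polarCoord.symm (polarCoord p) = p := polarCoord.left_inv hp
    have e1 : α * (log (polarCoord p).1 / α) = log (polarCoord p).1 := by field_simp
    have e2 : α * (σ + (polarCoord p).2 / α - σ) = (polarCoord p).2 := by field_simp; ring
    simp only [e1, e2, exp_log h1]
    exact h2
  open_source := isOpen_Ioo.preimage (f := fun x : ℝ × ℝ => α * (x.1 - σ)) (by fun_prop)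
  open_target := polarCoord.open_source
  continuousOn_toFun := by fun_prop
  continuousOn_invFun := by
    have hc : ContinuousOn polarCoord polarCoord.source := polarCoord.continuousOn
    have h1 : ContinuousOn (fun p => (polarCoord p).1) polarCoord.source :=
      continuous_fst.comp_continuousOn hc
    have h2 : ContinuousOn (fun p => (polarCoord p).2) polarCoord.source :=
      continuous_snd.comp_continuousOn hc
    refine ContinuousOn.prodMk (continuousOn_const.add (h2.div_const α)) ?_
    exact (h1.log fun p hp => ne_of_gt (polarCoord.map_source hp).1).div_const α

lemma polarChart_apply {α σ : ℝ} (hα : 0 < α) (x : ℝ × ℝ) : polarChart α σ hα x =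
    (exp (α * x.2) * cos (α * (x.1 - σ)), exp (α * x.2) * sin (α * (x.1 - σ))) := rfl

lemma isChart_polarChart {α : ℝ} (σ : ℝ) (hα : 0 < α) : IsChart α (polarChart α σ hα) := by
  intro A B C
  refine ⟨sinu α σ A B C, FC_sinu _ _ _ _ _, fun x => ?_, fun h x => sinu_grad hα h x⟩
  rw [sinu_f, polarChart_apply]; ring

lemma starConvex_polarCoord_source {X : ℝ} (hX : 0 < X) :
    StarConvex ℝ ((X, 0) : ℝ × ℝ) polarCoord.source := by
  intro y hy a b ha hb hab
  rw [polarCoord_source] at hy ⊢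
  simp only [Set.mem_union, Set.mem_ofPred_eq, Prod.fst_add, Prod.smul_fst, smul_eq_mul,
    Prod.snd_add, Prod.smul_snd, mul_zero, zero_add] at hy ⊢
  rcases hb.eq_or_lt with rfl | hb
  · left; rw [add_zero] at hab; subst hab; simpa using hX
  · rcases hy with hy | hy
    · left; nlinarith [mul_nonneg ha hX.le, mul_pos hb hy]
    · right; exact mul_ne_zero hb.ne' hy

/-- Image of the domain in a chart. -/
def chartImage (Φ : OpenPartialHomeomorph (ℝ × ℝ) (ℝ × ℝ)) (Ω : Set (ℝ × ℝ)) : Set (ℝ × ℝ) :=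
  Φ.target ∩ Φ.symm ⁻¹' Ω

lemma isOpen_chartImage (Φ : OpenPartialHomeomorph (ℝ × ℝ) (ℝ × ℝ)) {Ω : Set (ℝ × ℝ)}
    (hΩ : IsOpen Ω) : IsOpen (chartImage Φ Ω) := Φ.symm.isOpen_inter_preimage hΩ

def triSet : Set (ℝ × ℝ) := {l | 0 ≤ l.1 ∧ 0 ≤ l.2 ∧ l.1 + l.2 ≤ 1}

lemma isCompact_triSet : IsCompact triSet := by
  refine (isCompact_Icc (a := ((0, 0) : ℝ × ℝ)) (b := (1, 1))).of_isClosed_subset ?_ ?_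
  · have h1 : IsClosed {l : ℝ × ℝ | 0 ≤ l.1} := isClosed_le continuous_const continuous_fst
    have h2 : IsClosed {l : ℝ × ℝ | 0 ≤ l.2} := isClosed_le continuous_const continuous_snd
    have h3 : IsClosed {l : ℝ × ℝ | l.1 + l.2 ≤ 1} :=
      isClosed_le (by fun_prop) continuous_const
    exact h1.inter (h2.inter h3)
  · rintro ⟨a, b⟩ ⟨h1, h2, h3⟩
    simp only at h1 h2 h3
    exact ⟨⟨h1, h2⟩, ⟨by simp only; linarith, by simp only; linarith⟩⟩

lemma TGraph.triangle_of_det {α β : ℝ} {Ω : Set (ℝ × ℝ)} {u : J2} (hu : TGraph α β Ω u)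
    (hα : 0 ≤ α) {Φ : OpenPartialHomeomorph (ℝ × ℝ) (ℝ × ℝ)} (hΦ : IsChart α Φ)
    {p v w : ℝ × ℝ} (hD : v.1 * w.2 - v.2 * w.1 ≠ 0) {η : ℝ} (hη : 0 < η)
    (hT : ∀ l ∈ triSet, p + (1 + η) • (l.1 • v + l.2 • w) ∈ Φ.target)
    (hS : ∀ l ∈ triSet, l.1 * l.2 = 0 → p + (1 + η) • (l.1 • v + l.2 • w) ∈ chartImage Φ Ω) :
    ∀ l ∈ triSet, p + (l.1 • v + l.2 • w) ∈ chartImage Φ Ω := by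
  set D := v.1 * w.2 - v.2 * w.1 with hDdef
  set lam : ℝ × ℝ → ℝ := fun z => ((z.1 - p.1) * w.2 - (z.2 - p.2) * w.1) / D with hlam
  set mu : ℝ × ℝ → ℝ := fun z => (v.1 * (z.2 - p.2) - v.2 * (z.1 - p.1)) / D with hmu
  have hη1 : 0 < 1 + η := by linarith
  have clam : Continuous lam := by fun_prop
  have cmu : Continuous mu := by fun_prop
  have lam_comb : ∀ a b : ℝ, lam (p + (a • v + b • w)) = a := fun a b => by
    simp only [hlam, Prod.fst_add, Prod.snd_add, Prod.smul_fst, Prod.smul_snd, smul_eq_mul]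
    field_simp; rw [hDdef]; ring
  have mu_comb : ∀ a b : ℝ, mu (p + (a • v + b • w)) = b := fun a b => by
    simp only [hmu, Prod.fst_add, Prod.snd_add, Prod.smul_fst, Prod.smul_snd, smul_eq_mul]
    field_simp; rw [hDdef]; ring
  have comb : ∀ z, p + (lam z • v + mu z • w) = z := fun z => by
    simp only [hlam, hmu]
    ext
    · simp only [Prod.fst_add, Prod.smul_fst, smul_eq_mul]
      field_simp; rw [hDdef]; ring
    · simp only [Prod.snd_add, Prod.smul_snd, smul_eq_mul]
      field_simp; rw [hDdef]; ring
  set T : Set (ℝ × ℝ) := (fun l : ℝ × ℝ => p + (1 + η) • (l.1 • v + l.2 • w)) '' triSet with hTdef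
  have hTiff : ∀ z, z ∈ T ↔ 0 ≤ lam z ∧ 0 ≤ mu z ∧ lam z + mu z ≤ 1 + η := by
    intro z
    constructor
    · rintro ⟨l, ⟨h1, h2, h3⟩, rfl⟩
      simp only [smul_add, smul_smul, lam_comb, mu_comb]
      refine ⟨by positivity, by positivity, ?_⟩
      nlinarith
    · rintro ⟨h1, h2, h3⟩
      refine ⟨(lam z / (1 + η), mu z / (1 + η)), ⟨by positivity, by positivity, ?_⟩, ?_⟩
      · simp only; rw [← add_div]; exact (div_le_one hη1).2 h3
      · simp only [smul_add, smul_smul, mul_div_cancel₀ _ hη1.ne', comb]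
  have hTc : IsCompact T := isCompact_triSet.image (by fun_prop)
  have hTt : T ⊆ Φ.target := by rintro _ ⟨l, hl, rfl⟩; exact hT l hl
  have hTe : ∀ z ∈ T, lam z = 0 ∨ mu z = 0 → z ∈ chartImage Φ Ω := by
    rintro _ ⟨l, hl, rfl⟩ h
    refine hS l hl ?_
    simp only [smul_add, smul_smul, lam_comb, mu_comb, mul_eq_zero, hη1.ne', false_or] at h
    exact mul_eq_zero.2 h
  obtain ⟨g, hg, hgf, hgne⟩ := hΦ (-(w.2 - v.2) / D) (-(v.1 - w.1) / D)
    (1 + η + (p.1 * (w.2 - v.2) + p.2 * (v.1 - w.1)) / D)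
  have hgf' : ∀ x, g.f x = 1 + η - lam (Φ x) - mu (Φ x) := fun x => by
    rw [hgf]; simp only [hlam, hmu]; field_simp; ring
  have hAB : -(w.2 - v.2) / D ≠ 0 ∨ -(v.1 - w.1) / D ≠ 0 := by
    by_contra hc
    push Not at hc
    obtain ⟨h1, h2⟩ := hc
    have h1 : v.2 - w.2 = 0 := by simpa [hD] using h1
    have h2 : w.1 - v.1 = 0 := by simpa [hD] using h2
    apply hD
    rw [hDdef]; linear_combination -v.1 * h1 - v.2 * h2
  have hNc : IsCompact (Φ.symm '' T) := hTc.image_of_continuousOn (Φ.symm.continuousOn.mono hTt)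
  have key := hu.max_principle hα isOpen_univ hg.1 hNc (Set.subset_univ _)
    (fun x _ => hg.2 x trivial) (fun x _ => hgne hAB x) ?_
  · intro l hl
    obtain ⟨h1, h2, h3⟩ := hl
    have hz : p + (l.1 • v + l.2 • w) ∈ T := by
      rw [hTiff, lam_comb, mu_comb]; exact ⟨h1, h2, by linarith⟩
    refine ⟨hTt hz, ?_⟩
    by_contra hΩ
    have := key _ ⟨_, hz, rfl⟩ hΩ
    rw [hgf', Φ.right_inv (hTt hz), lam_comb, mu_comb] at this
    linarith
  · rintro _ ⟨z, hz, rfl⟩ hzΩ hpos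
    rw [hgf', Φ.right_inv (hTt hz)] at hpos
    have hz' := (hTiff z).1 hz
    have n1 : lam z ≠ 0 := fun h => hzΩ (hTe z hz (Or.inl h)).2
    have n2 : mu z ≠ 0 := fun h => hzΩ (hTe z hz (Or.inr h)).2
    have p1 : 0 < lam z := lt_of_le_of_ne hz'.1 (Ne.symm n1)
    have p2 : 0 < mu z := lt_of_le_of_ne hz'.2.1 (Ne.symm n2)
    have hTn : T ∈ 𝓝 z := by
      have q1 := clam.continuousAt.eventually_const_lt p1
      have q2 := cmu.continuousAt.eventually_const_lt p2
      have q3 := (clam.add cmu).continuousAt.eventually_lt_const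
        (show lam z + mu z < 1 + η by linarith)
      filter_upwards [q1, q2, q3] with y y1 y2 y3
      exact (hTiff y).2 ⟨y1.le, y2.le, y3.le⟩
    exact Φ.symm.image_mem_nhds (hTt hz) hTn

/-- Two sides of a triangle contained in the domain force the third one to be. -/
lemma TGraph.triangle {α β : ℝ} {Ω : Set (ℝ × ℝ)} {u : J2} (hu : TGraph α β Ω u)
    (hα : 0 ≤ α) {Φ : OpenPartialHomeomorph (ℝ × ℝ) (ℝ × ℝ)} (hΦ : IsChart α Φ)
    {p x y : ℝ × ℝ}
    (hT : ∀ l ∈ triSet, p + (l.1 • (x - p) + l.2 • (y - p)) ∈ Φ.target)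
    (hx : ∀ τ ∈ Set.Icc (0 : ℝ) 1, p + τ • (x - p) ∈ chartImage Φ Ω)
    (hy : ∀ τ ∈ Set.Icc (0 : ℝ) 1, p + τ • (y - p) ∈ chartImage Φ Ω) :
    ∀ τ ∈ Set.Icc (0 : ℝ) 1, x + τ • (y - x) ∈ chartImage Φ Ω := by
  by_cases hxy : x = y
  · subst hxy
    intro τ _
    simpa using hx 1 (by simp)
  have hO := isOpen_chartImage Φ hu.isOpen
  set n : ℝ × ℝ := (-(y - x).2, (y - x).1) with hn
  set Z : ℝ → ℝ × ℝ → ℝ × ℝ := fun κ l =>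
    (p + κ • n) + (1 + |κ|) • (l.1 • (x - (p + κ • n)) + l.2 • (y - (p + κ • n))) with hZ
  have hZc : Continuous fun q : ℝ × (ℝ × ℝ) => Z q.1 q.2 := by
    simp only [hZ]; fun_prop
  have e1 : ∀ᶠ κ in 𝓝 (0 : ℝ), ∀ l ∈ triSet, Z κ l ∈ Φ.target := by
    refine isCompact_triSet.eventually_forall_of_forall_eventually fun l hl => ?_
    refine hZc.continuousAt.eventually (Φ.open_target.mem_nhds ?_)
    simpa [hZ] using hT l hl
  have e2 : ∀ᶠ κ in 𝓝 (0 : ℝ), ∀ l ∈ triSet ∩ {l | l.1 * l.2 = 0}, Z κ l ∈ chartImage Φ Ω := by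
    have hc : IsClosed {l : ℝ × ℝ | l.1 * l.2 = 0} :=
      isClosed_eq (by fun_prop) continuous_const
    refine (isCompact_triSet.inter_right hc).eventually_forall_of_forall_eventually fun l hl => ?_
    refine hZc.continuousAt.eventually (hO.mem_nhds ?_)
    obtain ⟨⟨h1, h2, h3⟩, h4⟩ := hl
    rcases mul_eq_zero.1 h4 with h | h
    · simpa [hZ, h] using hy l.2 ⟨h2, by linarith⟩
    · simpa [hZ, h] using hx l.1 ⟨h1, by linarith⟩
  have hn2 : 0 < (y - x).1 ^ 2 + (y - x).2 ^ 2 := by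
    by_contra h0
    apply hxy
    have h1 : (y - x).1 = 0 := by nlinarith [sq_nonneg (y - x).1, sq_nonneg (y - x).2]
    have h2 : (y - x).2 = 0 := by nlinarith [sq_nonneg (y - x).1, sq_nonneg (y - x).2]
    have : y - x = 0 := by ext <;> assumption
    exact (sub_eq_zero.1 this).symm
  have e3 : ∀ᶠ κ in 𝓝[>] (0 : ℝ), (x - (p + κ • n)).1 * (y - (p + κ • n)).2
      - (x - (p + κ • n)).2 * (y - (p + κ • n)).1 ≠ 0 := by
    have hform : ∀ κ : ℝ, (x - (p + κ • n)).1 * (y - (p + κ • n)).2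
      - (x - (p + κ • n)).2 * (y - (p + κ • n)).1 =
      ((x - p).1 * (y - p).2 - (x - p).2 * (y - p).1)
        + κ * ((y - x).1 ^ 2 + (y - x).2 ^ 2) := fun κ => by
      simp only [hn, Prod.fst_sub, Prod.snd_sub, Prod.fst_add, Prod.snd_add, Prod.smul_fst,
        Prod.smul_snd, smul_eq_mul]
      ring
    set E := (x - p).1 * (y - p).2 - (x - p).2 * (y - p).1
    by_cases hE : E = 0
    · filter_upwards [self_mem_nhdsWithin] with κ hκ
      rw [hform, hE, zero_add]
      exact (mul_pos hκ hn2).ne'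
    · apply Filter.Eventually.filter_mono nhdsWithin_le_nhds
      have hc : ContinuousAt (fun κ : ℝ => E + κ * ((y - x).1 ^ 2 + (y - x).2 ^ 2)) 0 := by
        fun_prop
      filter_upwards [hc.eventually_ne (by simpa using hE)] with κ hκ
      rwa [hform]
  obtain ⟨κ, h3, h1, h2, h0⟩ := (e3.and ((e1.filter_mono nhdsWithin_le_nhds).and
    ((e2.filter_mono nhdsWithin_le_nhds).and self_mem_nhdsWithin))).exists
  have h0 : 0 < κ := h0
  intro τ hτ
  have := hu.triangle_of_det hα hΦ h3 (abs_pos.2 h0.ne') h1 (fun l hl hl0 => h2 l ⟨hl, hl0⟩)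
    (1 - τ, τ) ⟨by simp only; linarith [hτ.2], hτ.1, by simp⟩
  convert this using 1
  simp only
  module

/-- Points visible from `x` in a chart. -/
def vis (O : Set (ℝ × ℝ)) (x : ℝ × ℝ) : Set (ℝ × ℝ) :=
  {y | ∀ τ ∈ Set.Icc (0 : ℝ) 1, x + τ • (y - x) ∈ O}

lemma TGraph.vis_ball {α β : ℝ} {Ω : Set (ℝ × ℝ)} {u : J2} (hu : TGraph α β Ω u)
    (hα : 0 ≤ α) {Φ : OpenPartialHomeomorph (ℝ × ℝ) (ℝ × ℝ)} (hΦ : IsChart α Φ)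
    {x : ℝ × ℝ} (hx : StarConvex ℝ x Φ.target) {B : Set (ℝ × ℝ)} (hB : Convex ℝ B)
    (hBO : B ⊆ chartImage Φ Ω) {p y : ℝ × ℝ} (hp : p ∈ B) (hy : y ∈ B)
    (hpv : p ∈ vis (chartImage Φ Ω) x) : y ∈ vis (chartImage Φ Ω) x := by
  refine hu.triangle hα hΦ (p := p) ?_ ?_ ?_
  · rintro ⟨a, b⟩ ⟨h1, h2, h3⟩
    simp only at h1 h2 h3 ⊢
    rcases eq_or_lt_of_le (show a ≤ 1 by linarith) with h | h
    · have hb : b = 0 := by linarith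
      subst h; subst hb
      have : x ∈ chartImage Φ Ω := by simpa using hpv 0 (by simp)
      simpa using this.1
    · have hq : p + (b / (1 - a)) • (y - p) ∈ B := by
        refine hB.add_smul_sub_mem hp hy ⟨div_nonneg h2 (by linarith), ?_⟩
        rw [div_le_one (by linarith)]; linarith
      have := hx (hBO hq).1 h1 (show 0 ≤ 1 - a by linarith) (by ring)
      convert this using 1
      have h4 : (1 - a) ≠ 0 := by linarith
      rw [smul_add, smul_smul, mul_div_cancel₀ _ h4]
      module
  · intro τ hτ
    have := hpv (1 - τ) ⟨by linarith [hτ.2], by linarith [hτ.1]⟩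
    convert this using 1
    module
  · intro τ hτ
    exact hBO (hB.add_smul_sub_mem hp hy hτ)

/-- Clopen argument. -/
lemma eq_of_locally {Ω V : Set (ℝ × ℝ)} (hc : IsPreconnected Ω) (hV : (Ω ∩ V).Nonempty)
    (h : ∀ y ∈ Ω, ∃ B ∈ 𝓝 y, (B ∩ Ω ∩ V).Nonempty → B ∩ Ω ⊆ V) : Ω ⊆ V := by
  by_contra hcon
  obtain ⟨z, hzΩ, hzV⟩ := Set.not_subset.1 hcon
  choose! B hB hBV using h
  have hopen : ∀ y ∈ Ω, y ∈ interior (B y) := fun y hy => mem_interior_iff_mem_nhds.2 (hB y hy)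
  have c1 : Ω ⊆ (⋃ y ∈ Ω ∩ V, interior (B y)) ∪ (⋃ y ∈ Ω \ V, interior (B y)) := by
    intro y hy
    by_cases hyV : y ∈ V
    · exact Or.inl (Set.mem_biUnion (show y ∈ Ω ∩ V from ⟨hy, hyV⟩) (hopen y hy))
    · exact Or.inr (Set.mem_biUnion (show y ∈ Ω \ V from ⟨hy, hyV⟩) (hopen y hy))
  have c2 : (Ω ∩ (⋃ y ∈ Ω ∩ V, interior (B y))).Nonempty := by
    obtain ⟨y, hy⟩ := hV
    exact ⟨y, hy.1, Set.mem_biUnion hy (hopen y hy.1)⟩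
  have c3 : (Ω ∩ (⋃ y ∈ Ω \ V, interior (B y))).Nonempty :=
    ⟨z, hzΩ, Set.mem_biUnion (show z ∈ Ω \ V from ⟨hzΩ, hzV⟩) (hopen z hzΩ)⟩
  obtain ⟨w, hwΩ, hw1, hw2⟩ := hc _ _ (isOpen_biUnion fun _ _ => isOpen_interior)
    (isOpen_biUnion fun _ _ => isOpen_interior) c1 c2 c3
  simp only [Set.mem_iUnion] at hw1 hw2
  obtain ⟨y1, hy1, hw1⟩ := hw1
  obtain ⟨y2, hy2, hw2⟩ := hw2
  have hwV : w ∈ V := hBV y1 hy1.1 ⟨y1, ⟨interior_subset (hopen _ hy1.1), hy1.1⟩, hy1.2⟩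
    ⟨interior_subset hw1, hwΩ⟩
  exact hy2.2 (hBV y2 hy2.1 ⟨w, ⟨interior_subset hw2, hwΩ⟩, hwV⟩
    ⟨interior_subset (hopen _ hy2.1), hy2.1⟩)

/-- A compact set and a point can be separated by a convex function of the flat metric. -/
def Separates (α : ℝ) (K : Set (ℝ × ℝ)) (c : ℝ × ℝ) : Prop :=
  ∃ g : J2, FC α g ∧ (∀ x, 0 ≤ g.f x) ∧ (∀ x ∈ K, g.f x = 0) ∧ 0 < g.f c

lemma FC.continuous {α : ℝ} {g : J2} (hg : FC α g) : Continuous g.f :=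
  continuous_iff_continuousAt.2 fun _ => hg.1.cf trivial

lemma exists_between_compact {K : Set (ℝ × ℝ)} (hK : IsCompact K) {f : ℝ × ℝ → ℝ}
    (hf : ContinuousOn f K) {M : ℝ} (h : ∀ x ∈ K, f x < M) : ∃ b < M, ∀ x ∈ K, f x ≤ b := by
  rcases K.eq_empty_or_nonempty with rfl | hne
  · exact ⟨M - 1, by linarith, by simp⟩
  · obtain ⟨x, hx, hmax⟩ := hK.exists_isMaxOn hne hf
    exact ⟨f x, h x hx, fun y hy => hmax hy⟩

lemma sep_of_lt {α : ℝ} {K : Set (ℝ × ℝ)} {c : ℝ × ℝ} (hK : IsCompact K) {g : J2} (hg : FC α g)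
    (h : ∀ x ∈ K, g.f x < g.f c) : Separates α K c := by
  obtain ⟨b, hb, hKb⟩ := exists_between_compact hK hg.continuous.continuousOn h
  refine ⟨g.cut b, hg.cut b, fun x => ?_, fun x hx => ?_, ?_⟩
  · rw [cut_f]; positivity
  · rw [cut_f, max_eq_right (by linarith [hKb x hx])]; simp
  · rw [cut_f, max_eq_left (by linarith)]
    have : 0 < g.f c - b := by linarith
    positivity

lemma sep_of_chart {α : ℝ} {Φ : OpenPartialHomeomorph (ℝ × ℝ) (ℝ × ℝ)} (hΦ : IsChart α Φ)
    {Ω K : Set (ℝ × ℝ)} {c : ℝ × ℝ} (hΩ : IsOpen Ω) (hΩΦ : Ω ⊆ Φ.source)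
    (hconv : Convex ℝ (chartImage Φ Ω)) (hK : IsCompact K) (hKΩ : K ⊆ Ω)
    (hc : Φ c ∉ chartImage Φ Ω) : Separates α K c := by
  obtain ⟨f, hf⟩ := geometric_hahn_banach_open_point hconv (isOpen_chartImage Φ hΩ) hc
  obtain ⟨g, hg, hgf, -⟩ := hΦ (f (1, 0)) (f (0, 1)) 0
  have hfg : ∀ x, g.f x = f (Φ x) := fun x => by
    rw [hgf]
    have : Φ x = (Φ x).1 • ((1, 0) : ℝ × ℝ) + (Φ x).2 • ((0, 1) : ℝ × ℝ) := by
      ext <;> simp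
    conv_rhs => rw [this, map_add, map_smul, map_smul]
    simp only [smul_eq_mul]; ring
  refine sep_of_lt hK hg fun x hx => ?_
  rw [hfg, hfg]
  refine hf _ ⟨Φ.map_source (hΩΦ (hKΩ hx)), ?_⟩
  rw [Set.mem_preimage, Φ.left_inv (hΩΦ (hKΩ hx))]
  exact hKΩ hx

lemma TGraph.vis_of_isPreconnected {α β : ℝ} {Ω : Set (ℝ × ℝ)} {u : J2} (hu : TGraph α β Ω u)
    (hα : 0 ≤ α) {Φ : OpenPartialHomeomorph (ℝ × ℝ) (ℝ × ℝ)} (hΦ : IsChart α Φ)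
    {x : ℝ × ℝ} (hx : StarConvex ℝ x Φ.target) {A : Set (ℝ × ℝ)} (hA : IsPreconnected A)
    (hAΩ : A ⊆ Ω) (hAΦ : A ⊆ Φ.source) {p : ℝ × ℝ} (hp : p ∈ A)
    (hpv : Φ p ∈ vis (chartImage Φ Ω) x) : ∀ y ∈ A, Φ y ∈ vis (chartImage Φ Ω) x := by
  refine eq_of_locally (V := {y | Φ y ∈ vis (chartImage Φ Ω) x}) hA ⟨p, hp, hpv⟩ fun y hy => ?_
  have hyO : Φ y ∈ chartImage Φ Ω := by
    refine ⟨Φ.map_source (hAΦ hy), ?_⟩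
    rw [Set.mem_preimage, Φ.left_inv (hAΦ hy)]
    exact hAΩ hy
  obtain ⟨ρ, hρ, hball⟩ := Metric.isOpen_iff.1 (isOpen_chartImage Φ hu.isOpen) _ hyO
  refine ⟨Φ ⁻¹' ball (Φ y) ρ, (Φ.continuousAt (hAΦ hy)) (ball_mem_nhds _ hρ), ?_⟩
  rintro ⟨q, ⟨hq1, hq2⟩, hq3⟩ z ⟨hz1, hz2⟩
  exact hu.vis_ball hα hΦ hx (convex_ball _ _) hball hq1 hz1 hq3

lemma mem_vis_self {O : Set (ℝ × ℝ)} {x : ℝ × ℝ} (hx : x ∈ O) : x ∈ vis O x := by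
  intro τ _; simpa using hx

lemma TGraph.sep_zero {β : ℝ} {Ω : Set (ℝ × ℝ)} {u : J2} (hu : TGraph 0 β Ω u)
    (hconn : IsPreconnected Ω) {K : Set (ℝ × ℝ)} {c : ℝ × ℝ} (hK : IsCompact K) (hKΩ : K ⊆ Ω)
    (hc : c ∉ Ω) : Separates 0 K c := by
  have hO : chartImage (OpenPartialHomeomorph.refl (ℝ × ℝ)) Ω = Ω := by
    ext x; simp [chartImage]
  have hconv : Convex ℝ Ω := by
    rw [convex_iff_add_mem]
    intro x hx y hy a b ha hb hab
    have := hu.vis_of_isPreconnected le_rfl isChart_refl (x := x) (starConvex_univ _) hconn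
      subset_rfl (Set.subset_univ _) hx (mem_vis_self (by rw [hO]; exact hx)) y hy
    rw [hO] at this
    have h2 : x + b • (y - x) ∈ Ω := this b ⟨hb, by linarith⟩
    have e : a • x + b • y = x + b • (y - x) := by
      rw [show a = 1 - b by linarith]; module
    rw [e]; exact h2
  refine sep_of_chart isChart_refl hu.isOpen (Set.subset_univ _) (by rwa [hO]) hK hKΩ ?_
  rw [hO]; exact hc

/-- If no point of the domain lies on the vertical line through `c`. -/
lemma sep_of_not_mem_proj {α : ℝ} {Ω K : Set (ℝ × ℝ)} {c : ℝ × ℝ}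
    (hconn : IsPreconnected Ω) (hK : IsCompact K) (hKΩ : K ⊆ Ω) (hc : ∀ y ∈ Ω, y.1 ≠ c.1) :
    Separates α K c := by
  have hI : IsPreconnected (Prod.fst '' Ω) := hconn.image _ continuous_fst.continuousOn
  have hside : (∀ y ∈ Ω, y.1 < c.1) ∨ (∀ y ∈ Ω, c.1 < y.1) := by
    by_contra hcon
    push Not at hcon
    obtain ⟨⟨y, hy, hy1⟩, ⟨z, hz, hz1⟩⟩ := hcon
    obtain ⟨w, hw, hw1⟩ := hI.ordConnected.out ⟨z, hz, rfl⟩ ⟨y, hy, rfl⟩ ⟨hz1, hy1⟩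
    exact hc w hw hw1
  rcases hside with h | h
  · have hid : ∀ y, HasDerivAt (fun y : ℝ => max y 0 ^ 3) (3 * max y 0 ^ 2) y :=
      hasDerivAt_cube_pos
    obtain ⟨b, hb, hKb⟩ := exists_between_compact hK (f := Prod.fst) continuous_fst.continuousOn
      fun x hx => h x (hKΩ hx)
    refine ⟨pexp α (fun y => max (y - b) 0 ^ 3) (fun y => 3 * max (y - b) 0 ^ 2)
      (fun y => 6 * max (y - b) 0), FC_pexp (fun y => (hasDerivAt_cube_pos _).comp_sub_const y b)
      (fun y => (hasDerivAt_sq_pos _).comp_sub_const y b) (by fun_prop) (fun y => by positivity),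
      fun x => ?_, fun x hx => ?_, ?_⟩
    · simp only [pexp, J2.prod]; positivity
    · simp only [pexp, J2.prod]; rw [max_eq_right (by linarith [hKb x hx])]; simp
    · simp only [pexp, J2.prod]; rw [max_eq_left (by linarith)]
      have : 0 < c.1 - b := by linarith
      positivity
  · obtain ⟨b, hb, hKb⟩ := exists_between_compact hK (f := fun x => -x.1) (M := -c.1)
      (by fun_prop) fun x hx => by simpa using h x (hKΩ hx)
    have d1 : ∀ y, HasDerivAt (fun y : ℝ => max (-y - b) 0 ^ 3) (-(3 * max (-y - b) 0 ^ 2)) y :=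
      fun y => by
        have := (hasDerivAt_cube_pos (-y - b)).scomp y ((hasDerivAt_id y).neg.sub_const b)
        simpa [Function.comp_def] using this
    have d2 : ∀ y, HasDerivAt (fun y : ℝ => -(3 * max (-y - b) 0 ^ 2)) (6 * max (-y - b) 0) y :=
      fun y => by
        have := ((hasDerivAt_sq_pos (-y - b)).scomp y ((hasDerivAt_id y).neg.sub_const b)).fun_neg
        simpa [Function.comp_def] using this
    refine ⟨pexp α (fun y => max (-y - b) 0 ^ 3) (fun y => -(3 * max (-y - b) 0 ^ 2))
      (fun y => 6 * max (-y - b) 0), FC_pexp d1 d2 (by fun_prop) (fun y => by positivity),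
      fun x => ?_, fun x hx => ?_, ?_⟩
    · simp only [pexp, J2.prod]; positivity
    · simp only [pexp, J2.prod]; rw [max_eq_right (by linarith [hKb x hx])]; simp
    · simp only [pexp, J2.prod]; rw [max_eq_left (by linarith)]
      have : 0 < -c.1 - b := by linarith
      positivity

/-- The maximum principle on a box. -/
lemma TGraph.box {α β : ℝ} {Ω : Set (ℝ × ℝ)} {u : J2} (hu : TGraph α β Ω u)
    (hα : 0 < α) {σ A B C s₁ s₂ t₁ t₂ : ℝ} (hAB : A ≠ 0 ∨ B ≠ 0)
    (hbd : ∀ s ∈ Set.Icc s₁ s₂, ∀ t ∈ Set.Icc t₁ t₂, s = s₁ ∨ s = s₂ ∨ t = t₁ ∨ t = t₂ →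
      (s, t) ∈ Ω ∨ (sinu α σ A B C).f (s, t) ≤ 0) :
    ∀ s ∈ Set.Icc s₁ s₂, ∀ t ∈ Set.Icc t₁ t₂, (s, t) ∉ Ω → (sinu α σ A B C).f (s, t) ≤ 0 := by
  have hg := FC_sinu α σ A B C
  have key := hu.max_principle hα.le isOpen_univ hg.1
    ((isCompact_Icc (a := s₁) (b := s₂)).prod (isCompact_Icc (a := t₁) (b := t₂)))
    (Set.subset_univ _) (fun x _ => hg.2 x trivial) (fun x _ => sinu_grad hα hAB x) ?_
  · intro s hs t ht hst
    exact key (s, t) ⟨hs, ht⟩ hst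
  · rintro ⟨s, t⟩ ⟨hs, ht⟩ hst hpos
    simp only at hs ht
    have hn : ¬(s = s₁ ∨ s = s₂ ∨ t = t₁ ∨ t = t₂) :=
      fun h => (hbd s hs t ht h).elim hst (not_le.2 hpos)
    simp only [not_or] at hn
    refine prod_mem_nhds (Icc_mem_nhds ?_ ?_) (Icc_mem_nhds ?_ ?_)
    · exact lt_of_le_of_ne hs.1 (Ne.symm hn.1)
    · exact lt_of_le_of_ne hs.2 hn.2.1
    · exact lt_of_le_of_ne ht.1 (Ne.symm hn.2.2.1)
    · exact lt_of_le_of_ne ht.2 hn.2.2.2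

/-- Points from which the downward ray stays in the domain. -/
def rays (Ω : Set (ℝ × ℝ)) : Set (ℝ × ℝ) := {y | ∀ t ≤ y.2, (y.1, t) ∈ Ω}

lemma exists_exp_le {α ε : ℝ} (hα : 0 < α) (hε : 0 < ε) (T : ℝ) : ∃ t ≤ T, exp (α * t) ≤ ε := by
  refine ⟨min T (log ε / α), min_le_left _ _, ?_⟩
  rw [← Real.le_log_iff_exp_le hε]
  have h := mul_le_mul_of_nonneg_left (min_le_right T (log ε / α)) hα.le
  have : α * (log ε / α) = log ε := by field_simp
  linarith

lemma exists_le_exp {α ε : ℝ} (hα : 0 < α) (hε : 0 < ε) (T : ℝ) : ∃ t ≥ T, ε ≤ exp (α * t) := by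
  refine ⟨max T (log ε / α), le_max_left _ _, ?_⟩
  rw [← Real.log_le_iff_le_exp hε]
  have h := mul_le_mul_of_nonneg_left (le_max_right T (log ε / α)) hα.le
  have : α * (log ε / α) = log ε := by field_simp
  linarith

lemma TGraph.rays_step {α β : ℝ} {Ω : Set (ℝ × ℝ)} {u : J2} (hu : TGraph α β Ω u)
    (hα : 0 < α) {ρ : ℝ} (hρ : 4 * α * ρ < π) {y₀ p y : ℝ × ℝ}
    (hball : closedBall y₀ (2 * ρ) ⊆ Ω) (hp : p ∈ closedBall y₀ ρ) (hy : y ∈ closedBall y₀ ρ)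
    (hρ0 : 0 < ρ) (hpr : p ∈ rays Ω) : y ∈ rays Ω := by
  rw [mem_closedBall, Prod.dist_eq, max_le_iff, Real.dist_eq, Real.dist_eq, abs_le, abs_le] at hp hy
  obtain ⟨⟨p1, p2⟩, ⟨p3, p4⟩⟩ := hp
  obtain ⟨⟨y1, y2⟩, ⟨y3, y4⟩⟩ := hy
  have hmem : ∀ s t : ℝ, |s - y₀.1| ≤ 2 * ρ → |t - y₀.2| ≤ 2 * ρ → (s, t) ∈ Ω := by
    intro s t hs ht
    apply hball
    rw [mem_closedBall, Prod.dist_eq, max_le_iff, Real.dist_eq, Real.dist_eq]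
    exact ⟨hs, ht⟩
  have hside : ∀ t ≤ y.2, (p.1, t) ∈ Ω := by
    intro t ht
    rcases le_total t p.2 with h | h
    · exact hpr t h
    · apply hmem <;> rw [abs_le] <;> constructor <;> linarith
  have htop : ∀ s, |s - y₀.1| ≤ 2 * ρ → (s, y.2) ∈ Ω := by
    intro s hs
    apply hmem s _ hs
    rw [abs_le]; constructor <;> linarith
  intro t1 ht1
  by_contra hbad
  have hmain : ∀ (e A B : ℝ) (sL sR : ℝ), (A ≠ 0 ∨ B ≠ 0) →
      (∀ s ∈ Set.Icc sL sR, |s - y₀.1| ≤ 2 * ρ) →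
      (∀ s ∈ Set.Icc sL sR, A * cos (α * (s - e)) + B * sin (α * (s - e)) ≤ 1) →
      (sL = p.1 ∧ A * cos (α * (sR - e)) + B * sin (α * (sR - e)) ≤ 0 ∨
       sR = p.1 ∧ A * cos (α * (sL - e)) + B * sin (α * (sL - e)) ≤ 0) →
      y.1 ∈ Set.Icc sL sR → 0 < A * cos (α * (y.1 - e)) + B * sin (α * (y.1 - e)) → False := by
    intro e A B sL sR hAB hs hle1 hsides hys hpos
    set κ := (A * cos (α * (y.1 - e)) + B * sin (α * (y.1 - e))) * exp (α * t1) / 2 with hκ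
    have hκ0 : 0 < κ := by positivity
    obtain ⟨T, hT, hTκ⟩ := exists_exp_le hα hκ0 t1
    have := hu.box hα (σ := e) (C := -κ) (s₁ := sL) (s₂ := sR) (t₁ := T) (t₂ := y.2) hAB ?_
      y.1 hys t1 ⟨hT, ht1⟩ hbad
    · rw [sinu_f] at this
      simp only at this
      rw [hκ] at this
      have h2 : 0 < (A * cos (α * (y.1 - e)) + B * sin (α * (y.1 - e))) * exp (α * t1) := by
        positivity
      linarith
    · intro s hsm t htm hcase
      have hneg : A * cos (α * (s - e)) + B * sin (α * (s - e)) ≤ 0 →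
          (sinu α e A B (-κ)).f (s, t) ≤ 0 := fun h => by
        rw [sinu_f]
        have := mul_nonpos_of_nonpos_of_nonneg h (exp_pos (α * t)).le
        simp only; linarith
      rcases hcase with h | h | h | h
      · rcases hsides with ⟨h1, h2⟩ | ⟨h1, h2⟩
        · left; rw [h, h1]; exact hside t htm.2
        · right; apply hneg; rw [h]; exact h2
      · rcases hsides with ⟨h1, h2⟩ | ⟨h1, h2⟩
        · right; apply hneg; rw [h]; exact h2
        · left; rw [h, h1]; exact hside t htm.2
      · right
        rw [sinu_f, h]
        simp only
        have := mul_le_mul_of_nonneg_right (hle1 s hsm) (exp_pos (α * T)).le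
        linarith
      · left; rw [h]; exact htop s (hs s hsm)
  have hsinpos : ∀ d : ℝ, 0 < d → d ≤ 4 * ρ → 0 < sin (α * d) := fun d h1 h2 =>
    sin_pos_of_pos_of_lt_pi (by positivity) (by nlinarith)
  rcases le_total p.1 y.1 with h | h
  · refine hmain (y₀.1 + 2 * ρ) 0 (-1) p.1 (y₀.1 + 2 * ρ) (Or.inr (by norm_num)) ?_ ?_
      (Or.inl ⟨rfl, by simp⟩) ⟨h, by linarith⟩ ?_
    · intro s hs; rw [abs_le]; constructor <;> linarith [hs.1, hs.2]
    · intro s _; linarith [neg_one_le_sin (α * (s - (y₀.1 + 2 * ρ)))]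
    · have := hsinpos (y₀.1 + 2 * ρ - y.1) (by linarith) (by linarith)
      have e : α * (y.1 - (y₀.1 + 2 * ρ)) = -(α * (y₀.1 + 2 * ρ - y.1)) := by ring
      rw [e, sin_neg]; linarith
  · refine hmain (y₀.1 - 2 * ρ) 0 1 (y₀.1 - 2 * ρ) p.1 (Or.inr (by norm_num)) ?_ ?_
      (Or.inr ⟨rfl, by simp⟩) ⟨by linarith, h⟩ ?_
    · intro s hs; rw [abs_le]; constructor <;> linarith [hs.1, hs.2]
    · intro s _; linarith [sin_le_one (α * (s - (y₀.1 - 2 * ρ)))]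
    · have := hsinpos (y.1 - (y₀.1 - 2 * ρ)) (by linarith) (by linarith)
      linarith

lemma TGraph.rays_dichotomy {α β : ℝ} {Ω : Set (ℝ × ℝ)} {u : J2} (hu : TGraph α β Ω u)
    (hα : 0 < α) (hconn : IsPreconnected Ω) : Ω ⊆ rays Ω ∨ ∀ y ∈ Ω, y ∉ rays Ω := by
  by_cases h : ∃ y ∈ Ω, y ∈ rays Ω
  · left
    obtain ⟨y, hy, hyr⟩ := h
    refine eq_of_locally hconn ⟨y, hy, hyr⟩ fun z hz => ?_
    obtain ⟨ε, hε, hball⟩ := Metric.isOpen_iff.1 hu.isOpen z hz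
    set ρ := min (ε / 3) (π / (8 * α)) with hρ
    have hρ0 : 0 < ρ := lt_min (by positivity) (by positivity)
    have h1 : 2 * ρ < ε := by have := min_le_left (ε / 3) (π / (8 * α)); linarith
    have h2 : 4 * α * ρ < π := by
      have := mul_le_mul_of_nonneg_left (min_le_right (ε / 3) (π / (8 * α)))
        (show 0 ≤ 4 * α by positivity)
      have e : 4 * α * (π / (8 * α)) = π / 2 := by field_simp; norm_num
      rw [e] at this
      linarith [pi_pos]
    refine ⟨closedBall z ρ, closedBall_mem_nhds z hρ0, ?_⟩
    rintro ⟨p, ⟨hp1, hp2⟩, hp3⟩ w ⟨hw1, hw2⟩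
    exact hu.rays_step hα h2 ((closedBall_subset_ball h1).trans hball) hp1 hw1 hρ0 hp3
  · right; push Not at h; exact h

lemma exists_bottom {Ω : Set (ℝ × ℝ)} (hΩ : IsOpen Ω) (hr : Ω ⊆ rays Ω) {A : Set ℝ}
    (hA : IsCompact A) (h : ∀ s ∈ A, ∃ t, (s, t) ∈ Ω) :
    ∃ T, ∀ s ∈ A, ∀ t ≤ T, (s, t) ∈ Ω := by
  refine hA.induction_on (p := fun B => ∃ T, ∀ s ∈ B, ∀ t ≤ T, (s, t) ∈ Ω) ⟨0, by simp⟩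
    ?_ ?_ ?_
  · rintro B C hBC ⟨T, hT⟩
    exact ⟨T, fun s hs => hT s (hBC hs)⟩
  · rintro B C ⟨T, hT⟩ ⟨T', hT'⟩
    refine ⟨min T T', ?_⟩
    rintro s (hs | hs) t ht
    · exact hT s hs t (ht.trans (min_le_left _ _))
    · exact hT' s hs t (ht.trans (min_le_right _ _))
  · intro s hs
    obtain ⟨t, ht⟩ := h s hs
    have hc : ContinuousAt (fun s' : ℝ => (s', t)) s := by fun_prop
    refine ⟨_, mem_nhdsWithin_of_mem_nhds (hc (hΩ.mem_nhds ht)), t, fun s' hs' t' ht' => ?_⟩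
    exact hr hs' t' ht'

lemma TGraph.rays_concave {α β : ℝ} {Ω : Set (ℝ × ℝ)} {u : J2} (hu : TGraph α β Ω u)
    (hα : 0 < α) (hconn : IsPreconnected Ω) (hr : Ω ⊆ rays Ω) {s₁ t₁ s₂ t₂ s₀ t₀ : ℝ}
    (h1 : (s₁, t₁) ∈ Ω) (h2 : (s₂, t₂) ∈ Ω) (h0 : (s₀, t₀) ∉ Ω) (h10 : s₁ < s₀) (h02 : s₀ < s₂)
    (hπ : α * (s₂ - s₁) < π) :
    exp (-(α * t₀)) * sin (α * (s₂ - s₁)) ≤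
      exp (-(α * t₂)) * sin (α * (s₀ - s₁)) + exp (-(α * t₁)) * sin (α * (s₂ - s₀)) := by
  set D := sin (α * (s₂ - s₁)) with hDdef
  have hD : 0 < D := sin_pos_of_pos_of_lt_pi (mul_pos hα (by linarith)) hπ
  set E₁ := exp (-(α * t₁)) with hE1
  set E₂ := exp (-(α * t₂)) with hE2
  have hE1p : 0 < E₁ := exp_pos _
  have hE2p : 0 < E₂ := exp_pos _
  set a := α * (s₀ - s₁) with ha
  set b := α * (s₂ - s₀) with hb
  have hab : α * (s₂ - s₁) = a + b := by rw [ha, hb]; ring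
  set A := (E₁ * sin b + E₂ * sin a) / D with hA
  set B := (-E₁ * cos b + E₂ * cos a) / D with hB
  have ha0 : 0 < a := mul_pos hα (by linarith)
  have hb0 : 0 < b := mul_pos hα (by linarith)
  rw [hab] at hπ
  have hsa : 0 < sin a := sin_pos_of_pos_of_lt_pi ha0 (by linarith)
  have hsb : 0 < sin b := sin_pos_of_pos_of_lt_pi hb0 (by linarith)
  have hA0 : 0 < A := by positivity
  set h : ℝ → ℝ := fun s => A * cos (α * (s - s₀)) + B * sin (α * (s - s₀)) with hh
  have hform : ∀ s, h s = (E₁ * sin (α * (s₂ - s)) + E₂ * sin (α * (s - s₁))) / D := by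
    intro s
    have x1 : α * (s₂ - s) = b - α * (s - s₀) := by rw [hb]; ring
    have x2 : α * (s - s₁) = a + α * (s - s₀) := by rw [ha]; ring
    rw [x1, x2, sin_sub, sin_add]
    simp only [hh, hA, hB]
    field_simp; ring
  have hpos : ∀ s ∈ Set.Icc s₁ s₂, 0 < h s := by
    intro s hs
    rw [hform]
    apply div_pos _ hD
    have p1 : 0 ≤ α * (s₂ - s) := mul_nonneg hα.le (by linarith [hs.2])
    have p2 : 0 ≤ α * (s - s₁) := mul_nonneg hα.le (by linarith [hs.1])
    have p3 : α * (s₂ - s) + α * (s - s₁) = a + b := by rw [ha, hb]; ring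
    have q1 : 0 ≤ sin (α * (s₂ - s)) := sin_nonneg_of_nonneg_of_le_pi p1 (by linarith)
    have q2 : 0 ≤ sin (α * (s - s₁)) := sin_nonneg_of_nonneg_of_le_pi p2 (by linarith)
    rcases p1.eq_or_lt with p | p
    · have : 0 < sin (α * (s - s₁)) := sin_pos_of_pos_of_lt_pi (by linarith) (by linarith)
      positivity
    · have : 0 < sin (α * (s₂ - s)) := sin_pos_of_pos_of_lt_pi p (by linarith)
      positivity
  have hhc : Continuous h := by fun_prop
  have h12 : s₁ ≤ s₂ := by linarith
  obtain ⟨sm, hsm, hmin⟩ := (isCompact_Icc (a := s₁) (b := s₂)).exists_isMinOn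
    ⟨s₁, le_rfl, h12⟩ hhc.continuousOn
  obtain ⟨T₂, hT2, hT2'⟩ := exists_le_exp (ε := (h sm)⁻¹) hα (inv_pos.2 (hpos sm hsm)) t₀
  have hproj : ∀ s ∈ Set.Icc s₁ s₂, ∃ t, (s, t) ∈ Ω := by
    intro s hs
    have hI : IsPreconnected (Prod.fst '' Ω) := hconn.image _ continuous_fst.continuousOn
    obtain ⟨⟨s', t⟩, hw, hw1⟩ := hI.ordConnected.out ⟨_, h1, rfl⟩ ⟨_, h2, rfl⟩ hs
    exact ⟨t, by simpa [← hw1] using hw⟩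
  obtain ⟨T₁, hT1⟩ := exists_bottom hu.isOpen hr isCompact_Icc hproj
  have key := hu.box hα (σ := s₀) (A := -A) (B := -B) (C := 1) (s₁ := s₁) (s₂ := s₂)
    (t₁ := min T₁ t₀) (t₂ := T₂) (Or.inl (by linarith)) ?_ s₀ ⟨h10.le, h02.le⟩ t₀
    ⟨min_le_right _ _, hT2⟩ h0
  · rw [sinu_f] at key
    simp only [sub_self, mul_zero, cos_zero, sin_zero, mul_one, add_zero] at key
    have e0 : exp (-(α * t₀)) * exp (α * t₀) = 1 := by rw [← exp_add]; simp
    have : exp (-(α * t₀)) ≤ A := by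
      have hp := exp_pos (α * t₀)
      by_contra hc
      push Not at hc
      have := mul_lt_mul_of_pos_right hc hp
      linarith
    rw [hA, le_div_iff₀ hD] at this
    linarith
  · intro s hs t ht hcase
    have hf : (sinu α s₀ (-A) (-B) 1).f (s, t) = 1 - h s * exp (α * t) := by
      rw [sinu_f]; simp only [hh]; ring
    have hside : ∀ s' t', (s', t') ∈ Ω → h s' = exp (-(α * t')) →
        (s', t) ∈ Ω ∨ 1 - h s' * exp (α * t) ≤ 0 := by
      intro s' t' hst hhs
      rcases le_total t t' with h | h
      · left; exact hr hst t h
      · right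
        rw [hhs, ← exp_add]
        have := one_le_exp (x := -(α * t') + α * t) (by nlinarith)
        linarith
    rw [hf]
    rcases hcase with hc | hc | hc | hc
    · rw [hc]; refine hside s₁ t₁ h1 ?_
      rw [hform]; simp only [sub_self, mul_zero, sin_zero, add_zero]
      rw [mul_div_assoc, div_self hD.ne', mul_one]
    · rw [hc]; refine hside s₂ t₂ h2 ?_
      rw [hform]; simp only [sub_self, mul_zero, sin_zero, zero_add]
      rw [mul_div_assoc, div_self hD.ne', mul_one]
    · left; exact hT1 s hs t (hc.le.trans (min_le_left _ _))
    · right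
      rw [hc]
      have m1 : h sm ≤ h s := hmin hs
      have := mul_le_mul m1 hT2' (inv_nonneg.2 (hpos sm hsm).le) (hpos s hs).le
      rw [mul_inv_cancel₀ (hpos sm hsm).ne'] at this
      linarith

lemma TGraph.exists_slope {α β : ℝ} {Ω : Set (ℝ × ℝ)} {u : J2} (hu : TGraph α β Ω u)
    (hα : 0 < α) (hconn : IsPreconnected Ω) (hr : Ω ⊆ rays Ω) {s₀ t₀ t' : ℝ}
    (h0 : (s₀, t₀) ∉ Ω) (h0' : (s₀, t') ∈ Ω) :
    ∃ m, ∀ s t, (s, t) ∈ Ω → |α * (s - s₀)| < π →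
      exp (-(α * t₀)) * cos (α * (s - s₀)) + m * sin (α * (s - s₀)) ≤ exp (-(α * t)) := by
  set k := exp (-(α * t₀)) with hk
  set L : Set ℝ := {l | ∃ s t, (s, t) ∈ Ω ∧ s < s₀ ∧ α * (s₀ - s) < π ∧
    l = (k * cos (α * (s₀ - s)) - exp (-(α * t))) / sin (α * (s₀ - s))} with hL
  set R : Set ℝ := {l | ∃ s t, (s, t) ∈ Ω ∧ s₀ < s ∧ α * (s - s₀) < π ∧
    l = (exp (-(α * t)) - k * cos (α * (s - s₀))) / sin (α * (s - s₀))} with hR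
  obtain ⟨ε, hε, hball⟩ := Metric.isOpen_iff.1 hu.isOpen _ h0'
  set ρ := min (ε / 2) (π / (2 * α)) with hρ
  have hρ0 : 0 < ρ := lt_min (by positivity) (by positivity)
  have hρε : ρ < ε := by have := min_le_left (ε / 2) (π / (2 * α)); linarith
  have hρπ : α * ρ < π := by
    have := mul_le_mul_of_nonneg_left (min_le_right (ε / 2) (π / (2 * α))) hα.le
    have e : α * (π / (2 * α)) = π / 2 := by field_simp
    rw [e] at this
    linarith [pi_pos]
  have hLne : L.Nonempty := by
    refine ⟨_, s₀ - ρ, t', hball ?_, by linarith, by simpa using hρπ, rfl⟩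
    rw [mem_ball, Prod.dist_eq, max_lt_iff, Real.dist_eq, Real.dist_eq]
    simp [abs_of_pos hρ0, hρε, hε]
  have hRne : R.Nonempty := by
    refine ⟨_, s₀ + ρ, t', hball ?_, by linarith, by simpa using hρπ, rfl⟩
    rw [mem_ball, Prod.dist_eq, max_lt_iff, Real.dist_eq, Real.dist_eq]
    simp [abs_of_pos hρ0, hρε, hε]
  have hle : ∀ l ∈ L, ∀ r ∈ R, l ≤ r := by
    rintro _ ⟨s₁, t₁, m1, l1, p1, rfl⟩ _ ⟨s₂, t₂, m2, l2, p2, rfl⟩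
    have q1 : 0 < α * (s₀ - s₁) := mul_pos hα (by linarith)
    have q2 : 0 < α * (s₂ - s₀) := mul_pos hα (by linarith)
    have r1 := sin_pos_of_pos_of_lt_pi q1 p1
    have r2 := sin_pos_of_pos_of_lt_pi q2 p2
    rw [div_le_div_iff₀ r1 r2]
    have hsum : α * (s₂ - s₁) = α * (s₀ - s₁) + α * (s₂ - s₀) := by ring
    have hmain : k * sin (α * (s₂ - s₁)) ≤
      exp (-(α * t₂)) * sin (α * (s₀ - s₁)) + exp (-(α * t₁)) * sin (α * (s₂ - s₀)) := by
      rcases lt_or_ge (α * (s₂ - s₁)) π with h | h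
      · exact hu.rays_concave hα hconn hr m1 m2 h0 l1 l2 h
      · have : 0 ≤ sin (α * (s₂ - s₁) - π) :=
          sin_nonneg_of_nonneg_of_le_pi (by linarith) (by linarith)
        rw [sin_sub_pi] at this
        have hk0 : 0 < k := exp_pos _
        have i1 := mul_pos (exp_pos (-(α * t₂))) r1
        have i2 := mul_pos (exp_pos (-(α * t₁))) r2
        nlinarith
    rw [hsum, sin_add] at hmain
    linarith
  obtain ⟨r0, hr0⟩ := hRne
  have hbdd : BddAbove L := ⟨r0, fun l hl => hle l hl r0 hr0⟩
  refine ⟨sSup L, fun s t hst hσ => ?_⟩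
  rw [abs_lt] at hσ
  rcases lt_trichotomy s s₀ with h | h | h
  · have hl : (k * cos (α * (s₀ - s)) - exp (-(α * t))) / sin (α * (s₀ - s)) ≤ sSup L :=
      le_csSup hbdd ⟨s, t, hst, h, by linarith, rfl⟩
    have q1 : 0 < α * (s₀ - s) := mul_pos hα (by linarith)
    rw [div_le_iff₀ (sin_pos_of_pos_of_lt_pi q1 (by linarith))] at hl
    have e : α * (s - s₀) = -(α * (s₀ - s)) := by ring
    rw [e, cos_neg, sin_neg]; linarith
  · subst h
    simp only [sub_self, mul_zero, cos_zero, sin_zero, mul_one, add_zero]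
    have : t < t₀ := by
      by_contra hc
      exact h0 (hr hst t₀ (not_lt.1 hc))
    exact exp_le_exp.2 (by nlinarith)
  · have hl : sSup L ≤ (exp (-(α * t)) - k * cos (α * (s - s₀))) / sin (α * (s - s₀)) :=
      csSup_le hLne fun l hl => hle l hl _ ⟨s, t, hst, h, by linarith, rfl⟩
    have q1 : 0 < α * (s - s₀) := mul_pos hα (by linarith)
    rw [le_div_iff₀ (sin_pos_of_pos_of_lt_pi q1 (by linarith))] at hl
    linarith

/-- Equality of all the components. -/
def J2.EqAt (g h : J2) (x : ℝ × ℝ) : Prop :=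
  g.f x = h.f x ∧ g.s x = h.s x ∧ g.t x = h.t x ∧ g.ss x = h.ss x ∧ g.st x = h.st x ∧
    g.tt x = h.tt x

lemma FC_of_local {α : ℝ} {g : J2} (h : ∀ x, ∃ g', FC α g' ∧ ∀ᶠ y in 𝓝 x, g.EqAt g' y) :
    FC α g := by
  refine ⟨⟨fun x _ => ?_, fun x _ => ?_, fun x _ => ?_, fun x _ => ?_, fun x _ => ?_,
    fun x _ => ?_⟩, fun x _ a b => ?_⟩ <;> obtain ⟨g', hg', he⟩ := h x <;>
    have h0 := he.self_of_nhds
  · rw [h0.2.1, h0.2.2.1]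
    exact (hg'.1.hf x trivial).congr_of_eventuallyEq (he.mono fun y hy => hy.1)
  · rw [h0.2.2.2.1, h0.2.2.2.2.1]
    exact (hg'.1.hs x trivial).congr_of_eventuallyEq (he.mono fun y hy => hy.2.1)
  · rw [h0.2.2.2.2.1, h0.2.2.2.2.2]
    exact (hg'.1.ht x trivial).congr_of_eventuallyEq (he.mono fun y hy => hy.2.2.1)
  · exact (hg'.1.css x trivial).congr_of_eventuallyEq (he.mono fun y hy => hy.2.2.2.1)
  · exact (hg'.1.cst x trivial).congr_of_eventuallyEq (he.mono fun y hy => hy.2.2.2.2.1)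
  · exact (hg'.1.ctt x trivial).congr_of_eventuallyEq (he.mono fun y hy => hy.2.2.2.2.2)
  · have := hg'.2 x trivial a b
    simp only [Hss, Hst, Htt] at this ⊢
    rw [h0.2.1, h0.2.2.1, h0.2.2.2.1, h0.2.2.2.2.1, h0.2.2.2.2.2]
    exact this

/-- Restriction of all the components to a set, extended by zero. -/
def J2.restr (A : Set (ℝ × ℝ)) (g : J2) : J2 :=
  ⟨A.indicator g.f, A.indicator g.s, A.indicator g.t, A.indicator g.ss, A.indicator g.st,
    A.indicator g.tt⟩

lemma TGraph.sep_rays {α β : ℝ} {Ω : Set (ℝ × ℝ)} {u : J2} (hu : TGraph α β Ω u)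
    (hα : 0 < α) (hconn : IsPreconnected Ω) (hr : Ω ⊆ rays Ω) {K : Set (ℝ × ℝ)}
    (hK : IsCompact K) (hKΩ : K ⊆ Ω) {c : ℝ × ℝ} (hc : c ∉ Ω) {t' : ℝ} (hc' : (c.1, t') ∈ Ω) :
    Separates α K c := by
  obtain ⟨m, hm⟩ := hu.exists_slope hα hconn hr (s₀ := c.1) (t₀ := c.2) hc hc'
  set k := exp (-(α * c.2)) with hk
  have hk0 : 0 < k := exp_pos _
  set A : Set (ℝ × ℝ) := {x | |α * (x.1 - c.1)| < π} with hA
  have hAo : IsOpen A := isOpen_lt (by fun_prop) continuous_const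
  set cl : ℝ × ℝ → ℝ := fun x => max (-π) (min π (α * (x.1 - c.1))) with hcl
  have hcl1 : ∀ x ∈ A, cl x = α * (x.1 - c.1) := by
    intro x hx
    have hx : |α * (x.1 - c.1)| < π := hx
    obtain ⟨h1, h2⟩ := abs_lt.1 hx
    simp only [hcl]
    rw [min_eq_right h2.le, max_eq_right h1.le]
  have hcl2 : ∀ x ∉ A, cl x = π ∨ cl x = -π := by
    intro x hx
    simp only [hA, Set.mem_ofPred_eq, not_lt, le_abs] at hx
    simp only [hcl]
    rcases hx with h | h
    · left; rw [min_eq_left h, max_eq_right (by linarith [pi_pos])]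
    · right; rw [min_eq_right (by linarith [pi_pos]), max_eq_left (by linarith)]
  set F : ℝ × ℝ → ℝ := fun x => (k * cos (cl x) + m * sin (cl x)) * exp (α * x.2) with hF
  have hFc : Continuous F := by simp only [hF, hcl]; fun_prop
  have hF2 : ∀ x ∉ A, F x < 0 := by
    intro x hx
    have he := exp_pos (α * x.2)
    simp only [hF]
    rcases hcl2 x hx with h | h <;> rw [h] <;> simp <;> positivity
  have hFK : ∀ x ∈ K, F x < 1 := by
    intro x hx
    by_cases hxA : x ∈ A
    · have hcont : ContinuousAt (fun η : ℝ => ((x.1, x.2 + η) : ℝ × ℝ)) 0 := by fun_prop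
      have hev := hcont.eventually (hu.isOpen.mem_nhds (by simpa using hKΩ hx))
      have hev2 := (hev.filter_mono nhdsWithin_le_nhds).and
        (self_mem_nhdsWithin (s := Set.Ioi (0 : ℝ)) (a := 0))
      obtain ⟨η, h1, h2⟩ := hev2.exists
      have h2 : 0 < η := h2
      have := hm x.1 (x.2 + η) h1 hxA
      simp only [hF]
      rw [hcl1 x hxA]
      calc _ ≤ exp (-(α * (x.2 + η))) * exp (α * x.2) :=
            mul_le_mul_of_nonneg_right this (exp_pos _).le
        _ = exp (-(α * η)) := by rw [← exp_add]; ring_nf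
        _ < 1 := by rw [exp_lt_one_iff]; nlinarith
    · linarith [hF2 x hxA]
  obtain ⟨b₀, hb0, hKb⟩ := exists_between_compact hK hFc.continuousOn hFK
  set b := max b₀ 0 with hb
  have hb1 : b < 1 := max_lt hb0 one_pos
  have hbn : 0 ≤ b := le_max_right _ _
  set G := (sinu α c.1 k m 0).cut b with hG
  have hGF : ∀ x ∈ A, (sinu α c.1 k m 0).f x = F x := by
    intro x hx
    rw [sinu_f]; simp only [hF]; rw [hcl1 x hx, add_zero]
  refine ⟨G.restr A, FC_of_local fun x => ?_, fun x => ?_, fun x hx => ?_, ?_⟩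
  · by_cases hx : x ∈ A
    · refine ⟨G, (FC_sinu _ _ _ _ _).cut b, ?_⟩
      filter_upwards [hAo.mem_nhds hx] with y hy
      simp [J2.EqAt, J2.restr, hy]
    · refine ⟨J2.const 0, FC_const _ _, ?_⟩
      have hlt : F x < b := lt_of_lt_of_le (hF2 x hx) hbn
      filter_upwards [hFc.continuousAt.eventually_lt_const hlt] with y hy
      by_cases hyA : y ∈ A
      · have hz : max ((sinu α c.1 k m 0).f y - b) 0 = 0 :=
          max_eq_right (by rw [hGF y hyA]; linarith)
        simp [J2.EqAt, J2.restr, hyA, hG, J2.cut, J2.comp, hz, J2.const]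
      · simp [J2.EqAt, J2.restr, hyA, J2.const]
  · simp only [J2.restr]
    refine Set.indicator_nonneg (fun y _ => ?_) x
    rw [hG, cut_f]; positivity
  · simp only [J2.restr]
    by_cases hxA : x ∈ A
    · rw [Set.indicator_of_mem hxA, hG, cut_f, hGF x hxA,
        max_eq_right (by linarith [hKb x hx, le_max_left b₀ 0])]
      simp
    · rw [Set.indicator_of_notMem hxA]
  · have hcA : c ∈ A := by simp [hA, pi_pos]
    simp only [J2.restr]
    rw [Set.indicator_of_mem hcA, hG, cut_f, sinu_f]
    simp only [sub_self, mul_zero, cos_zero, sin_zero, mul_one, add_zero]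
    have e0 : k * exp (α * c.2) = 1 := by rw [hk, ← exp_add]; simp
    rw [e0, max_eq_left (by linarith)]
    have : 0 < 1 - b := by linarith
    positivity

lemma mem_polarChart_source {α σ : ℝ} (hα : 0 < α) (x : ℝ × ℝ) :
    x ∈ (polarChart α σ hα).source ↔ α * (x.1 - σ) ∈ Set.Ioo (-π) π := Iff.rfl

lemma mem_chartImage_apply {Φ : OpenPartialHomeomorph (ℝ × ℝ) (ℝ × ℝ)} {Ω : Set (ℝ × ℝ)}
    {x : ℝ × ℝ} (hx : x ∈ Φ.source) : Φ x ∈ chartImage Φ Ω ↔ x ∈ Ω := by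
  refine ⟨fun h => ?_, fun h => ⟨Φ.map_source hx, ?_⟩⟩
  · have := h.2
    rwa [Set.mem_preimage, Φ.left_inv hx] at this
  · rwa [Set.mem_preimage, Φ.left_inv hx]

lemma exists_ray_angle {X R r η₀ : ℝ} (hX : 0 < X) (hr : 0 < r) (hrR : r < R) (h0 : 0 < η₀)
    (hπ : η₀ < π) : ∃ η ∈ Set.Ioo 0 η₀, ∃ τ ∈ Set.Icc (0 : ℝ) 1,
      (1 - τ) * X - τ * R * cos η = -r * cos η₀ ∧ τ * R * sin η = r * sin η₀ := by
  have hs0 : 0 < sin η₀ := sin_pos_of_pos_of_lt_pi h0 hπ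
  have hR : 0 < R := hr.trans hrR
  have hf : ContinuousOn (fun η => X * (R * sin η - r * sin η₀) + R * r * sin (η - η₀))
      (Set.Icc 0 η₀) := by fun_prop
  have hmem : (0 : ℝ) ∈ Set.Ioo (X * (R * sin 0 - r * sin η₀) + R * r * sin (0 - η₀))
      (X * (R * sin η₀ - r * sin η₀) + R * r * sin (η₀ - η₀)) := by
    constructor
    · simp only [sin_zero, mul_zero, zero_sub, sin_neg]
      have h1 : 0 < X * (r * sin η₀) := by positivity
      have h2 : 0 < R * r * sin η₀ := by positivity
      linarith
    · simp only [sub_self, sin_zero, mul_zero, add_zero]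
      have : 0 < X * ((R - r) * sin η₀) := mul_pos hX (mul_pos (by linarith) hs0)
      linarith
  obtain ⟨η, hη, hη0⟩ := intermediate_value_Ioo h0.le hf hmem
  simp only at hη0
  have hs : 0 < sin η := sin_pos_of_pos_of_lt_pi hη.1 (hη.2.trans hπ)
  have hs2 : 0 < sin (η₀ - η) := sin_pos_of_pos_of_lt_pi (by linarith [hη.2]) (by linarith [hη.1])
  have e : sin (η - η₀) = - sin (η₀ - η) := by rw [← sin_neg]; ring_nf
  have hle : r * sin η₀ ≤ R * sin η := by
    by_contra hc
    have h1 : X * (R * sin η - r * sin η₀) < 0 := mul_neg_of_pos_of_neg hX (by linarith)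
    have h2 : 0 < R * r * sin (η₀ - η) := by positivity
    rw [e] at hη0
    linarith
  have hRs : 0 < R * sin η := by positivity
  refine ⟨η, hη, r * sin η₀ / (R * sin η), ⟨by positivity, (div_le_one hRs).2 hle⟩, ?_, ?_⟩
  · rw [sin_sub] at hη0
    have hh := hs.ne'
    field_simp
    linear_combination hη0
  · field_simp

lemma TGraph.vis_of_no_rays {α β : ℝ} {Ω : Set (ℝ × ℝ)} {u : J2} (hu : TGraph α β Ω u)
    (hα : 0 < α) (hconn : IsPreconnected Ω) (hnr : ∀ y ∈ Ω, y ∉ rays Ω) {x : ℝ × ℝ} (hx : x ∈ Ω) :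
    Ω ⊆ {y | y ∈ (polarChart α x.1 hα).source ∧ polarChart α x.1 hα y ∈
      vis (chartImage (polarChart α x.1 hα) Ω) (polarChart α x.1 hα x)} := by
  set Φ := polarChart α x.1 hα with hΦ
  have hΦx : Φ x = (exp (α * x.2), 0) := by rw [hΦ, polarChart_apply]; simp
  have hxs : x ∈ Φ.source := by rw [mem_polarChart_source]; simp [pi_pos]
  have hstar : StarConvex ℝ (Φ x) Φ.target := by
    rw [hΦx]; exact starConvex_polarCoord_source (exp_pos _)
  refine eq_of_locally hconn ⟨x, hx, hxs, mem_vis_self ((mem_chartImage_apply hxs).2 hx)⟩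
    fun y hy => ?_
  by_cases hys : y ∈ Φ.source
  · obtain ⟨ε, hε, hball⟩ := Metric.isOpen_iff.1 (hu.isOpen.inter Φ.open_source) y ⟨hy, hys⟩
    refine ⟨ball y ε, ball_mem_nhds y hε, ?_⟩
    rintro ⟨p, ⟨hp1, hp2⟩, hp3⟩ z ⟨hz1, hz2⟩
    exact ⟨(hball hz1).2, hu.vis_of_isPreconnected hα.le (isChart_polarChart _ hα) hstar
      (convex_ball y ε).isPreconnected (fun w hw => (hball hw).1) (fun w hw => (hball hw).2)
      hp1 hp3.2 z hz1⟩
  have key : ∀ σ : ℝ, (σ = 1 ∨ σ = -1) → α * (y.1 - x.1) = σ * π →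
      ∃ B ∈ 𝓝 y, (B ∩ Ω ∩ {y | y ∈ Φ.source ∧ Φ y ∈ vis (chartImage Φ Ω) (Φ x)}).Nonempty →
      B ∩ Ω ⊆ {y | y ∈ Φ.source ∧ Φ y ∈ vis (chartImage Φ Ω) (Φ x)} := by
    intro σ hσ hyσ
    have hσ2 : σ * σ = 1 := by rcases hσ with h | h <;> rw [h] <;> norm_num
    obtain ⟨ε, hε, hball⟩ := Metric.isOpen_iff.1 hu.isOpen y hy
    set ρ := min ε (π / α) with hρ
    have hρ0 : 0 < ρ := lt_min hε (by positivity)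
    have hρπ : α * ρ ≤ π := by
      have := mul_le_mul_of_nonneg_left (min_le_right ε (π / α)) hα.le
      rwa [mul_div_cancel₀ _ hα.ne'] at this
    refine ⟨ball y ρ, ball_mem_nhds y hρ0, ?_⟩
    rintro ⟨p, ⟨hp1, hp2⟩, hp3⟩
    exfalso
    set L := ball y ρ ∩ {z : ℝ × ℝ | σ * (z.1 - y.1) < 0} with hL
    have hLΩ : L ⊆ Ω := fun z hz => hball (ball_subset_ball (min_le_left _ _) hz.1)
    have hexp : ∀ z : ℝ × ℝ, σ * (α * (z.1 - x.1)) = α * (σ * (z.1 - y.1)) + π := by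
      intro z
      linear_combination σ * hyσ + π * hσ2
    have hLs : L ⊆ Φ.source := by
      intro z hz
      rw [mem_polarChart_source]
      obtain ⟨h1, h2⟩ := hz
      have h2 : σ * (z.1 - y.1) < 0 := h2
      rw [mem_ball, Prod.dist_eq, max_lt_iff, Real.dist_eq, abs_lt] at h1
      have h3 : -ρ < σ * (z.1 - y.1) := by rcases hσ with h | h <;> rw [h] <;>
        linarith [h1.1.1, h1.1.2]
      have h4 := mul_lt_mul_of_pos_left h2 hα
      have h5 := mul_lt_mul_of_pos_left h3 hα
      have h6 := hexp z
      rcases hσ with h | h <;> rw [h] at h2 h3 h4 h5 h6 <;> constructor <;> linarith [pi_pos]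
    have hLc : Convex ℝ L := by
      refine (convex_ball y ρ).inter ?_
      have : {z : ℝ × ℝ | σ * (z.1 - y.1) < 0} = {z | (σ • LinearMap.fst ℝ ℝ ℝ) z < σ * y.1} := by
        ext z; simp [mul_sub]
      rw [this]
      exact convex_halfSpace_lt (LinearMap.isLinear _) _
    have hpL : p ∈ L := by
      refine ⟨hp1, ?_⟩
      have h1 := (mem_polarChart_source hα p).1 hp3.1
      have h6 := hexp p
      have h7 : σ * (α * (p.1 - x.1)) < π := by
        rcases hσ with h | h <;> rw [h] <;> linarith [h1.1, h1.2]
      have : α * (σ * (p.1 - y.1)) < 0 := by linarith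
      have := (mul_neg_iff.1 this)
      rcases this with h | h
      · exact h.2
      · linarith [h.1]
    have hall := hu.vis_of_isPreconnected hα.le (isChart_polarChart _ hα) hstar
      hLc.isPreconnected hLΩ hLs hpL hp3.2
    set η₀ := α * ρ / 2 with hη
    have hη0 : 0 < η₀ := by positivity
    have hηπ : η₀ < π := by rw [hη]; linarith [pi_pos]
    have hmemL : ∀ η, 0 < η → η ≤ η₀ → (y.1 - σ * (η / α), y.2) ∈ L := by
      intro η h1 h2
      have h3 : 0 < η / α := by positivity
      have h4 : η / α < ρ := by rw [div_lt_iff₀ hα, mul_comm]; linarith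
      refine ⟨?_, ?_⟩
      · rw [mem_ball, Prod.dist_eq, max_lt_iff, Real.dist_eq, Real.dist_eq, abs_lt]
        simp only [sub_self, abs_zero]
        refine ⟨?_, hρ0⟩
        rcases hσ with h | h <;> rw [h] <;> constructor <;> linarith
      · have : σ * (y.1 - σ * (η / α) - y.1) = -(η / α) := by linear_combination -(η / α) * hσ2
        show σ * (y.1 - σ * (η / α) - y.1) < 0
        linarith
    have hval : ∀ η t, Φ (y.1 - σ * (η / α), t) =
        (-(exp (α * t) * cos η), exp (α * t) * (σ * sin η)) := by
      intro η t
      have e : α * (y.1 - σ * (η / α) - x.1) = σ * (π - η) := by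
        have : α * (η / α) = η := by field_simp
        linear_combination hyσ - σ * this
      rw [hΦ, polarChart_apply]
      simp only [e]
      rcases hσ with h | h <;> rw [h]
      · simp [cos_pi_sub, sin_pi_sub]
      · simp [cos_sub_pi, sin_sub_pi]
    have hy' := hmemL η₀ hη0 le_rfl
    refine hnr _ (hLΩ hy') fun t ht => ?_
    simp only at ht ⊢
    rcases ht.eq_or_lt with h | h
    · rw [h]; exact hLΩ hy'
    · have hlt : exp (α * t) < exp (α * y.2) := exp_lt_exp.2 (mul_lt_mul_of_pos_left h hα)
      obtain ⟨η, hηm, τ, hτ, k1, k2⟩ :=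
        exists_ray_angle (exp_pos (α * x.2)) (exp_pos (α * t)) hlt hη0 hηπ
      have hv := hall _ (hmemL η hηm.1 hηm.2.le) τ hτ
      have heq : Φ x + τ • (Φ (y.1 - σ * (η / α), y.2) - Φ x) = Φ (y.1 - σ * (η₀ / α), t) := by
        rw [hval, hval, hΦx]
        ext
        · simp only [Prod.fst_add, Prod.smul_fst, Prod.fst_sub, smul_eq_mul]
          linear_combination k1
        · simp only [Prod.snd_add, Prod.smul_snd, Prod.snd_sub, smul_eq_mul]
          linear_combination σ * k2
      rw [heq] at hv
      refine (mem_chartImage_apply ?_).1 hv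
      have := (mem_polarChart_source hα _).1 (hLs hy')
      exact (mem_polarChart_source hα _).2 this
  rw [mem_polarChart_source] at hys
  rcases lt_trichotomy (α * (y.1 - x.1)) π with h | h | h
  · rcases lt_trichotomy (α * (y.1 - x.1)) (-π) with h' | h' | h'
    · have hc : ContinuousAt (fun z : ℝ × ℝ => α * (z.1 - x.1)) y := by fun_prop
      refine ⟨_, hc.eventually_lt_const h', ?_⟩
      rintro ⟨p, ⟨hp1, hp2⟩, hp3⟩
      have h1 : α * (p.1 - x.1) < -π := hp1
      have h2 := ((mem_polarChart_source hα p).1 hp3.1).1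
      linarith
    · exact key (-1) (Or.inr rfl) (by rw [h']; ring)
    · exact absurd ⟨h', h⟩ hys
  · exact key 1 (Or.inl rfl) (by rw [h]; ring)
  · have hc : ContinuousAt (fun z : ℝ × ℝ => α * (z.1 - x.1)) y := by fun_prop
    refine ⟨_, hc.eventually_const_lt h, ?_⟩
    rintro ⟨p, ⟨hp1, hp2⟩, hp3⟩
    have h1 : π < α * (p.1 - x.1) := hp1
    have h2 := ((mem_polarChart_source hα p).1 hp3.1).2
    linarith

lemma polarChart_rotate {α : ℝ} (hα : 0 < α) (σ σ' : ℝ) (x : ℝ × ℝ) :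
    polarChart α σ hα x =
      (cos (α * (σ' - σ)) * (polarChart α σ' hα x).1
        - sin (α * (σ' - σ)) * (polarChart α σ' hα x).2,
       sin (α * (σ' - σ)) * (polarChart α σ' hα x).1
        + cos (α * (σ' - σ)) * (polarChart α σ' hα x).2) := by
  have e : α * (x.1 - σ) = α * (σ' - σ) + α * (x.1 - σ') := by ring
  rw [polarChart_apply, polarChart_apply, e, cos_add, sin_add]
  ext <;> simp only <;> ring

lemma TGraph.sep_no_rays {α β : ℝ} {Ω : Set (ℝ × ℝ)} {u : J2} (hu : TGraph α β Ω u)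
    (hα : 0 < α) (hconn : IsPreconnected Ω) (hnr : ∀ y ∈ Ω, y ∉ rays Ω) {K : Set (ℝ × ℝ)}
    (hK : IsCompact K) (hKΩ : K ⊆ Ω) {c : ℝ × ℝ} (hc : c ∉ Ω) {t' : ℝ} (hc' : (c.1, t') ∈ Ω) :
    Separates α K c := by
  have hsrc : Ω ⊆ (polarChart α c.1 hα).source :=
    fun y hy => (hu.vis_of_no_rays hα hconn hnr hc' hy).1
  have hcs : c ∈ (polarChart α c.1 hα).source := by rw [mem_polarChart_source]; simp [pi_pos]
  refine sep_of_chart (isChart_polarChart c.1 hα) hu.isOpen hsrc ?_ hK hKΩ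
    fun h => hc ((mem_chartImage_apply hcs).1 h)
  rw [convex_iff_add_mem]
  intro p hp q hq a b ha hb hab
  set Φ := polarChart α c.1 hα with hΦ
  obtain ⟨y₁, hy1, rfl⟩ : ∃ y ∈ Ω, Φ y = p := ⟨Φ.symm p, hp.2, Φ.right_inv hp.1⟩
  obtain ⟨y₂, hy2, rfl⟩ : ∃ y ∈ Ω, Φ y = q := ⟨Φ.symm q, hq.2, Φ.right_inv hq.1⟩
  set Ψ := polarChart α y₁.1 hα with hΨ
  have hv := (hu.vis_of_no_rays hα hconn hnr hy1 hy2).2 b ⟨hb, by linarith⟩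
  obtain ⟨z, hz, hzv⟩ : ∃ z ∈ Ω, Ψ z = Ψ y₁ + b • (Ψ y₂ - Ψ y₁) :=
    ⟨Ψ.symm _, hv.2, Ψ.right_inv hv.1⟩
  have hz' : a • Φ y₁ + b • Φ y₂ = Φ z := by
    rw [hΦ, polarChart_rotate hα c.1 y₁.1 z, polarChart_rotate hα c.1 y₁.1 y₁,
      polarChart_rotate hα c.1 y₁.1 y₂, ← hΨ, hzv, show a = 1 - b by linarith]
    ext <;> simp only [Prod.fst_add, Prod.snd_add, Prod.smul_fst, Prod.smul_snd, Prod.fst_sub,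
      Prod.snd_sub, smul_eq_mul] <;> ring
  rw [hz']
  exact (mem_chartImage_apply (hsrc hz)).2 hz

lemma TGraph.separates {α β : ℝ} {Ω : Set (ℝ × ℝ)} {u : J2} (hu : TGraph α β Ω u)
    (hα : 0 ≤ α) (hconn : IsPreconnected Ω) {K : Set (ℝ × ℝ)}
    (hK : IsCompact K) (hKΩ : K ⊆ Ω) {c : ℝ × ℝ} (hc : c ∉ Ω) : Separates α K c := by
  rcases hα.eq_or_lt with rfl | hα
  · exact hu.sep_zero hconn hK hKΩ hc
  by_cases h : ∀ y ∈ Ω, y.1 ≠ c.1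
  · exact sep_of_not_mem_proj hconn hK hKΩ h
  push Not at h
  obtain ⟨y, hy, hyc⟩ := h
  have hc' : (c.1, y.2) ∈ Ω := by rw [← hyc]; exact hy
  rcases hu.rays_dichotomy hα hconn with hr | hr
  · exact hu.sep_rays hα hconn hr hK hKΩ hc hc'
  · exact hu.sep_no_rays hα hconn hr hK hKΩ hc hc'

/-- A convex function vanishing on `K` and positive on the part of `D` outside the domain. -/
lemma TGraph.exists_barrier {α β : ℝ} {Ω : Set (ℝ × ℝ)} {u : J2} (hu : TGraph α β Ω u)
    (hα : 0 ≤ α) (hconn : IsPreconnected Ω) {K D : Set (ℝ × ℝ)}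
    (hK : IsCompact K) (hKΩ : K ⊆ Ω) (hD : IsCompact D) :
    ∃ d : J2, ∃ ε > 0, FC α d ∧ (∀ x, 0 ≤ d.f x) ∧ (∀ x ∈ K, d.f x = 0) ∧
      ∀ x ∈ D, x ∉ Ω → ε < d.f x := by
  have hDΩ : IsCompact (D \ Ω) := hD.diff hu.isOpen
  obtain ⟨d, hd, hd0, hdK, hpos⟩ : ∃ d : J2, FC α d ∧ (∀ x, 0 ≤ d.f x) ∧ (∀ x ∈ K, d.f x = 0) ∧
      ∀ x ∈ D \ Ω, 0 < d.f x := by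
    refine hDΩ.induction_on (p := fun B => ∃ d : J2, FC α d ∧ (∀ x, 0 ≤ d.f x) ∧
      (∀ x ∈ K, d.f x = 0) ∧ ∀ x ∈ B, 0 < d.f x) ?_ ?_ ?_ ?_
    · exact ⟨J2.const 0, FC_const _ _, fun x => le_rfl, fun x _ => rfl, by simp⟩
    · rintro B C hBC ⟨d, h1, h2, h3, h4⟩
      exact ⟨d, h1, h2, h3, fun x hx => h4 x (hBC hx)⟩
    · rintro B C ⟨d, h1, h2, h3, h4⟩ ⟨d', h1', h2', h3', h4'⟩
      refine ⟨d + d', h1.add h1', fun x => ?_, fun x hx => ?_, ?_⟩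
      · rw [add_f]; exact add_nonneg (h2 x) (h2' x)
      · rw [add_f, h3 x hx, h3' x hx, add_zero]
      · rintro x (hx | hx) <;> rw [add_f]
        · linarith [h4 x hx, h2' x]
        · linarith [h4' x hx, h2 x]
    · rintro x ⟨-, hx⟩
      obtain ⟨d, h1, h2, h3, h4⟩ := hu.separates hα hconn hK hKΩ hx
      exact ⟨_, mem_nhdsWithin_of_mem_nhds (h1.continuous.continuousAt.eventually_const_lt h4),
        d, h1, h2, h3, fun y hy => hy⟩
  obtain ⟨b, hb, hle⟩ := exists_between_compact hDΩ (f := fun x => -d.f x) (M := 0)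
    hd.continuous.neg.continuousOn fun x hx => by linarith [hpos x hx]
  refine ⟨d, -b / 2, by linarith, hd, hd0, hdK, fun x hx hxΩ => ?_⟩
  have := hle x ⟨hx, hxΩ⟩
  linarith

lemma continuous_of_eq_zero_off {X : Type*} [TopologicalSpace X] {f : X → ℝ} {Ω T : Set X}
    (hT : IsClosed T) (hTΩ : T ⊆ Ω) (hf : ∀ x ∈ Ω, ContinuousAt f x) (h0 : ∀ x ∉ T, f x = 0) :
    Continuous f := by
  rw [continuous_iff_continuousAt]
  intro x
  by_cases hx : x ∈ T
  · exact hf x (hTΩ hx)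
  · refine (continuousAt_const (y := (0 : ℝ))).congr ?_
    filter_upwards [hT.isOpen_compl.mem_nhds hx] with y hy
    exact (h0 y hy).symm

lemma integral_fderiv_eq_zero {X : ℝ × ℝ → ℝ} {a b : ℝ × ℝ → ℝ} (v : ℝ × ℝ)
    (h : ∀ x, HasFDerivAt X (lin (a x) (b x)) x) (hs : HasCompactSupport X)
    (hc : Continuous fun x => a x * v.1 + b x * v.2) :
    ∫ x, (a x * v.1 + b x * v.2) = 0 := by
  have hd : ∀ x, fderiv ℝ X x v = a x * v.1 + b x * v.2 := fun x => by
    rw [(h x).fderiv, lin_apply]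
  have hcX : Continuous X := continuous_iff_continuousAt.2 fun x => (h x).continuousAt
  have hs' : HasCompactSupport fun x => fderiv ℝ X x v := hs.fderiv_apply ℝ v
  have hi : Integrable fun x => fderiv ℝ X x v := by
    refine Continuous.integrable_of_hasCompactSupport ?_ hs'
    simpa only [hd] using hc
  have := integral_mul_fderiv_eq_neg_fderiv_mul_of_integrable (𝕜 := ℝ)
    (f := fun _ : ℝ × ℝ => (1 : ℝ))
    (g := X) (v := v) (μ := volume) (by simp) (by simpa using hi)
    (by simpa using hcX.integrable_of_hasCompactSupport hs) (by simp)
    (fun x _ => (h x).differentiableAt)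
  simpa [hd] using this

/-- Squared area density. -/
def J2.gW (u : J2) (x : ℝ × ℝ) : ℝ := 1 + u.s x ^ 2 + u.t x ^ 2

/-- Inverse area density. -/
def J2.iW (u : J2) (x : ℝ × ℝ) : ℝ := (√(u.gW x))⁻¹

lemma J2.gW_pos (u : J2) (x : ℝ × ℝ) : 0 < u.gW x := by unfold J2.gW; positivity

lemma J2.iW_sq (u : J2) (x : ℝ × ℝ) : u.iW x ^ 2 * u.gW x = 1 := by
  rw [J2.iW, inv_pow, sq_sqrt (u.gW_pos x).le, inv_mul_cancel₀ (u.gW_pos x).ne']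

lemma J2.sqrt_gW (u : J2) (x : ℝ × ℝ) : √(u.gW x) = u.gW x * u.iW x := by
  rw [J2.iW, ← div_eq_mul_inv, div_sqrt]

lemma hasDerivAt_inv_sqrt {y : ℝ} (hy : 0 < y) :
    HasDerivAt (fun y => (√y)⁻¹) (-(1 / 2) * ((√y)⁻¹) ^ 3) y := by
  have h := (hasDerivAt_sqrt hy.ne').fun_inv (sqrt_pos.2 hy).ne'
  refine h.congr_deriv ?_
  have := (sqrt_pos.2 hy).ne'
  field_simp

lemma J2.On.iW {u : J2} {Ω : Set (ℝ × ℝ)} (hu : u.On Ω) {x : ℝ × ℝ} (hx : x ∈ Ω) :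
    HasFDerivAt u.iW (lin (-(u.iW x) ^ 3 * (u.s x * u.ss x + u.t x * u.st x))
      (-(u.iW x) ^ 3 * (u.s x * u.st x + u.t x * u.tt x))) x := by
  have h1 := hasFDerivAt_mul (hu.hs x hx) (hu.hs x hx)
  have h2 := hasFDerivAt_mul (hu.ht x hx) (hu.ht x hx)
  have h3 := (hasFDerivAt_add h1 h2).const_add 1
  have hg : HasFDerivAt u.gW _ x := h3.congr_of_eventuallyEq
    (Eventually.of_forall fun y => by simp only [J2.gW]; ring)
  refine (hasFDerivAt_comp (hasDerivAt_inv_sqrt (u.gW_pos x)) hg).congr_fderiv ?_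
  congr 1 <;> simp only [J2.iW] <;> ring

lemma J2.On.continuousAt_iW {u : J2} {Ω : Set (ℝ × ℝ)} (hu : u.On Ω) {x : ℝ × ℝ} (hx : x ∈ Ω) :
    ContinuousAt u.iW x := (hu.iW hx).continuousAt

lemma J2.On.continuousAt_gW {u : J2} {Ω : Set (ℝ × ℝ)} (hu : u.On Ω) {x : ℝ × ℝ} (hx : x ∈ Ω) :
    ContinuousAt u.gW x := by
  have h1 := hu.cs hx
  have h2 := hu.ct hx
  unfold J2.gW
  fun_prop

/-- Partial derivatives of a function of three variables. -/
def D1 (Ψ : (ℝ × ℝ) × ℝ → ℝ) (p : (ℝ × ℝ) × ℝ) : ℝ := fderiv ℝ Ψ p ((1, 0), 0)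
def D2 (Ψ : (ℝ × ℝ) × ℝ → ℝ) (p : (ℝ × ℝ) × ℝ) : ℝ := fderiv ℝ Ψ p ((0, 1), 0)
def D3 (Ψ : (ℝ × ℝ) × ℝ → ℝ) (p : (ℝ × ℝ) × ℝ) : ℝ := fderiv ℝ Ψ p ((0, 0), 1)

lemma fderiv_apply_eq (Ψ : (ℝ × ℝ) × ℝ → ℝ) (p q : (ℝ × ℝ) × ℝ) :
    fderiv ℝ Ψ p q = D1 Ψ p * q.1.1 + D2 Ψ p * q.1.2 + D3 Ψ p * q.2 := by
  have : q = q.1.1 • (((1, 0), 0) : (ℝ × ℝ) × ℝ) + q.1.2 • (((0, 1), 0) : (ℝ × ℝ) × ℝ)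
      + q.2 • (((0, 0), 1) : (ℝ × ℝ) × ℝ) := by ext <;> simp
  conv_lhs => rw [this, map_add, map_add, map_smul, map_smul, map_smul]
  simp only [D1, D2, D3, smul_eq_mul]; ring

/-- A `C¹` function with compact support lying over a compact set `T`. -/
structure IsTest (Ψ : (ℝ × ℝ) × ℝ → ℝ) (T : Set (ℝ × ℝ)) : Prop where
  contDiff : ContDiff ℝ 1 Ψ
  supp : HasCompactSupport Ψ
  off : ∀ p : (ℝ × ℝ) × ℝ, p.1 ∉ T → Ψ p = 0

namespace IsTest

variable {Ψ : (ℝ × ℝ) × ℝ → ℝ} {T : Set (ℝ × ℝ)}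

lemma fderiv_off (h : IsTest Ψ T) (hT : IsClosed T) {p : (ℝ × ℝ) × ℝ} (hp : p.1 ∉ T) :
    fderiv ℝ Ψ p = 0 := by
  have : Ψ =ᶠ[𝓝 p] fun _ => 0 := by
    filter_upwards [(hT.isOpen_compl.preimage continuous_fst).mem_nhds hp] with q hq
    exact h.off q hq
  rw [this.fderiv_eq]; simp

lemma D1_off (h : IsTest Ψ T) (hT : IsClosed T) {p : (ℝ × ℝ) × ℝ} (hp : p.1 ∉ T) :
    D1 Ψ p = 0 := by simp [D1, h.fderiv_off hT hp]
lemma D2_off (h : IsTest Ψ T) (hT : IsClosed T) {p : (ℝ × ℝ) × ℝ} (hp : p.1 ∉ T) :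
    D2 Ψ p = 0 := by simp [D2, h.fderiv_off hT hp]
lemma D3_off (h : IsTest Ψ T) (hT : IsClosed T) {p : (ℝ × ℝ) × ℝ} (hp : p.1 ∉ T) :
    D3 Ψ p = 0 := by simp [D3, h.fderiv_off hT hp]

lemma continuous_fderiv (h : IsTest Ψ T) : Continuous (fderiv ℝ Ψ) :=
  h.contDiff.continuous_fderiv one_ne_zero

lemma continuous_D1 (h : IsTest Ψ T) : Continuous (D1 Ψ) :=
  h.continuous_fderiv.clm_apply continuous_const
lemma continuous_D2 (h : IsTest Ψ T) : Continuous (D2 Ψ) :=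
  h.continuous_fderiv.clm_apply continuous_const
lemma continuous_D3 (h : IsTest Ψ T) : Continuous (D3 Ψ) :=
  h.continuous_fderiv.clm_apply continuous_const

lemma hasFDerivAt_graph (h : IsTest Ψ T) {f : ℝ × ℝ → ℝ} {a b : ℝ} {x : ℝ × ℝ}
    (hf : HasFDerivAt f (lin a b) x) :
    HasFDerivAt (fun y => Ψ (y, f y)) (lin (D1 Ψ (x, f x) + D3 Ψ (x, f x) * a)
      (D2 Ψ (x, f x) + D3 Ψ (x, f x) * b)) x := by
  have hΨ := (h.contDiff.differentiable one_ne_zero (x, f x)).hasFDerivAt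
  have := hΨ.comp x ((hasFDerivAt_id x).prodMk hf)
  refine this.congr_fderiv ?_
  ext
  · simp [fderiv_apply_eq]
  · simp [fderiv_apply_eq]

end IsTest

/-- First variation of area, for a graph moved vertically by `c`. -/
lemma TGraph.integral_D3 {α β : ℝ} {Ω T : Set (ℝ × ℝ)} {u : J2} (hu : TGraph α β Ω u)
    (hT : IsCompact T) (hTΩ : T ⊆ Ω) {Ψ : (ℝ × ℝ) × ℝ → ℝ} (hΨ : IsTest Ψ T) (c : ℝ) :
    ∫ x, D3 Ψ (x, u.f x + c) * (exp (α * x.2) * (u.gW x * u.iW x)) =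
      ∫ x, exp (α * x.2) * (u.iW x * (D3 Ψ (x, u.f x + c) - β * Ψ (x, u.f x + c)
        - D1 Ψ (x, u.f x + c) * u.s x - D2 Ψ (x, u.f x + c) * u.t x)) := by
  have hTc := hT.isClosed
  set f := fun x => u.f x + c with hf
  set E : ℝ × ℝ → ℝ := fun x => exp (α * x.2) with hE
  have dE : ∀ x, HasFDerivAt E (lin 0 (α * E x)) x := by
    intro x
    have h1 : HasFDerivAt (fun x : ℝ × ℝ => α * x.2) (lin 0 α) x := by
      have := (lin 0 α).hasFDerivAt (x := x)
      refine this.congr_of_eventuallyEq (Eventually.of_forall fun y => by simp)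
    refine (hasFDerivAt_comp (Real.hasDerivAt_exp _) h1).congr_fderiv ?_
    simp only [hE]; congr 1 <;> ring
  have hdf : ∀ x ∈ Ω, HasFDerivAt f (lin (u.s x) (u.t x)) x :=
    fun x hx => (hu.on.hf x hx).add_const c
  -- partial derivatives of the two components
  set P : ℝ × ℝ → ℝ := fun x => Ψ (x, f x) with hP
  set Ps : ℝ × ℝ → ℝ := fun x => D1 Ψ (x, f x) + D3 Ψ (x, f x) * u.s x with hPs
  set Pt : ℝ × ℝ → ℝ := fun x => D2 Ψ (x, f x) + D3 Ψ (x, f x) * u.t x with hPt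
  have dP : ∀ x ∈ Ω, HasFDerivAt P (lin (Ps x) (Pt x)) x := fun x hx =>
    hΨ.hasFDerivAt_graph (hdf x hx)
  have P0 : ∀ x ∉ T, P x = 0 := fun x hx => hΨ.off _ hx
  have Ps0 : ∀ x ∉ T, Ps x = 0 := fun x hx => by
    simp [hPs, hΨ.D1_off hTc (p := (x, f x)) hx, hΨ.D3_off hTc (p := (x, f x)) hx]
  have Pt0 : ∀ x ∉ T, Pt x = 0 := fun x hx => by
    simp [hPt, hΨ.D2_off hTc (p := (x, f x)) hx, hΨ.D3_off hTc (p := (x, f x)) hx]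
  have cf : ∀ x ∈ Ω, ContinuousAt f x := fun x hx => (hdf x hx).continuousAt
  have cP : ∀ x ∈ Ω, ContinuousAt P x := fun x hx => (dP x hx).continuousAt
  have cpair : ∀ x ∈ Ω, ContinuousAt (fun x => (x, f x)) x := fun x hx =>
    continuousAt_id.prodMk (cf x hx)
  have cD1 : ∀ x ∈ Ω, ContinuousAt (fun x => D1 Ψ (x, f x)) x := fun x hx =>
    ContinuousAt.comp (f := fun x => (x, f x)) hΨ.continuous_D1.continuousAt (cpair x hx)
  have cD2 : ∀ x ∈ Ω, ContinuousAt (fun x => D2 Ψ (x, f x)) x := fun x hx =>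
    ContinuousAt.comp (f := fun x => (x, f x)) hΨ.continuous_D2.continuousAt (cpair x hx)
  have cD3 : ∀ x ∈ Ω, ContinuousAt (fun x => D3 Ψ (x, f x)) x := fun x hx =>
    ContinuousAt.comp (f := fun x => (x, f x)) hΨ.continuous_D3.continuousAt (cpair x hx)
  have cPs : ∀ x ∈ Ω, ContinuousAt Ps x := fun x hx =>
    (cD1 x hx).add ((cD3 x hx).mul (hu.on.cs hx))
  have cPt : ∀ x ∈ Ω, ContinuousAt Pt x := fun x hx =>
    (cD2 x hx).add ((cD3 x hx).mul (hu.on.ct hx))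
  have cE : ∀ x, ContinuousAt E x := fun x => (dE x).continuousAt
  -- the vanishing integrals
  have main : ∀ (w ws wt : ℝ × ℝ → ℝ) (v : ℝ × ℝ),
      (∀ x ∈ Ω, HasFDerivAt w (lin (ws x) (wt x)) x) → (∀ x ∈ Ω, ContinuousAt ws x) →
      (∀ x ∈ Ω, ContinuousAt wt x) →
      Integrable (fun x => (Ps x * w x + P x * ws x) * v.1 + (Pt x * w x + P x * wt x) * v.2) ∧
      ∫ x, ((Ps x * w x + P x * ws x) * v.1 + (Pt x * w x + P x * wt x) * v.2) = 0 := by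
    intro w ws wt v hw cws cwt
    have cw : ∀ x ∈ Ω, ContinuousAt w x := fun x hx => (hw x hx).continuousAt
    have hcont : Continuous fun x =>
        (Ps x * w x + P x * ws x) * v.1 + (Pt x * w x + P x * wt x) * v.2 := by
      refine continuous_of_eq_zero_off hTc hTΩ (fun x hx => ?_) fun x hx => by
        simp [P0 x hx, Ps0 x hx, Pt0 x hx]
      have := cws x hx
      have := cwt x hx
      have := cw x hx
      have := cP x hx
      have := cPs x hx
      have := cPt x hx
      fun_prop
    refine ⟨hcont.integrable_of_hasCompactSupport (HasCompactSupport.intro hT fun x hx => by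
      simp [P0 x hx, Ps0 x hx, Pt0 x hx]), ?_⟩
    refine integral_fderiv_eq_zero (X := fun x => P x * w x) v (fun x => ?_)
      (HasCompactSupport.intro hT fun x hx => by simp [P0 x hx]) hcont
    by_cases hx : x ∈ T
    · exact hasFDerivAt_mul (dP x (hTΩ hx)) (hw x (hTΩ hx))
    · rw [P0 x hx, Ps0 x hx, Pt0 x hx]
      have h0 : (fun x => P x * w x) =ᶠ[𝓝 x] fun _ => 0 := by
        filter_upwards [hTc.isOpen_compl.mem_nhds hx] with y hy
        simp [P0 y hy]
      refine ((hasFDerivAt_const (0 : ℝ) x).congr_fderiv ?_).congr_of_eventuallyEq h0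
      ext <;> simp
  have dI := fun x (hx : x ∈ Ω) => hu.on.iW hx
  have cI : ∀ x ∈ Ω, ContinuousAt u.iW x := fun x hx => hu.on.continuousAt_iW hx
  have cEI : ∀ x ∈ Ω, ContinuousAt E x ∧ ContinuousAt u.iW x ∧ ContinuousAt u.s x ∧
      ContinuousAt u.t x ∧ ContinuousAt u.ss x ∧ ContinuousAt u.st x ∧ ContinuousAt u.tt x :=
    fun x hx => ⟨cE x, cI x hx, hu.on.cs hx, hu.on.ct hx, hu.on.css x hx, hu.on.cst x hx,
      hu.on.ctt x hx⟩
  have A1 := main _ _ _ (1, 0) (fun x hx => hasFDerivAt_mul (dE x)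
    (hasFDerivAt_mul (hu.on.hs x hx) (dI x hx)))
    (fun x hx => by obtain ⟨_, _, _, _, _, _, _⟩ := cEI x hx; fun_prop)
    (fun x hx => by obtain ⟨_, _, _, _, _, _, _⟩ := cEI x hx; fun_prop)
  have A2 := main _ _ _ (0, 1) (fun x hx => hasFDerivAt_mul (dE x)
    (hasFDerivAt_mul (hu.on.ht x hx) (dI x hx)))
    (fun x hx => by obtain ⟨_, _, _, _, _, _, _⟩ := cEI x hx; fun_prop)
    (fun x hx => by obtain ⟨_, _, _, _, _, _, _⟩ := cEI x hx; fun_prop)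
  have hsum := integral_add A1.1 A2.1
  rw [A1.2, A2.2, add_zero] at hsum
  have cG : ∀ x ∈ Ω, ContinuousAt u.gW x := fun x hx => hu.on.continuousAt_gW hx
  have i1 : Integrable fun x => D3 Ψ (x, f x) * (E x * (u.gW x * u.iW x)) := by
    have off : ∀ x ∉ T, D3 Ψ (x, f x) * (E x * (u.gW x * u.iW x)) = 0 := fun x hx => by
      rw [hΨ.D3_off hTc (p := (x, f x)) hx, zero_mul]
    exact (continuous_of_eq_zero_off hTc hTΩ (fun x hx => (cD3 x hx).mul
      ((cE x).mul ((cG x hx).mul (cI x hx)))) off).integrable_of_hasCompactSupport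
      (HasCompactSupport.intro hT off)
  have i2 : Integrable fun x => E x * (u.iW x * (D3 Ψ (x, f x) - β * Ψ (x, f x)
        - D1 Ψ (x, f x) * u.s x - D2 Ψ (x, f x) * u.t x)) := by
    have off : ∀ x ∉ T, E x * (u.iW x * (D3 Ψ (x, f x) - β * Ψ (x, f x)
        - D1 Ψ (x, f x) * u.s x - D2 Ψ (x, f x) * u.t x)) = 0 := fun x hx => by
      rw [hΨ.D3_off hTc (p := (x, f x)) hx, hΨ.D2_off hTc (p := (x, f x)) hx,
        hΨ.D1_off hTc (p := (x, f x)) hx, hΨ.off (x, f x) hx]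
      simp
    exact (continuous_of_eq_zero_off hTc hTΩ (fun x hx => (cE x).mul ((cI x hx).mul
      ((((cD3 x hx).sub (continuousAt_const.mul (cP x hx))).sub
        ((cD1 x hx).mul (hu.on.cs hx))).sub ((cD2 x hx).mul (hu.on.ct hx)))))
      off).integrable_of_hasCompactSupport (HasCompactSupport.intro hT off)
  rw [← sub_eq_zero]
  refine (integral_sub i1 i2).symm.trans ?_
  refine Eq.trans (integral_congr_ae (Eventually.of_forall fun x => ?_)) hsum
  simp only
  by_cases hx : x ∈ T
  · have hpde := hu.pde x (hTΩ hx)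
    have hi := u.iW_sq x
    simp only [hPs, hPt, hP]
    have hg : u.gW x = 1 + u.s x ^ 2 + u.t x ^ 2 := rfl
    rw [hg] at hi ⊢
    set i := u.iW x
    linear_combination (-(i ^ 3) * Ψ (x, f x) * E x) * hpde
      + (-(i * Ψ (x, f x) * E x) * (β - α * u.t x - (u.ss x + u.tt x))) * hi
  · rw [Ps0 x hx, Pt0 x hx, P0 x hx, hΨ.D3_off hTc (p := (x, f x)) hx,
      hΨ.D2_off hTc (p := (x, f x)) hx, hΨ.D1_off hTc (p := (x, f x)) hx, hΨ.off (x, f x) hx]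
    simp

lemma continuous_shift {Ω T : Set (ℝ × ℝ)} (hT : IsCompact T) (hTΩ : T ⊆ Ω)
    {F : (ℝ × ℝ) × ℝ → ℝ} (hF : Continuous F) (off : ∀ p : (ℝ × ℝ) × ℝ, p.1 ∉ T → F p = 0)
    {f m : ℝ × ℝ → ℝ} (hf : ∀ x ∈ Ω, ContinuousAt f x) (hm : ∀ x ∈ Ω, ContinuousAt m x) :
    Continuous fun p : (ℝ × ℝ) × ℝ => F (p.1, f p.1 + p.2) * m p.1 := by
  refine continuous_of_eq_zero_off (T := Prod.fst ⁻¹' T) (Ω := Prod.fst ⁻¹' Ω)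
    (hT.isClosed.preimage continuous_fst) (Set.preimage_mono hTΩ) (fun p hp => ?_) fun p hp => by
      rw [off (p.1, f p.1 + p.2) hp, zero_mul]
  have h1 : ContinuousAt (fun p : (ℝ × ℝ) × ℝ => f p.1) p :=
    ContinuousAt.comp (f := Prod.fst) (hf _ hp) continuousAt_fst
  have h2 : ContinuousAt (fun p : (ℝ × ℝ) × ℝ => m p.1) p :=
    ContinuousAt.comp (f := Prod.fst) (hm _ hp) continuousAt_fst
  have h3 : ContinuousAt (fun p : (ℝ × ℝ) × ℝ => F (p.1, f p.1 + p.2)) p :=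
    ContinuousAt.comp (f := fun p : (ℝ × ℝ) × ℝ => (p.1, f p.1 + p.2)) hF.continuousAt
      (continuousAt_fst.prodMk (h1.add continuousAt_snd))
  exact h3.mul h2

lemma hasCompactSupport_shift {Ω T : Set (ℝ × ℝ)} (hT : IsCompact T) (hTΩ : T ⊆ Ω)
    {F : (ℝ × ℝ) × ℝ → ℝ} (hs : HasCompactSupport F)
    (off : ∀ p : (ℝ × ℝ) × ℝ, p.1 ∉ T → F p = 0)
    {f : ℝ × ℝ → ℝ} (m : ℝ × ℝ → ℝ) (hf : ∀ x ∈ Ω, ContinuousAt f x) :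
    HasCompactSupport fun p : (ℝ × ℝ) × ℝ => F (p.1, f p.1 + p.2) * m p.1 := by
  obtain ⟨M, hM⟩ := hT.exists_bound_of_continuousOn
    (fun x hx => (hf x (hTΩ hx)).continuousWithinAt)
  obtain ⟨R, hR⟩ := hs.isCompact.exists_bound_of_continuousOn
    (f := fun p : (ℝ × ℝ) × ℝ => p.2) continuous_snd.continuousOn
  refine HasCompactSupport.intro (hT.prod (isCompact_Icc (a := -(R + M)) (b := R + M)))
    fun p hp => ?_
  by_cases h1 : p.1 ∈ T
  · have h2 : (p.1, f p.1 + p.2) ∉ tsupport F := fun h => hp ⟨h1, by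
      have a1 := abs_le.1 (hR _ h)
      have a2 := abs_le.1 (hM _ h1)
      simp only at a1
      constructor <;> linarith [a1.1, a1.2, a2.1, a2.2]⟩
    rw [image_eq_zero_of_notMem_tsupport h2, zero_mul]
  · rw [off (p.1, f p.1 + p.2) h1, zero_mul]

/-- The weighted horizontal length of the differential of `Ψ`, with the vertical part twisted by
`β`. -/
def slant (β : ℝ) (Ψ : (ℝ × ℝ) × ℝ → ℝ) (p : (ℝ × ℝ) × ℝ) : ℝ :=
  √(D1 Ψ p ^ 2 + D2 Ψ p ^ 2 + (D3 Ψ p - β * Ψ p) ^ 2)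

namespace IsTest
variable {Ψ : (ℝ × ℝ) × ℝ → ℝ} {T : Set (ℝ × ℝ)}

lemma continuous_slant (h : IsTest Ψ T) (β : ℝ) : Continuous (slant β Ψ) := by
  have := h.continuous_D1
  have := h.continuous_D2
  have := h.continuous_D3
  have := h.contDiff.continuous
  unfold slant
  fun_prop

lemma hasCompactSupport_D3 (h : IsTest Ψ T) : HasCompactSupport (D3 Ψ) :=
  h.supp.fderiv_apply ℝ _

lemma hasCompactSupport_slant (h : IsTest Ψ T) (β : ℝ) : HasCompactSupport (slant β Ψ) := by
  refine HasCompactSupport.intro h.supp.isCompact fun p hp => ?_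
  have h1 : Ψ p = 0 := image_eq_zero_of_notMem_tsupport hp
  have h2 : fderiv ℝ Ψ p = 0 := by
    by_contra h0
    exact hp (support_fderiv_subset ℝ h0)
  simp [slant, D1, D2, D3, h1, h2]

lemma slant_off (h : IsTest Ψ T) (hT : IsClosed T) (β : ℝ) (p : (ℝ × ℝ) × ℝ) (hp : p.1 ∉ T) :
    slant β Ψ p = 0 := by
  simp [slant, h.D1_off hT hp, h.D2_off hT hp, h.D3_off hT hp, h.off p hp]

end IsTest

lemma abs_le_slant (u : J2) (x : ℝ × ℝ) (a b c : ℝ) :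
    |u.iW x * (c - a * u.s x - b * u.t x)| ≤ √(a ^ 2 + b ^ 2 + c ^ 2) := by
  refine abs_le_sqrt ?_
  have h := u.iW_sq x
  have hi := sq_nonneg (u.iW x)
  rw [J2.gW] at h
  rw [mul_pow]
  have : (c - a * u.s x - b * u.t x) ^ 2 ≤
      (a ^ 2 + b ^ 2 + c ^ 2) * (1 + u.s x ^ 2 + u.t x ^ 2) := by
    nlinarith [sq_nonneg (c * u.s x + a), sq_nonneg (c * u.t x + b),
      sq_nonneg (a * u.t x - b * u.s x)]
  calc _ ≤ u.iW x ^ 2 * ((a ^ 2 + b ^ 2 + c ^ 2) * (1 + u.s x ^ 2 + u.t x ^ 2)) := by gcongr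
    _ = _ := by linear_combination (a ^ 2 + b ^ 2 + c ^ 2) * h

/-- The area inequality satisfied by a graphical minimal surface. -/
lemma TGraph.two_mul_integral_le {α β : ℝ} {Ω T : Set (ℝ × ℝ)} {u : J2} (hu : TGraph α β Ω u)
    (hT : IsCompact T) (hTΩ : T ⊆ Ω) {Ψ : (ℝ × ℝ) × ℝ → ℝ} (hΨ : IsTest Ψ T) :
    2 * ∫ x, Ψ (x, u.f x) * (exp (α * x.2) * √(u.gW x)) ≤
      ∫ p : (ℝ × ℝ) × ℝ, exp (α * p.1.2) * slant β Ψ p := by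
  have hTc := hT.isClosed
  set m : ℝ × ℝ → ℝ := fun x => exp (α * x.2) * (u.gW x * u.iW x) with hm
  have cm : ∀ x ∈ Ω, ContinuousAt m x := fun x hx =>
    (by fun_prop : Continuous fun x : ℝ × ℝ => exp (α * x.2)).continuousAt.mul
      ((hu.on.continuousAt_gW hx).mul (hu.on.continuousAt_iW hx))
  have cE : Continuous fun x : ℝ × ℝ => exp (α * x.2) := by fun_prop
  have cu : ∀ x ∈ Ω, ContinuousAt u.f x := fun x hx => hu.on.cf hx
  set H : (ℝ × ℝ) × ℝ → ℝ := fun p => D3 Ψ (p.1, u.f p.1 + p.2) * m p.1 with hH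
  have cH : Continuous H :=
    continuous_shift hT hTΩ hΨ.continuous_D3 (fun p hp => hΨ.D3_off hTc hp) cu cm
  have sH : HasCompactSupport H := hasCompactSupport_shift hT hTΩ hΨ.hasCompactSupport_D3
    (fun p hp => hΨ.D3_off hTc hp) m cu
  have iH : Integrable H := cH.integrable_of_hasCompactSupport sH
  set G : (ℝ × ℝ) × ℝ → ℝ := fun p => slant β Ψ (p.1, u.f p.1 + p.2) * exp (α * p.1.2) with hG
  have cG : Continuous G := continuous_shift (m := fun x => exp (α * x.2)) hT hTΩ
    (hΨ.continuous_slant β) (hΨ.slant_off hTc β) cu (fun x _ => cE.continuousAt)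
  have sG : HasCompactSupport G := hasCompactSupport_shift hT hTΩ
    (hΨ.hasCompactSupport_slant β) (hΨ.slant_off hTc β) (fun x => exp (α * x.2)) cu
  have iG : Integrable G := cG.integrable_of_hasCompactSupport sG
  have iP : Integrable fun p : (ℝ × ℝ) × ℝ => exp (α * p.1.2) * slant β Ψ p :=
    ((by fun_prop : Continuous fun p : (ℝ × ℝ) × ℝ => exp (α * p.1.2)).mul
      (hΨ.continuous_slant β)).integrable_of_hasCompactSupport
      (hΨ.hasCompactSupport_slant β).mul_left
  have iH2 : Integrable H ((volume : Measure (ℝ × ℝ)).prod (volume : Measure ℝ)) := iH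
  have iG2 : Integrable G ((volume : Measure (ℝ × ℝ)).prod (volume : Measure ℝ)) := iG
  set I : ℝ → ℝ := fun c => ∫ x, H (x, c) with hI
  have iI : Integrable I := iH2.integral_prod_right
  -- the pointwise bound
  have bound : ∀ c, |I c| ≤ ∫ x, G (x, c) := by
    intro c
    have h1 : I c = _ := hu.integral_D3 hT hTΩ hΨ c
    rw [h1, ← Real.norm_eq_abs]
    refine norm_integral_le_of_norm_le ?_ (Eventually.of_forall fun x => ?_)
    · have := cG.comp (by fun_prop : Continuous fun x : ℝ × ℝ => (x, c))
      refine this.integrable_of_hasCompactSupport (HasCompactSupport.intro hT fun x hx => ?_)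
      simp [hG, hΨ.slant_off hTc β (x, u.f x + c) hx]
    · rw [norm_mul, Real.norm_of_nonneg (exp_pos _).le, mul_comm]
      exact mul_le_mul_of_nonneg_right (abs_le_slant u x _ _ _) (exp_pos _).le
  -- integration in the vertical direction
  have hder : ∀ x c, HasDerivAt (fun c => Ψ (x, u.f x + c) * m x) (H (x, c)) c := by
    intro x c
    have h1 := (hΨ.contDiff.differentiable one_ne_zero (x, u.f x + c)).hasFDerivAt
    have h2 : HasDerivAt (fun c : ℝ => (x, u.f x + c)) ((0, 0), 1) c :=
      (hasDerivAt_const c x).prodMk ((hasDerivAt_id c).const_add _)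
    exact (h1.comp_hasDerivAt c h2).mul_const _
  have hslice : ∀ x, HasCompactSupport fun c => Ψ (x, u.f x + c) * m x := by
    intro x
    refine HasCompactSupport.intro (hΨ.supp.isCompact.image
      (by fun_prop : Continuous fun p : (ℝ × ℝ) × ℝ => p.2 - u.f x)) fun c hc => ?_
    have h0 : (x, u.f x + c) ∉ tsupport Ψ := fun h => hc ⟨_, h, by simp⟩
    rw [image_eq_zero_of_notMem_tsupport h0, zero_mul]
  have hdeq : ∀ x, deriv (fun c => Ψ (x, u.f x + c) * m x) = fun c => H (x, c) := fun x =>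
    funext fun c => (hder x c).deriv
  have hC1 : ∀ x, ContDiff ℝ 1 fun c => Ψ (x, u.f x + c) * m x := fun x =>
    (hΨ.contDiff.comp (by fun_prop : ContDiff ℝ 1 fun c : ℝ => (x, u.f x + c))).mul contDiff_const
  have hIoi : ∀ x, ∫ c in Set.Ioi 0, H (x, c) = -(Ψ (x, u.f x) * m x) := fun x => by
    have := HasCompactSupport.integral_Ioi_deriv_eq (hC1 x) (hslice x) 0
    rwa [hdeq, add_zero] at this
  have hIic : ∀ x, ∫ c in Set.Iic 0, H (x, c) = Ψ (x, u.f x) * m x := fun x => by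
    have := HasCompactSupport.integral_Iic_deriv_eq (hC1 x) (hslice x) 0
    rwa [hdeq, add_zero] at this
  have swap : ∀ A : Set ℝ, ∫ c in A, I c = ∫ x, ∫ c in A, H (x, c) := fun A => by
    refine (integral_integral_swap (f := fun x c => H (x, c)) (μ := volume)
      (ν := volume.restrict A) ?_).symm
    have h3 := iH2.restrict (s := Set.univ ×ˢ A)
    rw [← Measure.prod_restrict, Measure.restrict_univ] at h3
    exact h3
  have eA : ∫ x, Ψ (x, u.f x) * (exp (α * x.2) * √(u.gW x)) = ∫ x, Ψ (x, u.f x) * m x := by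
    simp only [hm, J2.sqrt_gW]
  have e1 : ∫ c in Set.Ioi 0, I c = -∫ x, Ψ (x, u.f x) * m x := by
    rw [swap, ← integral_neg]; simp only [hIoi]
  have e2 : ∫ c in Set.Iic 0, I c = ∫ x, Ψ (x, u.f x) * m x := by
    rw [swap]; simp only [hIic]
  have e3 : ∫ c, |I c| = (∫ c in Set.Iic 0, |I c|) + ∫ c in Set.Ioi 0, |I c| := by
    rw [← integral_add_compl measurableSet_Iic iI.abs, Set.compl_Iic]
  have b1 : (∫ c in Set.Iic 0, I c) ≤ ∫ c in Set.Iic 0, |I c| :=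
    (le_abs_self _).trans abs_integral_le_integral_abs
  have b2 : -(∫ c in Set.Ioi 0, I c) ≤ ∫ c in Set.Ioi 0, |I c| :=
    (neg_le_abs _).trans abs_integral_le_integral_abs
  have e4 : ∫ c, |I c| ≤ ∫ c, ∫ x, G (x, c) :=
    integral_mono iI.abs iG2.integral_prod_right bound
  have e5 : ∫ c, ∫ x, G (x, c) = ∫ p : (ℝ × ℝ) × ℝ, exp (α * p.1.2) * slant β Ψ p := by
    rw [← integral_integral_swap (f := fun x c => G (x, c)) iG2]
    have : (∫ p : (ℝ × ℝ) × ℝ, exp (α * p.1.2) * slant β Ψ p) =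
      ∫ x : ℝ × ℝ, ∫ c : ℝ, exp (α * x.2) * slant β Ψ (x, c) := integral_prod _ iP
    rw [this]
    refine integral_congr_ae (Eventually.of_forall fun x => ?_)
    simp only [hG]
    rw [integral_add_left_eq_self (fun c => slant β Ψ (x, c) * exp (α * x.2)) (u.f x)]
    simp only [mul_comm]
  rw [eA]
  linarith

lemma HasCompactSupport.of_zero {X : Type*} [TopologicalSpace X] [R1Space X] {f g : X → ℝ}
    (hf : HasCompactSupport f) (h : ∀ x, x ∉ tsupport f → g x = 0) : HasCompactSupport g :=
  HasCompactSupport.intro hf.isCompact fun x hx => h x hx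

lemma hasFDerivAt_lin_off {ψ ψs ψt : ℝ × ℝ → ℝ}
    (hψ : ∀ x, HasFDerivAt ψ (lin (ψs x) (ψt x)) x) {x : ℝ × ℝ} (hx : x ∉ tsupport ψ) :
    ψs x = 0 ∧ ψt x = 0 := by
  have h0 : fderiv ℝ ψ x = 0 := by
    by_contra h0
    exact hx (support_fderiv_subset ℝ h0)
  rw [(hψ x).fderiv] at h0
  have h1 := DFunLike.congr_fun h0 (1, 0)
  have h2 := DFunLike.congr_fun h0 (0, 1)
  simp at h1 h2
  exact ⟨h1, h2⟩

/-- Regularised reciprocal of the length of the gradient. -/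
def J2.iS (α δ : ℝ) (d : J2) (x : ℝ × ℝ) : ℝ :=
  (√(δ ^ 2 * exp (α * x.2) ^ 2 + (d.s x ^ 2 + d.t x ^ 2)))⁻¹

lemma hasFDerivAt_exp_snd (α : ℝ) (x : ℝ × ℝ) :
    HasFDerivAt (fun x : ℝ × ℝ => exp (α * x.2)) (lin 0 (α * exp (α * x.2))) x := by
  have h1 : HasFDerivAt (fun x : ℝ × ℝ => α * x.2) (lin 0 α) x :=
    (lin 0 α).hasFDerivAt.congr_of_eventuallyEq (Eventually.of_forall fun y => by simp)
  refine (hasFDerivAt_comp (Real.hasDerivAt_exp _) h1).congr_fderiv ?_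
  congr 1 <;> ring

lemma J2.On.hasFDerivAt_iS {d : J2} {U : Set (ℝ × ℝ)} (hd : d.On U) {α δ : ℝ} (hδ : 0 < δ)
    {x : ℝ × ℝ} (hx : x ∈ U) : HasFDerivAt (d.iS α δ) (lin
      (-(d.iS α δ x) ^ 3 * (d.s x * d.ss x + d.t x * d.st x))
      (-(d.iS α δ x) ^ 3 * (α * δ ^ 2 * exp (α * x.2) ^ 2 + d.s x * d.st x + d.t x * d.tt x)))
      x := by
  have h0 := hasFDerivAt_exp_snd α x
  have h1 := hasFDerivAt_mul (hd.hs x hx) (hd.hs x hx)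
  have h2 := hasFDerivAt_mul (hd.ht x hx) (hd.ht x hx)
  have h3 := hasFDerivAt_const_mul (δ ^ 2) (hasFDerivAt_mul h0 h0)
  have h4 := hasFDerivAt_add h3 (hasFDerivAt_add h1 h2)
  have hq : HasFDerivAt
      (fun x : ℝ × ℝ => δ ^ 2 * exp (α * x.2) ^ 2 + (d.s x ^ 2 + d.t x ^ 2)) _ x :=
    h4.congr_of_eventuallyEq (Eventually.of_forall fun y => by ring)
  have hpos : 0 < δ ^ 2 * exp (α * x.2) ^ 2 + (d.s x ^ 2 + d.t x ^ 2) := by positivity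
  refine (hasFDerivAt_comp (hasDerivAt_inv_sqrt hpos) hq).congr_fderiv ?_
  congr 1 <;> simp only [J2.iS] <;> ring

lemma integral_div_eq_zero {X Y a b a' b' : ℝ × ℝ → ℝ}
    (hX : ∀ x, HasFDerivAt X (lin (a x) (b x)) x) (hY : ∀ x, HasFDerivAt Y (lin (a' x) (b' x)) x)
    (sX : HasCompactSupport X) (sY : HasCompactSupport Y) (ca : Continuous a)
    (cb : Continuous b') : Integrable (fun x => a x + b' x) ∧ ∫ x, (a x + b' x) = 0 := by
  have h1 := integral_fderiv_eq_zero (1, 0) hX sX (by simpa using ca)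
  have h2 := integral_fderiv_eq_zero (0, 1) hY sY (by simpa using cb)
  simp only [mul_one, mul_zero, add_zero, zero_add] at h1 h2
  have i1 : Integrable a := ca.integrable_of_hasCompactSupport
    (sX.of_zero fun x hx => (hasFDerivAt_lin_off hX hx).1)
  have i2 : Integrable b' := cb.integrable_of_hasCompactSupport
    (sY.of_zero fun x hx => (hasFDerivAt_lin_off hY hx).2)
  exact ⟨i1.add i2, by rw [integral_add i1 i2, h1, h2, add_zero]⟩

lemma integral_le_of_zero {f g h k : ℝ × ℝ → ℝ} {δ : ℝ} (hf : Integrable f) (hg : Integrable g)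
    (hh : Integrable h) (hk : Integrable k) (hk0 : ∫ x, k x = 0)
    (hle : ∀ x, f x ≤ g x + δ * h x + k x) : ∫ x, f x ≤ (∫ x, g x) + δ * ∫ x, h x := by
  have h1 := integral_mono hf ((hg.add (hh.const_mul δ)).add hk) hle
  rw [integral_add' (hg.add (hh.const_mul δ)) hk, integral_add' hg (hh.const_mul δ), hk0,
    integral_const_mul, add_zero] at h1
  exact h1

lemma div_pointwise {s t ss st tt ψ ψs ψt θ θ' e i δ α : ℝ} (hip : 0 < i)
    (hi2 : i ^ 2 * (δ ^ 2 * e ^ 2 + (s ^ 2 + t ^ 2)) = 1) (he : 0 < e) (hδ : 0 ≤ δ)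
    (hψx : 0 ≤ ψ) (ht1 : 0 ≤ θ) (ht2 : 0 ≤ θ')
    (hp : ∀ a b : ℝ, 0 ≤ (ss + α * t) * a ^ 2 + 2 * (st - α * s) * (a * b)
      + (tt - α * t) * b ^ 2) :
    ψ * (θ' * √(s ^ 2 + t ^ 2)) * e ≤ θ * √(ψs ^ 2 + ψt ^ 2) * e + δ * (ψ * θ' * e ^ 2) +
      ((ψs * (θ * e) + ψ * (θ' * s * e + θ * 0)) * (s * i) +
          ψ * (θ * e) * (ss * i + s * (-i ^ 3 * (s * ss + t * st))) +
        ((ψt * (θ * e) + ψ * (θ' * t * e + θ * (α * e))) * (t * i) +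
          ψ * (θ * e) * (tt * i + t * (-i ^ 3 * (α * δ ^ 2 * e ^ 2 + s * st + t * tt))))) := by
  have hp1 := hp 1 0
  have hp2 := hp 0 1
  have hp3 := hp t (-s)
  have hL := sq_sqrt (add_nonneg (sq_nonneg s) (sq_nonneg t))
  have hL0 := sqrt_nonneg (s ^ 2 + t ^ 2)
  have hN := sq_sqrt (add_nonneg (sq_nonneg ψs) (sq_nonneg ψt))
  have hN0 := sqrt_nonneg (ψs ^ 2 + ψt ^ 2)
  set L := √(s ^ 2 + t ^ 2)
  set N := √(ψs ^ 2 + ψt ^ 2)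
  -- the field has nonnegative divergence
  have hE : 0 ≤ i ^ 3 * (δ ^ 2 * e ^ 2 * (ss + tt) +
      (ss * t ^ 2 - 2 * st * s * t + tt * s ^ 2 +
        α * t * (s ^ 2 + t ^ 2))) := by
    have : 0 ≤ ss + tt := by linarith
    have h3 : 0 ≤ ss * t ^ 2 - 2 * st * s * t + tt * s ^ 2 +
        α * t * (s ^ 2 + t ^ 2) := by linarith
    positivity
  -- the Cauchy-Schwarz bound
  have hiL : i * L ≤ 1 := by
    refine abs_le_of_sq_le_sq' ?_ zero_le_one |>.2
    have : 0 ≤ i ^ 2 * (δ ^ 2 * e ^ 2) := by positivity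
    rw [mul_pow, hL]
    linarith
  have hie : i * (δ * e) ≤ 1 := by
    refine abs_le_of_sq_le_sq' ?_ zero_le_one |>.2
    have : 0 ≤ i ^ 2 * (s ^ 2 + t ^ 2) := by positivity
    linarith
  have hcs : -(ψs * s + ψt * t) ≤ N * L := by
    refine abs_le_of_sq_le_sq' ?_ (by positivity) |>.2
    rw [mul_pow, hN, hL]
    linarith [sq_nonneg (ψs * t - ψt * s)]
  have hcs' : -(i * (ψs * s + ψt * t)) ≤ N := by
    have h1 := mul_le_mul_of_nonneg_left hcs hip.le
    have h2 := mul_le_mul_of_nonneg_left hiL hN0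
    have h3 : i * (N * L) = N * (i * L) := by ring
    linarith
  have hLS : L ≤ δ * e + i * (s ^ 2 + t ^ 2) := by
    have h1 : i * L ^ 2 + i * (δ * e) ^ 2 = i⁻¹ := by
      rw [hL]; field_simp; linarith
    have h2 : L ≤ i⁻¹ := by
      rwa [← one_div, le_div_iff₀ hip, mul_comm]
    have h3 : i * (δ * e) ^ 2 ≤ δ * e := by
      have h4 := mul_le_mul_of_nonneg_right hie (by positivity : 0 ≤ δ * e)
      linarith
    rw [← hL]
    linarith
  have k1 : ψ * θ' * e * L ≤ ψ * θ' * e *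
      (δ * e + i * (s ^ 2 + t ^ 2)) :=
    mul_le_mul_of_nonneg_left hLS (by positivity)
  have k2 := mul_le_mul_of_nonneg_left hcs' (by positivity : 0 ≤ θ * e)
  have k3 := mul_nonneg (by positivity : 0 ≤ ψ * θ * e) hE
  have key2 : i ^ 3 * (δ ^ 2 * e ^ 2 * (ss + tt) +
      (ss * t ^ 2 - 2 * st * s * t + tt * s ^ 2 +
        α * t * (s ^ 2 + t ^ 2))) = i * (ss + tt + α * t) -
    i ^ 3 * (s * (s * ss + t * st) +
      t * (α * δ ^ 2 * e ^ 2 + s * st + t * tt)) := by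
    linear_combination (i * (ss + tt + α * t)) * hi2
  rw [key2] at k3
  linarith

/-- Integrated monotonicity of level-set length for a convex function of the flat metric. -/
lemma FC.integral_le {α : ℝ} {d : J2} (hd : FC α d) {ψ ψs ψt : ℝ × ℝ → ℝ}
    (hψ : ∀ x, HasFDerivAt ψ (lin (ψs x) (ψt x)) x) (hψ0 : ∀ x, 0 ≤ ψ x)
    (cψs : Continuous ψs) (cψt : Continuous ψt) (sψ : HasCompactSupport ψ)
    {θ θ' : ℝ → ℝ} (hθ : ∀ y, HasDerivAt θ (θ' y) y) (cθ' : Continuous θ') (hθ0 : ∀ y, 0 ≤ θ y)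
    (hθ'0 : ∀ y, 0 ≤ θ' y) :
    ∫ x, ψ x * (θ' (d.f x) * √(d.s x ^ 2 + d.t x ^ 2)) * exp (α * x.2) ≤
      ∫ x, θ (d.f x) * √(ψs x ^ 2 + ψt x ^ 2) * exp (α * x.2) := by
  have hon := hd.1
  have cd : Continuous d.f := continuous_iff_continuousAt.2 fun x => hon.cf (Set.mem_univ x)
  have cs : Continuous d.s := continuous_iff_continuousAt.2 fun x => hon.cs (Set.mem_univ x)
  have ct : Continuous d.t := continuous_iff_continuousAt.2 fun x => hon.ct (Set.mem_univ x)
  have css : Continuous d.ss := continuous_iff_continuousAt.2 fun x => hon.css x (Set.mem_univ x)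
  have cst : Continuous d.st := continuous_iff_continuousAt.2 fun x => hon.cst x (Set.mem_univ x)
  have ctt : Continuous d.tt := continuous_iff_continuousAt.2 fun x => hon.ctt x (Set.mem_univ x)
  have cθ : Continuous θ := continuous_iff_continuousAt.2 fun y => (hθ y).continuousAt
  have cψ : Continuous ψ := continuous_iff_continuousAt.2 fun x => (hψ x).continuousAt
  have cθd : Continuous fun x => θ (d.f x) := cθ.comp cd
  have cθd' : Continuous fun x => θ' (d.f x) := cθ'.comp cd
  have ce : Continuous fun x : ℝ × ℝ => exp (α * x.2) := by fun_prop
  have off : ∀ x, x ∉ tsupport ψ → ψ x = 0 ∧ ψs x = 0 ∧ ψt x = 0 := fun x hx =>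
    ⟨image_eq_zero_of_notMem_tsupport hx, hasFDerivAt_lin_off hψ hx⟩
  have iL : Integrable fun x => ψ x * (θ' (d.f x) * √(d.s x ^ 2 + d.t x ^ 2)) * exp (α * x.2) := by
    refine Continuous.integrable_of_hasCompactSupport (by fun_prop) (sψ.of_zero fun x hx => ?_)
    simp [off x hx]
  have iR : Integrable fun x => θ (d.f x) * √(ψs x ^ 2 + ψt x ^ 2) * exp (α * x.2) := by
    refine Continuous.integrable_of_hasCompactSupport (by fun_prop) (sψ.of_zero fun x hx => ?_)
    simp [off x hx]
  have iM : Integrable fun x => ψ x * θ' (d.f x) * exp (α * x.2) ^ 2 := by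
    refine Continuous.integrable_of_hasCompactSupport (by fun_prop) (sψ.of_zero fun x hx => ?_)
    simp [off x hx]
  have key : ∀ δ > 0, ∫ x, ψ x * (θ' (d.f x) * √(d.s x ^ 2 + d.t x ^ 2)) * exp (α * x.2) ≤
      (∫ x, θ (d.f x) * √(ψs x ^ 2 + ψt x ^ 2) * exp (α * x.2)) +
        δ * ∫ x, ψ x * θ' (d.f x) * exp (α * x.2) ^ 2 := by
    intro δ hδ
    set i := d.iS α δ with hi
    have ci : Continuous i := continuous_iff_continuousAt.2 fun x =>
      (hon.hasFDerivAt_iS hδ (Set.mem_univ x)).continuousAt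
    have dY : ∀ x, HasFDerivAt (fun x => ψ x * (θ (d.f x) * exp (α * x.2))) _ x := fun x =>
      hasFDerivAt_mul (hψ x) (hasFDerivAt_mul (hasFDerivAt_comp (hθ _)
        (hon.hf x (Set.mem_univ x))) (hasFDerivAt_exp_snd α x))
    have dX1 := fun x => hasFDerivAt_mul (dY x) (hasFDerivAt_mul (hon.hs x (Set.mem_univ x))
      (hon.hasFDerivAt_iS (α := α) hδ (Set.mem_univ x)))
    have dX2 := fun x => hasFDerivAt_mul (dY x) (hasFDerivAt_mul (hon.ht x (Set.mem_univ x))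
      (hon.hasFDerivAt_iS (α := α) hδ (Set.mem_univ x)))
    rw [← hi] at dX1 dX2
    obtain ⟨i1, c1⟩ := integral_div_eq_zero dX1 dX2
      (sψ.of_zero fun x hx => by simp [off x hx]) (sψ.of_zero fun x hx => by simp [off x hx])
      (by fun_prop) (by fun_prop)
    refine integral_le_of_zero iL iR iM i1 c1 fun x => ?_
    refine div_pointwise (inv_pos.2 (sqrt_pos.2 (by positivity))) ?_ (exp_pos _) hδ.le (hψ0 x)
      (hθ0 _) (hθ'0 _) (hd.2 x (Set.mem_univ x))
    rw [hi, J2.iS, inv_pow, sq_sqrt (by positivity), inv_mul_cancel₀ (by positivity)]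
  refine le_of_forall_pos_le_add fun η hη => ?_
  set M := ∫ x, ψ x * θ' (d.f x) * exp (α * x.2) ^ 2
  have hM : 0 ≤ M := integral_nonneg fun x => by
    have := hψ0 x
    have := hθ'0 (d.f x)
    positivity
  refine (key (η / (M + 1)) (by positivity)).trans ?_
  gcongr
  rw [div_mul_eq_mul_div, div_le_iff₀ (by positivity)]
  nlinarith

section

/-- Squared Euclidean norm on `(ℝ × ℝ) × ℝ`. -/
def nsq (p : (ℝ × ℝ) × ℝ) : ℝ := p.1.1 ^ 2 + p.1.2 ^ 2 + p.2 ^ 2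

lemma continuous_nsq : Continuous nsq := by unfold nsq; fun_prop

lemma isCompact_nsq_le (R : ℝ) : IsCompact {p | nsq p ≤ R} := by
  refine Metric.isCompact_of_isClosed_isBounded (isClosed_le continuous_nsq continuous_const) ?_
  refine (isBounded_iff_forall_norm_le).2 ⟨√R, fun p hp => ?_⟩
  simp only [Set.mem_ofPred_eq, nsq] at hp
  have h1 := sq_nonneg p.1.1
  have h2 := sq_nonneg p.1.2
  have h3 := sq_nonneg p.2
  refine norm_prod_le_iff.2 ⟨norm_prod_le_iff.2 ⟨?_, ?_⟩, ?_⟩ <;>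
    exact abs_le_sqrt (by linarith)

/-- A nonincreasing cutoff vanishing beyond `ρ`. -/
structure IsCutoff (χ : ℝ → ℝ) (ρ : ℝ) : Prop where
  contDiff : ContDiff ℝ 1 χ
  nonneg : ∀ y, 0 ≤ χ y
  anti : Antitone χ
  zero : ∀ y, ρ ≤ y → χ y = 0

namespace IsCutoff
variable {χ : ℝ → ℝ} {ρ : ℝ}

lemma hasDerivAt (h : IsCutoff χ ρ) (y : ℝ) : HasDerivAt χ (deriv χ y) y :=
  (h.contDiff.differentiable one_ne_zero y).hasDerivAt

lemma continuous_deriv (h : IsCutoff χ ρ) : Continuous (deriv χ) :=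
  h.contDiff.continuous_deriv le_rfl

lemma deriv_zero (h : IsCutoff χ ρ) {y : ℝ} (hy : ρ < y) : deriv χ y = 0 := by
  have : χ =ᶠ[𝓝 y] fun _ => 0 := by
    filter_upwards [Ioi_mem_nhds hy] with z hz using h.zero z (le_of_lt hz)
  rw [this.deriv_eq]; simp

lemma deriv_nonpos (h : IsCutoff χ ρ) (y : ℝ) : deriv χ y ≤ 0 := h.anti.deriv_nonpos

end IsCutoff

lemma sqrt_add_sq_le {a b c s t φ ζ : ℝ} (hφ : 0 ≤ φ) (hζ : 0 ≤ ζ) :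
    √((s * φ + ζ * a) ^ 2 + (t * φ + ζ * b) ^ 2 + (ζ * c) ^ 2) ≤
      φ * √(s ^ 2 + t ^ 2) + ζ * √(a ^ 2 + b ^ 2 + c ^ 2) := by
  refine sqrt_le_iff.2 ⟨by positivity, ?_⟩
  have h1 := sq_sqrt (by positivity : 0 ≤ s ^ 2 + t ^ 2)
  have h2 := sq_sqrt (by positivity : 0 ≤ a ^ 2 + b ^ 2 + c ^ 2)
  have h3 : s * a + t * b ≤ √(s ^ 2 + t ^ 2) * √(a ^ 2 + b ^ 2 + c ^ 2) := by
    refine abs_le_of_sq_le_sq' ?_ (by positivity) |>.2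
    rw [mul_pow, h1, h2]
    nlinarith [sq_nonneg (s * b - t * a), sq_nonneg (s * c), sq_nonneg (t * c)]
  have h4 := mul_le_mul_of_nonneg_left h3 (mul_nonneg hφ hζ)
  have h5 : (φ * √(s ^ 2 + t ^ 2) + ζ * √(a ^ 2 + b ^ 2 + c ^ 2)) ^ 2 =
      φ ^ 2 * √(s ^ 2 + t ^ 2) ^ 2 + 2 * (φ * ζ * (√(s ^ 2 + t ^ 2) * √(a ^ 2 + b ^ 2 + c ^ 2))) +
        ζ ^ 2 * √(a ^ 2 + b ^ 2 + c ^ 2) ^ 2 := by ring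
  rw [h5, h1, h2]
  linarith

variable {α β ρ : ℝ} {Ω : Set (ℝ × ℝ)} {u d : J2} {χ θ : ℝ → ℝ}

/-- The test function built from a barrier and a radial cutoff. -/
def testFun (β : ℝ) (d : J2) (θ χ : ℝ → ℝ) (p : (ℝ × ℝ) × ℝ) : ℝ :=
  (1 - θ (d.f p.1)) * (χ (nsq p) * exp (β * p.2))

lemma hasFDerivAt_nsq (p : (ℝ × ℝ) × ℝ) : HasFDerivAt nsq
    ((2 * p.1.1) • (ContinuousLinearMap.fst ℝ ℝ ℝ ∘L ContinuousLinearMap.fst ℝ (ℝ × ℝ) ℝ) +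
      (2 * p.1.2) • (ContinuousLinearMap.snd ℝ ℝ ℝ ∘L ContinuousLinearMap.fst ℝ (ℝ × ℝ) ℝ) +
      (2 * p.2) • ContinuousLinearMap.snd ℝ (ℝ × ℝ) ℝ) p := by
  have h1 := (ContinuousLinearMap.fst ℝ ℝ ℝ ∘L ContinuousLinearMap.fst ℝ (ℝ × ℝ) ℝ).hasFDerivAt
    (x := p)
  have h2 := (ContinuousLinearMap.snd ℝ ℝ ℝ ∘L ContinuousLinearMap.fst ℝ (ℝ × ℝ) ℝ).hasFDerivAt
    (x := p)
  have h3 := (ContinuousLinearMap.snd ℝ (ℝ × ℝ) ℝ).hasFDerivAt (x := p)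
  refine (((h1.mul h1).add (h2.mul h2)).add (h3.mul h3)).congr_fderiv ?_ |>.congr_of_eventuallyEq
    (Eventually.of_forall fun q => ?_)
  · ext <;> simp <;> ring
  · simp [nsq]; ring

lemma hasFDerivAt_testFun (hd : d.On Set.univ) (hχ : IsCutoff χ ρ) {θ' : ℝ → ℝ}
    (hθ : ∀ y, HasDerivAt θ (θ' y) y) (p : (ℝ × ℝ) × ℝ) :
    HasFDerivAt (testFun β d θ χ)
      ((1 - θ (d.f p.1)) • (χ (nsq p) • (exp (β * p.2) • (β • ContinuousLinearMap.snd ℝ (ℝ × ℝ) ℝ))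
        + exp (β * p.2) • (deriv χ (nsq p) •
        ((2 * p.1.1) • (ContinuousLinearMap.fst ℝ ℝ ℝ ∘L ContinuousLinearMap.fst ℝ (ℝ × ℝ) ℝ) +
          (2 * p.1.2) • (ContinuousLinearMap.snd ℝ ℝ ℝ ∘L ContinuousLinearMap.fst ℝ (ℝ × ℝ) ℝ) +
          (2 * p.2) • ContinuousLinearMap.snd ℝ (ℝ × ℝ) ℝ))) +
       (χ (nsq p) * exp (β * p.2)) • (-(θ' (d.f p.1) •
        (lin (d.s p.1) (d.t p.1) ∘L ContinuousLinearMap.fst ℝ (ℝ × ℝ) ℝ)))) p := by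
  have h1 := ((hθ (d.f p.1)).comp_hasFDerivAt p
    ((hd.hf p.1 (Set.mem_univ _)).comp p hasFDerivAt_fst)).const_sub 1
  have h2 := (hχ.hasDerivAt (nsq p)).comp_hasFDerivAt p (hasFDerivAt_nsq p)
  have h3 := (Real.hasDerivAt_exp (β * p.2)).comp_hasFDerivAt p
    ((ContinuousLinearMap.snd ℝ (ℝ × ℝ) ℝ).hasFDerivAt (x := p) |>.const_mul β)
  exact h1.mul (h2.mul h3)

lemma testFun_fderiv (hd : d.On Set.univ) (hχ : IsCutoff χ ρ) {θ' : ℝ → ℝ}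
    (hθ : ∀ y, HasDerivAt θ (θ' y) y) (p : (ℝ × ℝ) × ℝ) :
    D1 (testFun β d θ χ) p = exp (β * p.2) * ((-(θ' (d.f p.1)) * d.s p.1) * χ (nsq p) +
      (1 - θ (d.f p.1)) * (2 * deriv χ (nsq p) * p.1.1)) ∧
    D2 (testFun β d θ χ) p = exp (β * p.2) * ((-(θ' (d.f p.1)) * d.t p.1) * χ (nsq p) +
      (1 - θ (d.f p.1)) * (2 * deriv χ (nsq p) * p.1.2)) ∧
    D3 (testFun β d θ χ) p - β * testFun β d θ χ p =
      exp (β * p.2) * ((1 - θ (d.f p.1)) * (2 * deriv χ (nsq p) * p.2)) := by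
  simp only [D1, D2, D3, (hasFDerivAt_testFun hd hχ hθ p).fderiv]
  refine ⟨?_, ?_, ?_⟩ <;> simp [testFun] <;> ring

lemma slant_testFun_le (hd : d.On Set.univ) (hχ : IsCutoff χ ρ) {θ' : ℝ → ℝ}
    (hθ : ∀ y, HasDerivAt θ (θ' y) y) (hθ1 : ∀ y, θ y ≤ 1) (hθ' : ∀ y, 0 ≤ θ' y)
    (p : (ℝ × ℝ) × ℝ) :
    slant β (testFun β d θ χ) p ≤ exp (β * p.2) *
      (χ (nsq p) * (θ' (d.f p.1) * √(d.s p.1 ^ 2 + d.t p.1 ^ 2)) +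
        (1 - θ (d.f p.1)) * (-(2 * deriv χ (nsq p)) * √(nsq p))) := by
  obtain ⟨h1, h2, h3⟩ := testFun_fderiv (β := β) hd hχ hθ p
  have hχ' := hχ.deriv_nonpos (nsq p)
  rw [slant, h1, h2, h3, mul_pow, mul_pow, mul_pow, ← mul_add, ← mul_add,
    sqrt_mul (by positivity), sqrt_sq (exp_pos _).le]
  refine mul_le_mul_of_nonneg_left ?_ (exp_pos _).le
  refine (sqrt_add_sq_le (hχ.nonneg _) (sub_nonneg.2 (hθ1 _))).trans (le_of_eq ?_)
  have e1 : (-(θ' (d.f p.1)) * d.s p.1) ^ 2 + (-(θ' (d.f p.1)) * d.t p.1) ^ 2 =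
      θ' (d.f p.1) ^ 2 * (d.s p.1 ^ 2 + d.t p.1 ^ 2) := by ring
  have e2 : (2 * deriv χ (nsq p) * p.1.1) ^ 2 + (2 * deriv χ (nsq p) * p.1.2) ^ 2 +
      (2 * deriv χ (nsq p) * p.2) ^ 2 = (-(2 * deriv χ (nsq p))) ^ 2 * nsq p := by
    rw [nsq]; ring
  rw [e1, e2, sqrt_mul (sq_nonneg _), sqrt_mul (sq_nonneg _), sqrt_sq (hθ' _),
    sqrt_sq (by linarith)]

lemma isTest_testFun (hd : d.On Set.univ) (hχ : IsCutoff χ ρ) {θ' : ℝ → ℝ}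
    (hθ : ∀ y, HasDerivAt θ (θ' y) y) (cθ' : Continuous θ') {T : Set (ℝ × ℝ)}
    (hT : ∀ x ∉ T, θ (d.f x) = 1 ∨ ρ ≤ x.1 ^ 2 + x.2 ^ 2) : IsTest (testFun β d θ χ) T := by
  have cd : Continuous d.f := continuous_iff_continuousAt.2 fun x => hd.cf (Set.mem_univ x)
  have cs : Continuous d.s := continuous_iff_continuousAt.2 fun x => hd.cs (Set.mem_univ x)
  have ct : Continuous d.t := continuous_iff_continuousAt.2 fun x => hd.ct (Set.mem_univ x)
  have cθ : Continuous θ := continuous_iff_continuousAt.2 fun y => (hθ y).continuousAt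
  have cχ := hχ.contDiff.continuous
  have cχ' := hχ.continuous_deriv
  have cn := continuous_nsq
  refine ⟨contDiff_one_iff_hasFDerivAt.2 ⟨_, ?_, hasFDerivAt_testFun hd hχ hθ⟩, ?_, ?_⟩
  · have c1 : Continuous fun p : (ℝ × ℝ) × ℝ => lin (d.s p.1) (d.t p.1) := by
      unfold lin; fun_prop
    fun_prop
  · refine HasCompactSupport.intro (isCompact_nsq_le ρ) fun p hp => ?_
    simp [testFun, hχ.zero _ (le_of_lt (not_le.1 hp))]
  · intro p hp
    rcases hT _ hp with h | h
    · simp [testFun, h]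
    · have : ρ ≤ nsq p := h.trans (by simp only [nsq]; linarith [sq_nonneg p.2])
      simp [testFun, hχ.zero _ this]

end

section

variable {α β ρ : ℝ} {Ω : Set (ℝ × ℝ)} {u d : J2} {χ θ : ℝ → ℝ}

lemma integral_mono_slices {f g : (ℝ × ℝ) × ℝ → ℝ} (hf : Integrable f) (hg : Integrable g)
    (h : ∀ w : ℝ, ∫ x, f (x, w) ≤ ∫ x, g (x, w)) : ∫ p, f p ≤ ∫ p, g p := by
  have hf' : Integrable f ((volume : Measure (ℝ × ℝ)).prod (volume : Measure ℝ)) := hf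
  have hg' : Integrable g ((volume : Measure (ℝ × ℝ)).prod (volume : Measure ℝ)) := hg
  have e1 : ∫ p, f p = ∫ w : ℝ, ∫ x : ℝ × ℝ, f (x, w) := integral_prod_symm f hf'
  have e2 : ∫ p, g p = ∫ w : ℝ, ∫ x : ℝ × ℝ, g (x, w) := integral_prod_symm g hg'
  rw [e1, e2]
  exact integral_mono hf'.integral_prod_right hg'.integral_prod_right h

lemma IsCutoff.integrable (hχ : IsCutoff χ ρ) {f : (ℝ × ℝ) × ℝ → ℝ} (hf : Continuous f)
    (h0 : ∀ p, χ (nsq p) = 0 → deriv χ (nsq p) = 0 → f p = 0) : Integrable f :=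
  hf.integrable_of_hasCompactSupport (HasCompactSupport.intro (isCompact_nsq_le ρ) fun p hp =>
    h0 p (hχ.zero _ (not_le.1 hp).le) (hχ.deriv_zero (not_le.1 hp)))

lemma IsCutoff.hasFDerivAt_slice (hχ : IsCutoff χ ρ) (w : ℝ) (x : ℝ × ℝ) :
    HasFDerivAt (fun x => χ (nsq (x, w)))
      (lin (2 * deriv χ (nsq (x, w)) * x.1) (2 * deriv χ (nsq (x, w)) * x.2)) x := by
  have h1 : HasFDerivAt (fun x : ℝ × ℝ => nsq (x, w)) (lin (2 * x.1) (2 * x.2)) x := by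
    have a1 : HasFDerivAt (fun x : ℝ × ℝ => x.1) (lin 1 0) x :=
      (lin 1 0).hasFDerivAt.congr_of_eventuallyEq (Eventually.of_forall fun y => by simp)
    have a2 : HasFDerivAt (fun x : ℝ × ℝ => x.2) (lin 0 1) x :=
      (lin 0 1).hasFDerivAt.congr_of_eventuallyEq (Eventually.of_forall fun y => by simp)
    refine ((hasFDerivAt_add (hasFDerivAt_mul a1 a1) (hasFDerivAt_mul a2 a2)).add_const
      (w ^ 2)).congr_fderiv ?_ |>.congr_of_eventuallyEq (Eventually.of_forall fun y => ?_)
    · congr 1 <;> ring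
    · simp [nsq]; ring
  refine (hasFDerivAt_comp (hχ.hasDerivAt _) h1).congr_fderiv ?_
  congr 1 <;> ring

lemma integral_slant_testFun_le (hd : FC α d) (hχ : IsCutoff χ ρ) {θ' : ℝ → ℝ}
    (hθ : ∀ y, HasDerivAt θ (θ' y) y) (cθ' : Continuous θ') (hθ0 : ∀ y, 0 ≤ θ y)
    (hθ1 : ∀ y, θ y ≤ 1) (hθ' : ∀ y, 0 ≤ θ' y)
    (hi : Integrable fun p : (ℝ × ℝ) × ℝ => exp (α * p.1.2) * slant β (testFun β d θ χ) p) :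
    ∫ p : (ℝ × ℝ) × ℝ, exp (α * p.1.2) * slant β (testFun β d θ χ) p ≤
      ∫ p : (ℝ × ℝ) × ℝ, -(2 * deriv χ (nsq p)) * √(nsq p) * exp (α * p.1.2 + β * p.2) := by
  have hon := hd.1
  have cd : Continuous d.f := continuous_iff_continuousAt.2 fun x => hon.cf (Set.mem_univ x)
  have cs : Continuous d.s := continuous_iff_continuousAt.2 fun x => hon.cs (Set.mem_univ x)
  have ct : Continuous d.t := continuous_iff_continuousAt.2 fun x => hon.ct (Set.mem_univ x)
  have cθ : Continuous θ := continuous_iff_continuousAt.2 fun y => (hθ y).continuousAt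
  have cχ := hχ.contDiff.continuous
  have cχ' := hχ.continuous_deriv
  have cn := continuous_nsq
  set A : (ℝ × ℝ) × ℝ → ℝ := fun p => χ (nsq p) * (θ' (d.f p.1) * √(d.s p.1 ^ 2 + d.t p.1 ^ 2)) *
    exp (α * p.1.2) * exp (β * p.2) with hA
  set B : (ℝ × ℝ) × ℝ → ℝ := fun p => θ (d.f p.1) * √((2 * deriv χ (nsq p) * p.1.1) ^ 2 +
    (2 * deriv χ (nsq p) * p.1.2) ^ 2) * exp (α * p.1.2) * exp (β * p.2) with hB
  set C : (ℝ × ℝ) × ℝ → ℝ := fun p => (1 - θ (d.f p.1)) * (-(2 * deriv χ (nsq p)) * √(nsq p)) *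
    exp (α * p.1.2) * exp (β * p.2) with hC
  have iA : Integrable A := hχ.integrable (by fun_prop) fun p h1 h2 => by simp [hA, h1]
  have iB : Integrable B := hχ.integrable (by fun_prop) fun p h1 h2 => by simp [hB, h2]
  have iC : Integrable C := hχ.integrable (by fun_prop) fun p h1 h2 => by simp [hC, h2]
  have iG : Integrable fun p : (ℝ × ℝ) × ℝ =>
      -(2 * deriv χ (nsq p)) * √(nsq p) * exp (α * p.1.2 + β * p.2) :=
    hχ.integrable (by fun_prop) fun p h1 h2 => by simp [h2]
  have h1 : ∫ p : (ℝ × ℝ) × ℝ, exp (α * p.1.2) * slant β (testFun β d θ χ) p ≤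
      ∫ p, (A p + C p) := by
    refine integral_mono hi (iA.add iC) fun p => ?_
    have := mul_le_mul_of_nonneg_left (slant_testFun_le (β := β) hon hχ hθ hθ1 hθ' p)
      (exp_pos (α * p.1.2)).le
    refine this.trans (le_of_eq ?_)
    simp only [hA, hC]; ring
  have h2 : ∫ p, A p ≤ ∫ p, B p := by
    refine integral_mono_slices iA iB fun w => ?_
    simp only [hA, hB, integral_mul_const]
    refine mul_le_mul_of_nonneg_right ?_ (exp_pos _).le
    have hsl := hχ.hasFDerivAt_slice w
    refine hd.integral_le (ψ := fun x => χ (nsq (x, w))) hsl (fun x => hχ.nonneg _)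
      (by fun_prop) (by fun_prop) ?_ hθ cθ' hθ0 hθ'
    refine HasCompactSupport.intro ((isCompact_nsq_le ρ).image continuous_fst) fun x hx => ?_
    refine hχ.zero _ (not_lt.1 fun h => hx ⟨(x, w), h.le, rfl⟩)
  have h3 : ∫ p, (B p + C p) ≤
      ∫ p : (ℝ × ℝ) × ℝ, -(2 * deriv χ (nsq p)) * √(nsq p) * exp (α * p.1.2 + β * p.2) := by
    refine integral_mono (iB.add iC) iG fun p => ?_
    simp only [hB, hC]
    have hχ0 := hχ.deriv_nonpos (nsq p)
    have hle : √((2 * deriv χ (nsq p) * p.1.1) ^ 2 + (2 * deriv χ (nsq p) * p.1.2) ^ 2) ≤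
        -(2 * deriv χ (nsq p)) * √(nsq p) := by
      rw [← sqrt_sq (by linarith : 0 ≤ -(2 * deriv χ (nsq p))), ← sqrt_mul (sq_nonneg _)]
      refine sqrt_le_sqrt ?_
      have := sq_nonneg (2 * deriv χ (nsq p) * p.2)
      simp only [nsq] at this ⊢
      linarith
    rw [exp_add]
    have := mul_le_mul_of_nonneg_left hle (hθ0 (d.f p.1))
    have h4 := mul_le_mul_of_nonneg_right this (by positivity :
      0 ≤ exp (α * p.1.2) * exp (β * p.2))
    linarith
  rw [integral_add iA iC] at h1
  rw [integral_add iB iC] at h3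
  linarith

/-- Area bound for a closed graph, in terms of a radial cutoff. -/
lemma TGraph.lintegral_cutoff_le (hu : TGraph α β Ω u) (hα : 0 ≤ α) (hconn : IsPreconnected Ω)
    (hχ : IsCutoff χ ρ) :
    2 * ∫⁻ x in Ω, ENNReal.ofReal
        (χ (nsq (x, u.f x)) * (exp (α * x.2 + β * u.f x) * √(u.gW x))) ≤
      ENNReal.ofReal (∫ p : (ℝ × ℝ) × ℝ,
        -(2 * deriv χ (nsq p)) * √(nsq p) * exp (α * p.1.2 + β * p.2)) := by
  set D : Set (ℝ × ℝ) := Prod.fst '' {p | nsq p ≤ ρ} with hD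
  have cD : IsCompact D := (isCompact_nsq_le ρ).image continuous_fst
  set K : Set (ℝ × ℝ) := Prod.fst '' ({p | nsq p ≤ ρ} ∩ {p | p.1 ∈ Ω ∧ p.2 = u.f p.1}) with hK
  have cK : IsCompact K := ((isCompact_nsq_le ρ).inter_right hu.closed).image continuous_fst
  have hKΩ : K ⊆ Ω := by rintro _ ⟨p, hp, rfl⟩; exact hp.2.1
  obtain ⟨d, ε, hε, hd, hd0, hdK, hdD⟩ := hu.exists_barrier hα hconn cK hKΩ cD
  have cd : Continuous d.f := hd.continuous
  set θ : ℝ → ℝ := fun y => smoothTransition (y / ε) with hθdef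
  have hθc : ContDiff ℝ 1 θ := (smoothTransition.contDiff (n := 1)).comp (by fun_prop)
  have hθ : ∀ y, HasDerivAt θ (deriv θ y) y := fun y =>
    (hθc.differentiable one_ne_zero y).hasDerivAt
  have cθ' : Continuous (deriv θ) := hθc.continuous_deriv le_rfl
  have hmono : Monotone θ := fun x y hxy =>
    smoothTransition.monotone (div_le_div_of_nonneg_right hxy hε.le)
  have hθ0 : ∀ y, 0 ≤ θ y := fun y => smoothTransition.nonneg _
  have hθ1 : ∀ y, θ y ≤ 1 := fun y => smoothTransition.le_one _
  set T : Set (ℝ × ℝ) := D ∩ {x | d.f x ≤ ε} with hT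
  have cT : IsCompact T := cD.inter_right (isClosed_le cd continuous_const)
  have hTΩ : T ⊆ Ω := fun x hx => by
    by_contra h
    exact absurd hx.2 (not_le.2 (hdD x hx.1 h))
  have htest : IsTest (testFun β d θ χ) T := by
    refine isTest_testFun hd.1 hχ hθ cθ' fun x hx => ?_
    by_cases hxD : x ∈ D
    · left
      have : ε < d.f x := not_le.1 fun h => hx ⟨hxD, h⟩
      exact smoothTransition.one_of_one_le ((one_le_div hε).2 this.le)
    · right
      refine le_of_lt (not_le.1 fun h => hxD ⟨(x, 0), ?_, rfl⟩)
      simpa [nsq] using h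
  have hle := hu.two_mul_integral_le cT hTΩ htest
  have hi : Integrable fun p : (ℝ × ℝ) × ℝ => exp (α * p.1.2) * slant β (testFun β d θ χ) p :=
    ((by fun_prop : Continuous fun p : (ℝ × ℝ) × ℝ => exp (α * p.1.2)).mul
      (htest.continuous_slant β)).integrable_of_hasCompactSupport
      (htest.hasCompactSupport_slant β).mul_left
  have hle2 := hle.trans (integral_slant_testFun_le hd hχ hθ cθ' hθ0 hθ1
    (fun y => hmono.deriv_nonneg) hi)
  refine le_trans (le_of_eq ?_) (ENNReal.ofReal_le_ofReal hle2)
  rw [ENNReal.ofReal_mul zero_le_two, ENNReal.ofReal_ofNat]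
  congr 1
  have off : ∀ x ∉ T, testFun β d θ χ (x, u.f x) * (exp (α * x.2) * √(u.gW x)) = 0 := fun x hx => by
    rw [htest.off _ hx, zero_mul]
  have hcont : Continuous fun x => testFun β d θ χ (x, u.f x) * (exp (α * x.2) * √(u.gW x)) := by
    refine continuous_of_eq_zero_off cT.isClosed hTΩ (fun x hx => ?_) off
    have h1 := hu.on.cf hx
    have h2 := hu.on.continuousAt_gW hx
    have h3 : ContinuousAt (fun x => testFun β d θ χ (x, u.f x)) x :=
      ContinuousAt.comp (f := fun x => (x, u.f x)) htest.contDiff.continuous.continuousAt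
        (continuousAt_id.prodMk h1)
    fun_prop
  have hpos : ∀ p, 0 ≤ testFun β d θ χ p := fun p =>
    mul_nonneg (sub_nonneg.2 (hθ1 _)) (mul_nonneg (hχ.nonneg _) (exp_pos _).le)
  rw [ofReal_integral_eq_lintegral_ofReal (hcont.integrable_of_hasCompactSupport
    (HasCompactSupport.intro cT off)) (Eventually.of_forall fun x =>
      mul_nonneg (hpos _) (by positivity)), ← lintegral_indicator hu.isOpen.measurableSet]
  refine lintegral_congr fun x => ?_
  by_cases hx : x ∈ Ω
  · rw [Set.indicator_of_mem hx]
    congr 1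
    rw [testFun, exp_add]
    rcases eq_or_ne (χ (nsq (x, u.f x))) 0 with h0 | h0
    · simp [h0]
    · have hxK : x ∈ K := by
        refine ⟨(x, u.f x), ⟨?_, hx, rfl⟩, rfl⟩
        exact le_of_lt (not_le.1 fun h => h0 (hχ.zero _ h))
      have : θ (d.f x) = 0 := by
        simp only [hθdef]
        rw [hdK x hxK, zero_div, smoothTransition.zero]
      simp only [this]; ring
  · rw [Set.indicator_of_notMem hx]
    have := off x fun h => hx (hTΩ h)
    simp only [this, ENNReal.ofReal_zero]

end

section

lemma measurePreserving_rotation {α β : ℝ} (h : α ^ 2 + β ^ 2 = 1) :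
    MeasurePreserving (fun x : ℝ × ℝ => (β * x.1 - α * x.2, α * x.1 + β * x.2)) := by
  have hn : ‖(⟨β, α⟩ : ℂ)‖ = 1 := by
    rw [Complex.norm_def, Complex.normSq_mk, Real.sqrt_eq_one]; linarith
  let z : Circle := ⟨⟨β, α⟩, mem_sphere_zero_iff_norm.2 hn⟩
  have h1 := (rotation z).measurePreserving
  have h2 := (Complex.volume_preserving_equiv_real_prod.comp h1).comp
    (Complex.volume_preserving_equiv_real_prod.symm)
  have h3 : ∀ w : ℂ, rotation z w = ⟨β, α⟩ * w := fun w => rotation_apply z w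
  convert! h2 using 1
  ext x <;> simp [h3, add_comm]

lemma integral_radial (f : ℝ → ℝ) :
    ∫ p : ℝ × ℝ, f √(p.1 ^ 2 + p.2 ^ 2) = 2 * π * ∫ y in Set.Ioi (0 : ℝ), y * f y := by
  have h := integral_fun_norm_addHaar (volume : Measure ℂ) f
  rw [Complex.finrank_real_complex] at h
  have hb : (volume : Measure ℂ).real (ball 0 1) = π := by
    simp [Measure.real, Complex.volume_ball]
  rw [hb] at h
  have h2 := Complex.volume_preserving_equiv_real_prod.integral_comp
    Complex.measurableEquivRealProd.measurableEmbedding (fun p : ℝ × ℝ => f √(p.1 ^ 2 + p.2 ^ 2))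
  rw [← h2]
  have h3 : ∀ z : ℂ, f √((Complex.measurableEquivRealProd z).1 ^ 2 +
      (Complex.measurableEquivRealProd z).2 ^ 2) = f ‖z‖ := fun z => by
    rw [Complex.norm_def, Complex.normSq_apply]
    simp [Complex.measurableEquivRealProd_apply, sq]
  simp only [h3, h]
  simp [mul_assoc]

variable {α β ρ : ℝ} {χ : ℝ → ℝ}

lemma IsCutoff.integral_radial_deriv (hχ : IsCutoff χ ρ) (z : ℝ) :
    ∫ x : ℝ × ℝ, -(2 * deriv χ (x.1 ^ 2 + x.2 ^ 2 + z ^ 2)) = 2 * π * χ (z ^ 2) := by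
  have h := integral_radial fun y => -(2 * deriv χ (y ^ 2 + z ^ 2))
  have h1 : ∀ x : ℝ × ℝ, √(x.1 ^ 2 + x.2 ^ 2) ^ 2 = x.1 ^ 2 + x.2 ^ 2 := fun x =>
    sq_sqrt (by positivity)
  simp only [h1] at h
  rw [h]
  congr 1
  have h2 := integral_Ioi_of_hasDerivAt_of_nonneg' (a := 0) (l := 0)
    (g := fun y => -χ (y ^ 2 + z ^ 2)) (g' := fun y => y * -(2 * deriv χ (y ^ 2 + z ^ 2)))
    (fun y _ => by
      have := (hχ.hasDerivAt (y ^ 2 + z ^ 2)).comp y (((hasDerivAt_id y).pow 2).add_const (z ^ 2))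
      have := this.neg
      refine this.congr_deriv ?_
      simp; ring)
    (fun y hy => mul_nonneg (le_of_lt hy) (by linarith [hχ.deriv_nonpos (y ^ 2 + z ^ 2)]))
    (by
      refine tendsto_const_nhds.congr' ?_
      filter_upwards [eventually_ge_atTop 1, eventually_ge_atTop ρ] with y h1 h2
      rw [hχ.zero _ (by nlinarith [sq_nonneg z]), neg_zero])
  rw [h2]; simp

/-- The area of the boundary of a cut-off ball. -/
lemma IsCutoff.integral_deriv_nsq_le (hαβ : α ^ 2 + β ^ 2 = 1) {R : ℝ} (hR : 0 ≤ R)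
    (hχ : IsCutoff χ (R ^ 2)) (h1 : ∀ y, χ y ≤ 1) :
    ∫ p : (ℝ × ℝ) × ℝ, -(2 * deriv χ (nsq p)) * √(nsq p) * exp (α * p.1.2 + β * p.2)
      ≤ 4 * π * R * sinh R := by
  have cont : Continuous fun p : (ℝ × ℝ) × ℝ => -(2 * deriv χ (nsq p)) := by
    have := hχ.continuous_deriv
    have := continuous_nsq
    fun_prop
  have z0 : ∀ p : (ℝ × ℝ) × ℝ, R < √(nsq p) → deriv χ (nsq p) = 0 := fun p hp =>
    hχ.deriv_zero (by rw [← lt_sqrt hR]; exact hp)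
  have step1 : ∫ p : (ℝ × ℝ) × ℝ, -(2 * deriv χ (nsq p)) * √(nsq p) * exp (α * p.1.2 + β * p.2)
      ≤ ∫ p : (ℝ × ℝ) × ℝ, R * (-(2 * deriv χ (nsq p)) * exp (α * p.1.2 + β * p.2)) := by
    refine integral_mono (hχ.integrable (by have := continuous_nsq; fun_prop) fun p _ hp => ?_)
      (hχ.integrable (by fun_prop) fun p _ hp => ?_) fun p => ?_
    · rw [hp]; simp
    · rw [hp]; simp
    · have hd := hχ.deriv_nonpos (nsq p)
      dsimp only
      rcases le_or_gt (√(nsq p)) R with h | h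
      · have : 0 ≤ -(2 * deriv χ (nsq p)) * exp (α * p.1.2 + β * p.2) :=
          mul_nonneg (by linarith) (exp_pos _).le
        nlinarith
      · rw [z0 p h]; simp
  have rot : MeasurePreserving (fun p : (ℝ × ℝ) × ℝ =>
      (((p.1.1, β * p.1.2 - α * p.2) : ℝ × ℝ), α * p.1.2 + β * p.2)) := by
    have h1 := (MeasurePreserving.id (volume : Measure ℝ)).prod (measurePreserving_rotation hαβ)
    exact (volume_preserving_prodAssoc.symm _).comp (h1.comp volume_preserving_prodAssoc)
  have int0 : Integrable fun p : (ℝ × ℝ) × ℝ => -(2 * deriv χ (nsq p)) * exp p.2 :=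
    hχ.integrable (by fun_prop) fun p _ hp => by rw [hp]; simp
  have step2 : ∫ p : (ℝ × ℝ) × ℝ, -(2 * deriv χ (nsq p)) * exp (α * p.1.2 + β * p.2)
      = ∫ p : (ℝ × ℝ) × ℝ, -(2 * deriv χ (nsq p)) * exp p.2 := by
    conv_rhs => rw [← rot.map_eq]
    rw [integral_map rot.measurable.aemeasurable (by
      rw [rot.map_eq]; exact int0.aestronglyMeasurable)]
    refine integral_congr_ae (Eventually.of_forall fun p => ?_)
    have : nsq ((p.1.1, β * p.1.2 - α * p.2), α * p.1.2 + β * p.2) = nsq p := by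
      simp only [nsq]
      linear_combination (p.1.2 ^ 2 + p.2 ^ 2) * hαβ
    simp only [this]
  have step3 : ∫ p : (ℝ × ℝ) × ℝ, -(2 * deriv χ (nsq p)) * exp p.2
      = ∫ z : ℝ, 2 * π * χ (z ^ 2) * exp z := by
    rw [Measure.volume_eq_prod, integral_prod_symm _ int0]
    refine integral_congr_ae (Eventually.of_forall fun z => ?_)
    simp only [nsq]
    rw [integral_mul_const, hχ.integral_radial_deriv]
  have step4 : ∫ z : ℝ, 2 * π * χ (z ^ 2) * exp z ≤ ∫ z in Set.Icc (-R) R, 2 * π * exp z := by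
    rw [← integral_indicator measurableSet_Icc]
    refine integral_mono_of_nonneg (Eventually.of_forall fun z => ?_) ?_
      (Eventually.of_forall fun z => ?_)
    · have := hχ.nonneg (z ^ 2); simp only [Pi.zero_apply]; positivity
    · exact (Continuous.integrableOn_Icc (by fun_prop)).integrable_indicator measurableSet_Icc
    · by_cases hz : z ∈ Set.Icc (-R) R
      · simp only [Set.indicator_of_mem hz]
        have := h1 (z ^ 2)
        have h2 : 0 ≤ 2 * π * exp z := by positivity
        nlinarith
      · simp only [Set.indicator_of_notMem hz]
        rw [hχ.zero]
        · simp
        · rw [Set.mem_Icc, ← abs_le] at hz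
          rw [← sq_abs z]
          have := not_le.1 hz
          gcongr
  have step5 : ∫ z in Set.Icc (-R) R, 2 * π * exp z = 4 * π * sinh R := by
    rw [integral_Icc_eq_integral_Ioc, ← intervalIntegral.integral_of_le (by linarith),
      intervalIntegral.integral_const_mul, integral_exp, sinh_eq]
    ring
  rw [integral_const_mul, step2, step3] at step1
  nlinarith

end

/-- The Hausdorff measure of the Euclidean plane is a multiple of the area. -/
lemma exists_hausdorff_eq_smul :
    ∃ c : ℝ≥0, (μH[2] : Measure ℂ) = c • (volume : Measure ℂ) := by
  have h := isAddHaarMeasure_hausdorffMeasure (E := ℂ)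
  rw [Complex.finrank_real_complex, Nat.cast_ofNat] at h
  exact ⟨_, Measure.isAddLeftInvariant_eq_smul _ _⟩

lemma volume_preimage_equivRealProd (B : Set (ℝ × ℝ)) :
    volume (Complex.measurableEquivRealProd ⁻¹' B) = volume B :=
  Complex.volume_preserving_equiv_real_prod.measure_preimage_equiv B

lemma E3.dist_sq (p q : E3) :
    dist p q ^ 2 = (p 0 - q 0) ^ 2 + (p 1 - q 1) ^ 2 + (p 2 - q 2) ^ 2 := by
  rw [EuclideanSpace.dist_eq, sq_sqrt (by positivity), Fin.sum_univ_three]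
  simp only [Real.dist_eq, sq_abs]

/-- The horizontal disc of radius `r`. -/
def disc (r : ℝ) : Set (ℝ × ℝ) := {x | x.1 ^ 2 + x.2 ^ 2 < r ^ 2}

lemma isOpen_disc (r : ℝ) : IsOpen (disc r) := isOpen_lt (by fun_prop) (by fun_prop)

/-- The open hemisphere on the side given by the sign `σ`. -/
def hemisphere (q : E3) (r σ : ℝ) : Set E3 := {p | dist p q = r ∧ 0 < σ * (p 2 - q 2)}

lemma measurableSet_hemisphere (q : E3) (r σ : ℝ) : MeasurableSet (hemisphere q r σ) :=
  (isClosed_eq (f := fun p : E3 => dist p q) (g := fun _ => r) (by fun_prop)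
    (by fun_prop)).measurableSet.inter (isOpen_lt (f := fun _ : E3 => (0 : ℝ))
      (g := fun p : E3 => σ * (p 2 - q 2)) (by fun_prop) (by fun_prop)).measurableSet

/-- The horizontal projection. -/
def hproj (q : E3) (p : E3) : ℝ × ℝ := (p 0 - q 0, p 1 - q 1)

lemma continuous_hproj (q : E3) : Continuous (hproj q) := by unfold hproj; fun_prop

lemma hemisphere_apply_two {q p : E3} {r σ : ℝ} (hσ : σ ^ 2 = 1) (hp : p ∈ hemisphere q r σ) :
    p 2 = q 2 + σ * √(r ^ 2 - (hproj q p).1 ^ 2 - (hproj q p).2 ^ 2) := by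
  have h := E3.dist_sq p q
  rw [hp.1] at h
  have : r ^ 2 - (hproj q p).1 ^ 2 - (hproj q p).2 ^ 2 = (σ * (p 2 - q 2)) ^ 2 := by
    simp only [hproj]; rw [mul_pow, hσ]; linarith
  rw [this, sqrt_sq hp.2.le]
  linear_combination -(p 2 - q 2) * hσ

lemma smul_restrict_disc_le {c : ℝ≥0} (hc : (μH[2] : Measure ℂ) = c • (volume : Measure ℂ))
    (q : E3) {r σ : ℝ} (hr : 0 < r) (hσ : σ ^ 2 = 1) :
    c • (volume : Measure (ℝ × ℝ)).restrict (disc r)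
      ≤ Measure.map (hproj q) ((μH[2] : Measure E3).restrict (hemisphere q r σ)) := by
  refine Measure.le_iff.2 fun B hB => ?_
  rw [Measure.smul_apply, Measure.restrict_apply hB,
    Measure.map_apply (continuous_hproj q).measurable hB,
    Measure.restrict_apply ((continuous_hproj q).measurable hB), ← volume_preimage_equivRealProd,
    ← Measure.smul_apply, ← hc]
  let g : E3 → ℂ := fun p => Complex.measurableEquivRealProd.symm (hproj q p)
  have hg : LipschitzWith 1 g := by
    refine LipschitzWith.of_dist_le_mul fun x y => ?_
    rw [NNReal.coe_one, one_mul, ← pow_le_pow_iff_left₀ dist_nonneg dist_nonneg two_ne_zero,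
      E3.dist_sq, Complex.dist_eq, Complex.sq_norm, Complex.normSq_apply]
    simp only [g, hproj, Complex.measurableEquivRealProd_symm_apply, Complex.sub_re, Complex.sub_im]
    nlinarith [sq_nonneg (x 2 - y 2)]
  have h := hg.hausdorffMeasure_image_le (d := 2) (by norm_num)
    (hproj q ⁻¹' B ∩ hemisphere q r σ)
  rw [ENNReal.coe_one, ENNReal.one_rpow, one_mul] at h
  refine (measure_mono ?_).trans h
  rintro z ⟨hzB, hzD⟩
  have hz : z.re ^ 2 + z.im ^ 2 < r ^ 2 := hzD
  have hpos : 0 < r ^ 2 - z.re ^ 2 - z.im ^ 2 := by linarith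
  let p : E3 := !₂[q 0 + z.re, q 1 + z.im, q 2 + σ * √(r ^ 2 - z.re ^ 2 - z.im ^ 2)]
  have hp : hproj q p = (z.re, z.im) := by simp [hproj, p]
  refine ⟨p, ⟨?_, ?_, ?_⟩, ?_⟩
  · rw [Set.mem_preimage, hp]; exact hzB
  · rw [← pow_left_inj₀ dist_nonneg hr.le two_ne_zero, E3.dist_sq]
    simp only [p, Matrix.cons_val_zero, Matrix.cons_val_one, Matrix.cons_val]
    rw [add_sub_cancel_left, add_sub_cancel_left, add_sub_cancel_left, mul_pow, hσ,
      sq_sqrt hpos.le]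
    linarith
  · have h2 : p 2 - q 2 = σ * √(r ^ 2 - z.re ^ 2 - z.im ^ 2) := by simp [p]
    rw [h2, ← mul_assoc, ← sq, hσ, one_mul]
    exact sqrt_pos.2 hpos
  · simp only [g, hp]
    rfl

lemma lintegral_disc_le_hemisphere {c : ℝ≥0}
    (hc : (μH[2] : Measure ℂ) = c • (volume : Measure ℂ))
    (q : E3) {r σ : ℝ} (hr : 0 < r) (hσ : σ ^ 2 = 1) :
    c * ∫⁻ x in disc r, ENNReal.ofReal (exp (q 2 + σ * √(r ^ 2 - x.1 ^ 2 - x.2 ^ 2)))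
      ≤ ∫⁻ p in hemisphere q r σ, ENNReal.ofReal (exp (p 2)) ∂μH[2] := by
  have h : ∫⁻ p in hemisphere q r σ, ENNReal.ofReal (exp (p 2)) ∂μH[2]
      = ∫⁻ p in hemisphere q r σ, ENNReal.ofReal
        (exp (q 2 + σ * √(r ^ 2 - (hproj q p).1 ^ 2 - (hproj q p).2 ^ 2))) ∂μH[2] :=
    setLIntegral_congr_fun (measurableSet_hemisphere q r σ) fun p hp => by
      simp only []
      rw [← hemisphere_apply_two hσ hp]
  rw [h, ← lintegral_map (f := fun x : ℝ × ℝ => ENNReal.ofReal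
        (exp (q 2 + σ * √(r ^ 2 - x.1 ^ 2 - x.2 ^ 2)))) (by fun_prop)
        (continuous_hproj q).measurable]
  refine le_trans (le_of_eq ?_) (lintegral_mono' (smul_restrict_disc_le hc q hr hσ) le_rfl)
  rw [lintegral_smul_measure]
  rfl

lemma integral_disc {r : ℝ} (hr : 0 < r) :
    ∫ x in disc r, (exp √(r ^ 2 - x.1 ^ 2 - x.2 ^ 2) + exp (-√(r ^ 2 - x.1 ^ 2 - x.2 ^ 2)))
      = 4 * π * (r * sinh r - cosh r + 1) := by
  rw [← integral_indicator (isOpen_disc r).measurableSet]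
  have h := integral_radial fun y => (Set.Iio r).indicator
    (fun y => exp √(r ^ 2 - y ^ 2) + exp (-√(r ^ 2 - y ^ 2))) y
  have h1 : ∀ x : ℝ × ℝ, (disc r).indicator (fun x : ℝ × ℝ =>
      exp √(r ^ 2 - x.1 ^ 2 - x.2 ^ 2) + exp (-√(r ^ 2 - x.1 ^ 2 - x.2 ^ 2))) x
      = (Set.Iio r).indicator
    (fun y => exp √(r ^ 2 - y ^ 2) + exp (-√(r ^ 2 - y ^ 2))) √(x.1 ^ 2 + x.2 ^ 2) := fun x => by
    have hx : x ∈ disc r ↔ √(x.1 ^ 2 + x.2 ^ 2) ∈ Set.Iio r := (sqrt_lt' hr).symm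
    by_cases hd : x ∈ disc r
    · rw [Set.indicator_of_mem hd, Set.indicator_of_mem (hx.1 hd),
        sq_sqrt (by positivity), sub_sub]
    · rw [Set.indicator_of_notMem hd, Set.indicator_of_notMem fun h => hd (hx.2 h)]
  simp only [h1]
  rw [h]
  have h2 : ∀ y, y * (Set.Iio r).indicator
      (fun y => exp √(r ^ 2 - y ^ 2) + exp (-√(r ^ 2 - y ^ 2))) y = (Set.Iio r).indicator
      (fun y => y * (exp √(r ^ 2 - y ^ 2) + exp (-√(r ^ 2 - y ^ 2)))) y := fun y => by
    by_cases hy : y ∈ Set.Iio r <;> simp [hy]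
  simp only [h2]
  rw [setIntegral_indicator measurableSet_Iio, Set.Ioi_inter_Iio, ← integral_Ioc_eq_integral_Ioo,
    ← intervalIntegral.integral_of_le hr.le]
  rw [intervalIntegral.integral_eq_sub_of_hasDerivAt_of_le (f := fun y =>
    -2 * (√(r ^ 2 - y ^ 2) * sinh √(r ^ 2 - y ^ 2) - cosh √(r ^ 2 - y ^ 2))) hr.le]
  · simp only [sub_self, sqrt_zero, sinh_zero, cosh_zero, sub_zero, ne_eq, OfNat.ofNat_ne_zero,
      not_false_eq_true, zero_pow, sqrt_sq hr.le]
    ring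
  · exact Continuous.continuousOn (by fun_prop)
  · intro y hy
    have hpos : 0 < r ^ 2 - y ^ 2 := by nlinarith [hy.1, hy.2]
    have hs := sqrt_pos.2 hpos
    have d0 := (((hasDerivAt_id y).pow 2).const_sub (r ^ 2)).sqrt (by simpa using hpos.ne')
    have d1 := ((d0.mul d0.sinh).sub d0.cosh).const_mul (-2)
    refine d1.congr_deriv ?_
    simp only [id_eq, Pi.pow_apply]
    have : exp √(r ^ 2 - y ^ 2) + exp (-√(r ^ 2 - y ^ 2)) = 2 * cosh √(r ^ 2 - y ^ 2) := by
      rw [cosh_eq]; ring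
    rw [this]
    field_simp
    ring
  · exact Continuous.intervalIntegrable (by fun_prop) _ _

/-- Lower bound for the weighted area of a sphere. -/
lemma le_lintegral_sphere {c : ℝ≥0} (hc : (μH[2] : Measure ℂ) = c • (volume : Measure ℂ))
    (q : E3) {r : ℝ} (hr : 0 < r) :
    c * ENNReal.ofReal (exp (q 2) * (4 * π * (r * sinh r - cosh r + 1)))
      ≤ ∫⁻ p in sphere q r, ENNReal.ofReal (exp (p 2)) ∂μH[2] := by
  have hsub : hemisphere q r 1 ∪ hemisphere q r (-1) ⊆ sphere q r := by
    rintro p (hp | hp) <;> exact hp.1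
  have hdisj : Disjoint (hemisphere q r 1) (hemisphere q r (-1)) :=
    Set.disjoint_left.2 fun p h1 h2 => by
      have := h1.2; have := h2.2; linarith
  refine le_trans ?_ (lintegral_mono_set hsub)
  rw [lintegral_union (measurableSet_hemisphere q r (-1)) hdisj]
  refine le_trans (le_of_eq ?_) (add_le_add
    (lintegral_disc_le_hemisphere hc q hr (by norm_num))
    (lintegral_disc_le_hemisphere hc q hr (by norm_num)))
  rw [← mul_add, ← lintegral_add_left (by fun_prop), ← integral_disc hr, ← integral_const_mul,
    ofReal_integral_eq_lintegral_ofReal]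
  · congr 1
    refine lintegral_congr fun x => ?_
    rw [← ENNReal.ofReal_add (exp_pos _).le (exp_pos _).le]
    congr 1
    rw [exp_add, exp_add, one_mul, neg_one_mul]; ring
  · refine (Continuous.integrableOn_Icc (a := ((-r, -r) : ℝ × ℝ)) (b := (r, r))
      (by fun_prop)).mono_set fun x hx => ?_
    have hx : x.1 ^ 2 + x.2 ^ 2 < r ^ 2 := hx
    have hx1 := abs_le.1 (abs_le_of_sq_le_sq (a := x.1) (by nlinarith [sq_nonneg x.2]) hr.le)
    have hx2 := abs_le.1 (abs_le_of_sq_le_sq (a := x.2) (by nlinarith [sq_nonneg x.1]) hr.le)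
    exact ⟨⟨hx1.1, hx2.1⟩, ⟨hx1.2, hx2.2⟩⟩
  · exact Eventually.of_forall fun x => by positivity

section

/-- The upper triangular linear map of the plane. -/
def triangular (k l m : ℝ) : ℝ × ℝ →ₗ[ℝ] ℝ × ℝ :=
  Matrix.toLin (Module.Basis.finTwoProd ℝ) (Module.Basis.finTwoProd ℝ) !![k, l; 0, m]

lemma triangular_apply (k l m : ℝ) (x : ℝ × ℝ) :
    triangular k l m x = (k * x.1 + l * x.2, m * x.2) := by
  rw [triangular, Matrix.toLin_finTwoProd_apply, zero_mul, zero_add]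

lemma det_triangular (k l m : ℝ) : LinearMap.det (triangular k l m) = k * m := by
  rw [triangular, LinearMap.det_toLin, Matrix.det_fin_two_of, mul_zero, sub_zero]

/-- If distances expand at most by the factor `K` with respect to a linear chart, areas expand at
most by the factor `K ^ 2`. -/
lemma hausdorffMeasure_image_le_of_dist_le {c : ℝ≥0}
    (hc : (μH[2] : Measure ℂ) = c • (volume : Measure ℂ)) {X : Type*} [MetricSpace X]
    [MeasurableSpace X] [BorelSpace X] {γ : ℝ × ℝ → X} {A : Set (ℝ × ℝ)}
    {M : ℝ × ℝ →ₗ[ℝ] ℝ × ℝ} (hM : Function.Injective M) {K : ℝ≥0}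
    (h : ∀ x ∈ A, ∀ y ∈ A, dist (γ x) (γ y) ≤
      K * √((M (x - y)).1 ^ 2 + (M (x - y)).2 ^ 2)) :
    μH[2] (γ '' A) ≤ K ^ 2 * (c * (ENNReal.ofReal |LinearMap.det M| * volume A)) := by
  let e : ℝ × ℝ → ℂ := fun x => Complex.measurableEquivRealProd.symm (M x)
  have he : Function.Injective e := Complex.measurableEquivRealProd.symm.injective.comp hM
  have hinv := Function.leftInverse_invFun he
  have hL : LipschitzOnWith K (fun z => γ (Function.invFun e z)) (e '' A) := by
    refine LipschitzOnWith.of_dist_le_mul ?_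
    rintro _ ⟨x, hx, rfl⟩ _ ⟨y, hy, rfl⟩
    rw [hinv x, hinv y]
    refine (h x hx y hy).trans (le_of_eq ?_)
    rw [Complex.dist_eq, Complex.norm_def, Complex.normSq_apply, map_sub]
    simp [e, Complex.measurableEquivRealProd_symm_apply, sq]
  have h1 := hL.hausdorffMeasure_image_le (d := 2) (by norm_num)
  rw [Set.image_image] at h1
  simp only [hinv _] at h1
  refine h1.trans (le_of_eq ?_)
  rw [hc, ENNReal.rpow_ofNat, Measure.smul_apply, ← Measure.addHaar_image_linearMap]
  have : e '' A = Complex.measurableEquivRealProd ⁻¹' (M '' A) := by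
    rw [← MeasurableEquiv.image_symm, Set.image_image]
  rw [this, volume_preimage_equivRealProd]
  rfl

variable {Ω : Set (ℝ × ℝ)} {u : J2}

/-- The parametrized graph in an orthonormal frame. -/
def graphMap (q a b v : E3) (f : ℝ × ℝ → ℝ) (x : ℝ × ℝ) : E3 :=
  q + (x.1 • a + x.2 • b + f x • v)

lemma norm_frame_sq {a b v : E3} (h : Orthonormal ℝ ![a, b, v]) (x y z : ℝ) :
    ‖x • a + y • b + z • v‖ ^ 2 = x ^ 2 + y ^ 2 + z ^ 2 := by
  have ha : ‖a‖ = 1 := h.1 0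
  have hb : ‖b‖ = 1 := h.1 1
  have hv : ‖v‖ = 1 := h.1 2
  have hab : ⟪a, b⟫ = 0 := h.2 (i := 0) (j := 1) (by decide)
  have hav : ⟪a, v⟫ = 0 := h.2 (i := 0) (j := 2) (by decide)
  have hbv : ⟪b, v⟫ = 0 := h.2 (i := 1) (j := 2) (by decide)
  rw [norm_add_sq_real, norm_add_sq_real, inner_add_left]
  simp only [inner_smul_left, inner_smul_right, hab, hav, hbv, norm_smul, ha, hb, hv]
  simp

lemma dist_graphMap_sq {q a b v : E3} (h : Orthonormal ℝ ![a, b, v]) (f : ℝ × ℝ → ℝ)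
    (x y : ℝ × ℝ) : dist (graphMap q a b v f x) (graphMap q a b v f y) ^ 2
      = (x.1 - y.1) ^ 2 + (x.2 - y.2) ^ 2 + (f x - f y) ^ 2 := by
  rw [← norm_frame_sq h, dist_eq_norm]
  congr 2
  simp only [graphMap]
  module

lemma perturbed_sq_le {s t l e δ : ℝ} (hδ : 0 ≤ δ) (he : |e| ≤ δ * √(s ^ 2 + t ^ 2)) :
    s ^ 2 + t ^ 2 + (l + e) ^ 2 ≤ ((1 + δ) * √(s ^ 2 + t ^ 2 + l ^ 2)) ^ 2 := by
  have hn : 0 ≤ s ^ 2 + t ^ 2 := by positivity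
  rw [mul_pow, sq_sqrt (by positivity)]
  set m := √(s ^ 2 + t ^ 2) with hm
  have hm2 : m ^ 2 = s ^ 2 + t ^ 2 := sq_sqrt hn
  have hm0 : 0 ≤ m := sqrt_nonneg _
  have h1 : e ^ 2 ≤ δ ^ 2 * m ^ 2 := by
    rw [← mul_pow, ← sq_abs e]; gcongr
  have h2 : l * e ≤ |l| * (δ * m) := by
    calc l * e ≤ |l * e| := le_abs_self _
      _ = |l| * |e| := abs_mul _ _
      _ ≤ _ := by gcongr
  have h3 : 2 * (|l| * m) ≤ l ^ 2 + m ^ 2 := by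
    rw [← sq_abs l]; nlinarith [sq_nonneg (|l| - m)]
  have h4 := mul_le_mul_of_nonneg_left h3 hδ
  rw [← hm2]
  nlinarith [mul_nonneg hδ (add_nonneg (sq_nonneg l) (sq_nonneg m)),
    mul_nonneg (sq_nonneg δ) (sq_nonneg l)]

/-- The Cholesky factor of the first fundamental form of a graph. -/
lemma exists_chart (p q : ℝ) : ∃ M : ℝ × ℝ →ₗ[ℝ] ℝ × ℝ,
    LinearMap.det M = √(1 + p ^ 2 + q ^ 2) ∧
    ∀ x, (M x).1 ^ 2 + (M x).2 ^ 2 = x.1 ^ 2 + x.2 ^ 2 + (p * x.1 + q * x.2) ^ 2 := by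
  have hP : 0 < √(1 + p ^ 2) := sqrt_pos.2 (by positivity)
  have hP2 : √(1 + p ^ 2) ^ 2 = 1 + p ^ 2 := sq_sqrt (by positivity)
  have hW2 : √(1 + p ^ 2 + q ^ 2) ^ 2 = 1 + p ^ 2 + q ^ 2 := sq_sqrt (by positivity)
  refine ⟨triangular √(1 + p ^ 2) (p * q / √(1 + p ^ 2)) (√(1 + p ^ 2 + q ^ 2) / √(1 + p ^ 2)),
    ?_, fun x => ?_⟩
  · rw [det_triangular]; field_simp
  · rw [triangular_apply]
    generalize √(1 + p ^ 2) = P at *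
    generalize √(1 + p ^ 2 + q ^ 2) = W at *
    dsimp only
    have : (P * x.1 + p * q / P * x.2) ^ 2 + (W / P * x.2) ^ 2
        = P ^ 2 * x.1 ^ 2 + 2 * (p * q) * x.1 * x.2
          + (p ^ 2 * q ^ 2 + W ^ 2) / P ^ 2 * x.2 ^ 2 := by
      field_simp; ring
    rw [this, hP2, hW2]
    have h1 : (1 + p ^ 2) ≠ 0 := by positivity
    field_simp
    ring

lemma J2.On.hasStrictFDerivAt (hΩ : IsOpen Ω) (hu : u.On Ω) {x : ℝ × ℝ} (hx : x ∈ Ω) :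
    HasStrictFDerivAt u.f (lin (u.s x) (u.t x)) x := by
  refine hasStrictFDerivAt_of_hasFDerivAt_of_continuousAt (f' := fun y => lin (u.s y) (u.t y))
    ((hΩ.eventually_mem hx).mono fun y hy => hu.hf y hy) ?_
  have h1 := (hu.hs x hx).continuousAt
  have h2 := (hu.ht x hx).continuousAt
  unfold lin
  exact (h1.smul continuousAt_const).add (h2.smul continuousAt_const)

lemma J2.On.exists_nhds_hausdorff_le {c : ℝ≥0}
    (hc : (μH[2] : Measure ℂ) = c • (volume : Measure ℂ)) (hΩ : IsOpen Ω) (hu : u.On Ω)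
    {q a b v : E3} (h : Orthonormal ℝ ![a, b, v]) {K : ℝ≥0} (hK : 1 < K) {x : ℝ × ℝ}
    (hx : x ∈ Ω) : ∃ U ∈ 𝓝 x, ∀ A ⊆ U, MeasurableSet A →
      μH[2] (graphMap q a b v u.f '' A)
        ≤ c * K ^ 3 * ∫⁻ y in A, ENNReal.ofReal √(u.gW y) := by
  obtain ⟨M, hdet, hM⟩ := exists_chart (u.s x) (u.t x)
  replace hdet : LinearMap.det M = √(u.gW x) := hdet
  have hK' : (1 : ℝ) < K := hK
  let δ : ℝ≥0 := K - 1
  have hδ : (δ : ℝ) = K - 1 := NNReal.coe_sub hK.le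
  have hδ0 : 0 < δ := tsub_pos_of_lt hK
  obtain ⟨U, hU, happ⟩ := (hu.hasStrictFDerivAt hΩ hx).approximates_deriv_on_nhds
    (c := δ) (Or.inr hδ0)
  have hW0 : 0 < √(u.gW x) := sqrt_pos.2 (J2.gW_pos _ _)
  have hWc : ∀ᶠ y in 𝓝 x, √(u.gW x) < K * √(u.gW y) := by
    have h1 : ContinuousAt (fun y => K * √(u.gW y)) x :=
      continuousAt_const.mul (hu.continuousAt_gW hx).sqrt
    exact h1.eventually (lt_mem_nhds (by nlinarith))
  refine ⟨U ∩ {y | √(u.gW x) < K * √(u.gW y)}, inter_mem hU hWc, fun A hA hAm => ?_⟩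
  have hinj : Function.Injective M := by
    refine (injective_iff_map_eq_zero M).2 fun y hy => ?_
    have h1 := hM y
    rw [hy] at h1
    simp only [Prod.fst_zero, Prod.snd_zero] at h1
    ext
    · show y.1 = 0
      nlinarith [sq_nonneg y.1, sq_nonneg y.2, sq_nonneg (u.s x * y.1 + u.t x * y.2)]
    · show y.2 = 0
      nlinarith [sq_nonneg y.1, sq_nonneg y.2, sq_nonneg (u.s x * y.1 + u.t x * y.2)]
  have hdist := hausdorffMeasure_image_le_of_dist_le hc (γ := graphMap q a b v u.f) (A := A)
    hinj (K := K) fun y hy z hz => by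
      have h1 := happ y (hA hy).1 z (hA hz).1
      rw [← pow_le_pow_iff_left₀ dist_nonneg (by positivity) two_ne_zero, dist_graphMap_sq h,
        hM]
      have h2 : u.f y - u.f z = (u.s x * (y - z).1 + u.t x * (y - z).2)
          + (u.f y - u.f z - lin (u.s x) (u.t x) (y - z)) := by
        rw [lin_apply]; ring
      have hK1 : (K : ℝ) = 1 + δ := by rw [hδ]; ring
      rw [h2, hK1]
      refine perturbed_sq_le δ.2 ((Real.norm_eq_abs _ ▸ h1).trans ?_)
      gcongr
      rw [Prod.norm_def]
      refine max_le ?_ ?_ <;> refine abs_le_sqrt ?_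
      · rw [Prod.fst_sub]; nlinarith [sq_nonneg (y.2 - z.2)]
      · rw [Prod.snd_sub]; nlinarith [sq_nonneg (y.1 - z.1)]
  refine hdist.trans ?_
  rw [hdet, abs_of_nonneg (sqrt_nonneg _)]
  have hint : ENNReal.ofReal √(u.gW x) * volume A ≤ K * ∫⁻ y in A, ENNReal.ofReal √(u.gW y) := by
    rw [← setLIntegral_const, ← lintegral_const_mul' _ _ ENNReal.coe_ne_top]
    refine setLIntegral_mono' hAm fun y hy => ?_
    rw [← ENNReal.ofReal_coe_nnreal, ← ENNReal.ofReal_mul K.coe_nonneg]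
    exact ENNReal.ofReal_le_ofReal (le_of_lt (hA hy).2)
  calc _ ≤ (K : ℝ≥0∞) ^ 2 * (c * (K * ∫⁻ y in A, ENNReal.ofReal √(u.gW y))) := by
        gcongr
    _ = _ := by ring

lemma J2.On.hausdorff_graph_le {c : ℝ≥0}
    (hc : (μH[2] : Measure ℂ) = c • (volume : Measure ℂ)) (hΩ : IsOpen Ω) (hu : u.On Ω)
    {q a b v : E3} (h : Orthonormal ℝ ![a, b, v]) {K : ℝ≥0} (hK : 1 < K) {A : Set (ℝ × ℝ)}
    (hA : A ⊆ Ω) (hAm : MeasurableSet A) :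
    μH[2] (graphMap q a b v u.f '' A)
        ≤ c * K ^ 3 * ∫⁻ y in A, ENNReal.ofReal √(u.gW y) := by
  have hloc : ∀ x : ℝ × ℝ, ∃ U ∈ 𝓝 x, x ∈ Ω → ∀ B ⊆ U, MeasurableSet B →
      μH[2] (graphMap q a b v u.f '' B)
        ≤ c * K ^ 3 * ∫⁻ y in B, ENNReal.ofReal √(u.gW y) := fun x => by
    by_cases hx : x ∈ Ω
    · obtain ⟨U, hU, h1⟩ := hu.exists_nhds_hausdorff_le hc hΩ (q := q) h hK hx
      exact ⟨U, hU, fun _ => h1⟩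
    · exact ⟨Set.univ, univ_mem, fun h => absurd h hx⟩
  choose U hU hUB using hloc
  obtain ⟨T, hTA, hTc, hTU⟩ := TopologicalSpace.countable_cover_nhdsWithin (s := A)
    (f := fun x => interior (U x)) fun x _ =>
      mem_nhdsWithin_of_mem_nhds (interior_mem_nhds.2 (hU x))
  rcases Set.eq_empty_or_nonempty T with rfl | hne
  · have : A = ∅ := by simpa using hTU
    simp [this]
  obtain ⟨g, rfl⟩ := hTc.exists_eq_range hne
  let D : ℕ → Set (ℝ × ℝ) := disjointed fun n => A ∩ interior (U (g n))
  have hDm : ∀ n, MeasurableSet (D n) :=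
    MeasurableSet.disjointed fun n => hAm.inter isOpen_interior.measurableSet
  have hDA : A = ⋃ n, D n := by
    rw [iUnion_disjointed, ← Set.inter_iUnion]
    rw [Set.biUnion_range] at hTU
    exact (Set.inter_eq_left.2 hTU).symm
  have hDU : ∀ n, D n ⊆ U (g n) := fun n =>
    (disjointed_subset _ n).trans (Set.inter_subset_right.trans interior_subset)
  have hgn : ∀ n, g n ∈ Ω := fun n => hA (hTA ⟨n, rfl⟩)
  rw [hDA, Set.image_iUnion, lintegral_iUnion hDm (disjoint_disjointed _), ← ENNReal.tsum_mul_left]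
  exact (measure_iUnion_le _).trans (ENNReal.tsum_le_tsum fun n => hUB _ (hgn n) _ (hDU n) (hDm n))

/-- The weighted area of a part of a graph, in terms of its parametrization. -/
lemma J2.On.lintegral_graph_le {c : ℝ≥0}
    (hc : (μH[2] : Measure ℂ) = c • (volume : Measure ℂ)) (hΩ : IsOpen Ω) (hu : u.On Ω)
    {q a b v : E3} (h : Orthonormal ℝ ![a, b, v]) {K : ℝ≥0} (hK : 1 < K) {F : E3 → ℝ≥0∞}
    (hF : Measurable F) {B : Set E3} (hB : MeasurableSet B) :
    ∫⁻ p in graphMap q a b v u.f '' Ω ∩ B, F p ∂μH[2] ≤ c * K ^ 3 *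
      ∫⁻ x in Ω, B.indicator F (graphMap q a b v u.f x) * ENNReal.ofReal √(u.gW x) := by
  set γ := graphMap q a b v u.f with hγ
  have hcγ : ContinuousOn γ Ω := fun x hx => ContinuousAt.continuousWithinAt (by
    have := (hu.hf x hx).continuousAt
    simp only [hγ]; unfold graphMap; fun_prop)
  have hcW : ContinuousOn (fun x => ENNReal.ofReal √(u.gW x)) Ω := fun x hx =>
    ContinuousAt.continuousWithinAt (ENNReal.continuous_ofReal.continuousAt.comp
      (hu.continuousAt_gW hx).sqrt)
  have mγ := hcγ.aemeasurable (μ := volume) hΩ.measurableSet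
  have mW := hcW.aemeasurable (μ := volume) hΩ.measurableSet
  let ν := (volume.restrict Ω).withDensity fun x => ENNReal.ofReal √(u.gW x)
  have mγν : AEMeasurable γ ν := mγ.mono_ac (withDensity_absolutelyContinuous _ _)
  have hle : (μH[2] : Measure E3).restrict (γ '' Ω) ≤ (c * K ^ 3 : ℝ≥0∞) • Measure.map γ ν := by
    refine Measure.le_iff.2 fun C hC => ?_
    have hpre : MeasurableSet (Ω ∩ γ ⁻¹' C) := by
      convert! hΩ.measurableSet.subtype_image (hcγ.domRestrict.measurable hC) using 1
      ext x
      simp [and_comm]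
    rw [Measure.restrict_apply hC, Measure.smul_apply, Measure.map_apply_of_aemeasurable mγν hC]
    have h1 := hu.hausdorff_graph_le hc hΩ (q := q) h hK Set.inter_subset_left hpre
    rw [Set.inter_comm, ← Set.image_inter_preimage]
    refine h1.trans ?_
    rw [smul_eq_mul]
    gcongr
    refine le_trans ?_ (withDensity_apply_le _ _)
    rw [Measure.restrict_restrict₀' hΩ.measurableSet.nullMeasurableSet, Set.inter_comm]
  rw [Set.inter_comm, ← Measure.restrict_restrict hB]
  refine (lintegral_mono' (Measure.restrict_mono subset_rfl hle) le_rfl).trans (le_of_eq ?_)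
  rw [Measure.restrict_smul, lintegral_smul_measure, smul_eq_mul, ← lintegral_indicator hB,
    lintegral_map' (hF.indicator hB).aemeasurable mγν,
    lintegral_withDensity_eq_lintegral_mul₀ (f := fun x => ENNReal.ofReal √(u.gW x)) mW
      (g := fun x => B.indicator F (γ x)) ((hF.indicator hB).comp_aemeasurable mγ)]
  simp only [Pi.mul_apply, mul_comm]

end

section

lemma sinh_lt_mul_cosh {x : ℝ} (hx : 0 < x) : sinh x < x * cosh x := by
  have hd : ∀ y : ℝ, HasDerivAt (fun y => y * cosh y - sinh y) (y * sinh y) y := fun y =>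
    (((hasDerivAt_id y).mul (hasDerivAt_cosh y)).sub (hasDerivAt_sinh y)).congr_deriv (by
      simp)
  have h := strictMonoOn_of_deriv_pos (convex_Ici 0) (f := fun y => y * cosh y - sinh y)
    (by fun_prop) fun y hy => by
      rw [interior_Ici] at hy
      rw [(hd y).deriv]
      exact mul_pos hy (sinh_pos_iff.2 hy)
  have := h Set.self_mem_Ici hx.le hx
  simp only [zero_mul, sinh_zero, sub_zero] at this
  linarith

lemma mul_sinh_lt {r : ℝ} (hr : 0 < r) : r * sinh r < 2 * (r * sinh r - cosh r + 1) := by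
  have h := sinh_lt_mul_cosh (half_pos hr)
  have hs := sinh_pos_iff.2 (half_pos hr)
  have e1 : sinh r = 2 * sinh (r / 2) * cosh (r / 2) := by rw [← sinh_two_mul]; ring_nf
  have e2 : cosh r = 1 + 2 * sinh (r / 2) ^ 2 := by
    rw [show cosh r = cosh (2 * (r / 2)) by ring_nf, cosh_two_mul, cosh_sq]; ring
  rw [e1, e2]
  nlinarith [mul_pos hs (sub_pos.2 h)]

lemma exists_radius {r : ℝ} (hr : 0 < r) : ∃ R, r < R ∧
    (R / r) ^ 3 * (4 * π * R * sinh R) ≤ 2 * (4 * π * (r * sinh r - cosh r + 1)) := by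
  have hc : ContinuousAt (fun R => (R / r) ^ 3 * (4 * π * R * sinh R)) r := by fun_prop
  have h : (r / r) ^ 3 * (4 * π * r * sinh r) < 2 * (4 * π * (r * sinh r - cosh r + 1)) := by
    rw [div_self hr.ne']
    nlinarith [mul_lt_mul_of_pos_left (mul_sinh_lt hr) (mul_pos (by norm_num : (0 : ℝ) < 4) pi_pos)]
  have h1 : ∀ᶠ R in 𝓝[>] r, (R / r) ^ 3 * (4 * π * R * sinh R)
      < 2 * (4 * π * (r * sinh r - cosh r + 1)) :=
    (hc.eventually (gt_mem_nhds h)).filter_mono nhdsWithin_le_nhds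
  obtain ⟨R, hR, hR'⟩ := (h1.and self_mem_nhdsWithin).exists
  exact ⟨R, hR', hR.le⟩

lemma exists_cutoff {r R : ℝ} (hr : 0 < r) (hR : r < R) :
    ∃ χ, IsCutoff χ (R ^ 2) ∧ (∀ y, χ y ≤ 1) ∧ ∀ y < r ^ 2, χ y = 1 := by
  have hd : 0 < R ^ 2 - r ^ 2 := by nlinarith
  refine ⟨fun y => smoothTransition ((R ^ 2 - y) / (R ^ 2 - r ^ 2)), ⟨?_, fun y => ?_, ?_, ?_⟩,
    fun y => smoothTransition.le_one _, fun y hy => ?_⟩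
  · exact smoothTransition.contDiff.comp (by fun_prop)
  · exact smoothTransition.nonneg _
  · intro x y hxy
    exact smoothTransition.monotone (by gcongr)
  · intro y hy
    exact smoothTransition.zero_of_nonpos (div_nonpos_of_nonpos_of_nonneg (by linarith) hd.le)
  · exact smoothTransition.one_of_one_le ((one_le_div hd).2 (by linarith))

variable {α β : ℝ} {Ω : Set (ℝ × ℝ)} {u : J2}

/-- The weighted area bound in adapted coordinates. -/
lemma TGraph.lintegral_graph_inter_ball_le (hu : TGraph α β Ω u) (hα : 0 ≤ α)
    (hαβ : α ^ 2 + β ^ 2 = 1) (hconn : IsPreconnected Ω) {a b v : E3}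
    (h : Orthonormal ℝ ![a, b, v]) (ha : a 2 = 0) (hb : b 2 = α) (hv : v 2 = β) (q : E3) {r : ℝ}
    (hr : 0 < r) :
    ∫⁻ p in graphMap q a b v u.f '' Ω ∩ ball q r, ENNReal.ofReal (exp (p 2)) ∂μH[2]
      ≤ ∫⁻ p in sphere q r, ENNReal.ofReal (exp (p 2)) ∂μH[2] := by
  obtain ⟨c, hc⟩ := exists_hausdorff_eq_smul
  obtain ⟨R, hrR, hR⟩ := exists_radius hr
  obtain ⟨χ, hχ, hχ1, hχr⟩ := exists_cutoff hr hrR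
  have hR0 : 0 < R := hr.trans hrR
  let K : ℝ≥0 := (R / r).toNNReal
  have hK : 1 < K := by
    rw [← NNReal.coe_lt_coe, Real.coe_toNNReal _ (by positivity)]
    exact (one_lt_div hr).2 hrR
  refine le_trans ?_ (le_lintegral_sphere hc q hr)
  refine (hu.on.lintegral_graph_le hc hu.isOpen h (q := q) hK
    (F := fun p => ENNReal.ofReal (exp (p 2))) (by fun_prop) measurableSet_ball).trans ?_
  have hpt : ∀ x, (ball q r).indicator (fun p : E3 => ENNReal.ofReal (exp (p 2)))
      (graphMap q a b v u.f x) * ENNReal.ofReal √(u.gW x) ≤ ENNReal.ofReal (exp (q 2)) *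
        ENNReal.ofReal (χ (nsq (x, u.f x)) * (exp (α * x.2 + β * u.f x) * √(u.gW x))) := fun x => by
    by_cases hx : graphMap q a b v u.f x ∈ ball q r
    · have h1 : nsq (x, u.f x) < r ^ 2 := by
        rw [mem_ball, ← pow_lt_pow_iff_left₀ dist_nonneg hr.le two_ne_zero, dist_eq_norm,
          graphMap, add_sub_cancel_left, norm_frame_sq h] at hx
        exact hx
      have h2 : (graphMap q a b v u.f x) 2 = q 2 + (α * x.2 + β * u.f x) := by
        simp [graphMap, ha, hb, hv, mul_comm]
      rw [Set.indicator_of_mem hx, hχr _ h1, h2, exp_add, one_mul,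
        ← ENNReal.ofReal_mul (by positivity), ← ENNReal.ofReal_mul (by positivity), mul_assoc]
    · rw [Set.indicator_of_notMem hx, zero_mul]; exact zero_le
  have hmain : 2 * ∫⁻ x in Ω, ENNReal.ofReal (χ (nsq (x, u.f x)) *
      (exp (α * x.2 + β * u.f x) * √(u.gW x))) ≤ ENNReal.ofReal (4 * π * R * sinh R) :=
    (hu.lintegral_cutoff_le hα hconn hχ).trans
      (ENNReal.ofReal_le_ofReal (hχ.integral_deriv_nsq_le hαβ hR0.le hχ1))
  set X := ∫⁻ x in Ω, ENNReal.ofReal (χ (nsq (x, u.f x)) *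
      (exp (α * x.2 + β * u.f x) * √(u.gW x))) with hX
  have hbound : (K : ℝ≥0∞) ^ 3 * X ≤ ENNReal.ofReal (4 * π * (r * sinh r - cosh r + 1)) := by
    have h2 : 2 * ((K : ℝ≥0∞) ^ 3 * X)
        ≤ 2 * ENNReal.ofReal (4 * π * (r * sinh r - cosh r + 1)) := by
      calc 2 * ((K : ℝ≥0∞) ^ 3 * X) = K ^ 3 * (2 * X) := by ring
        _ ≤ K ^ 3 * ENNReal.ofReal (4 * π * R * sinh R) := by gcongr
        _ = ENNReal.ofReal ((R / r) ^ 3 * (4 * π * R * sinh R)) := by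
          rw [ENNReal.ofReal_mul (p := (R / r) ^ 3) (by positivity),
            ENNReal.ofReal_pow (by positivity)]
          rfl
        _ ≤ ENNReal.ofReal (2 * (4 * π * (r * sinh r - cosh r + 1))) :=
          ENNReal.ofReal_le_ofReal hR
        _ = _ := by rw [ENNReal.ofReal_mul two_pos.le, ENNReal.ofReal_ofNat]
    exact (ENNReal.mul_le_mul_iff_right two_ne_zero ENNReal.ofNat_ne_top).1 h2
  calc _ ≤ c * (K : ℝ≥0∞) ^ 3 * ∫⁻ x in Ω, ENNReal.ofReal (exp (q 2)) *
        ENNReal.ofReal (χ (nsq (x, u.f x)) * (exp (α * x.2 + β * u.f x) * √(u.gW x))) := by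
        exact mul_le_mul_right (lintegral_mono hpt) _
    _ = c * (ENNReal.ofReal (exp (q 2)) * (K ^ 3 * X)) := by
        rw [lintegral_const_mul' _ _ ENNReal.ofReal_ne_top, ← hX]; ring
    _ ≤ c * (ENNReal.ofReal (exp (q 2)) * ENNReal.ofReal (4 * π * (r * sinh r - cosh r + 1))) := by
        gcongr
    _ = _ := by rw [ENNReal.ofReal_mul (exp_pos _).le]

end

lemma hasFDerivAt_pds_pdt {f : ℝ × ℝ → ℝ} {x : ℝ × ℝ} (h : DifferentiableAt ℝ f x) :
    HasFDerivAt f (lin (pds f x) (pdt f x)) x := by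
  refine h.hasFDerivAt.congr_fderiv ?_
  ext <;> simp [pds, pdt]

lemma contDiffOn_pds {f : ℝ × ℝ → ℝ} {Ω : Set (ℝ × ℝ)} (hΩ : IsOpen Ω)
    (h : ContDiffOn ℝ (⊤ : ℕ∞) f Ω) : ContDiffOn ℝ (⊤ : ℕ∞) (pds f) Ω :=
  (h.fderiv_of_isOpen hΩ (m := (⊤ : ℕ∞)) le_rfl).clm_apply contDiffOn_const

lemma contDiffOn_pdt {f : ℝ × ℝ → ℝ} {Ω : Set (ℝ × ℝ)} (hΩ : IsOpen Ω)
    (h : ContDiffOn ℝ (⊤ : ℕ∞) f Ω) : ContDiffOn ℝ (⊤ : ℕ∞) (pdt f) Ω :=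
  (h.fderiv_of_isOpen hΩ (m := (⊤ : ℕ∞)) le_rfl).clm_apply contDiffOn_const

lemma pds_pdt_comm {f : ℝ × ℝ → ℝ} {x : ℝ × ℝ} (h : ContDiffAt ℝ (⊤ : ℕ∞) f x) :
    pds (pdt f) x = pdt (pds f) x := by
  have hd : DifferentiableAt ℝ (fderiv ℝ f) x :=
    (h.fderiv_right (m := (⊤ : ℕ∞)) le_rfl).differentiableAt (by simp)
  have hs := h.isSymmSndFDerivAt (by
    rw [minSmoothness_of_isRCLikeNormedField]; exact WithTop.coe_le_coe.2 le_top)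
  have h1 : ∀ w z : ℝ × ℝ, fderiv ℝ (fun y => fderiv ℝ f y w) x z = fderiv ℝ (fderiv ℝ f) x z w :=
    fun w z => by
      rw [fderiv_clm_apply hd (differentiableAt_const w)]; simp
  exact (h1 _ _).trans ((hs _ _).trans (h1 _ _).symm)

/-- The jet of a smooth function. -/
def jet (f : ℝ × ℝ → ℝ) : J2 := ⟨f, pds f, pdt f, pds (pds f), pdt (pds f), pdt (pdt f)⟩

lemma jet_on {f : ℝ × ℝ → ℝ} {Ω : Set (ℝ × ℝ)} (hΩ : IsOpen Ω)
    (h : ContDiffOn ℝ (⊤ : ℕ∞) f Ω) : (jet f).On Ω := by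
  have hd : ∀ {g : ℝ × ℝ → ℝ}, ContDiffOn ℝ (⊤ : ℕ∞) g Ω → ∀ x ∈ Ω,
      HasFDerivAt g (lin (pds g x) (pdt g x)) x := fun hg x hx =>
    hasFDerivAt_pds_pdt ((hg.contDiffAt (hΩ.mem_nhds hx)).differentiableAt (by simp))
  have hs := contDiffOn_pds hΩ h
  have ht := contDiffOn_pdt hΩ h
  refine ⟨hd h, hd hs, fun x hx => ?_, fun x hx => ?_, fun x hx => ?_, fun x hx => ?_⟩
  · have := hd ht x hx
    rwa [pds_pdt_comm (h.contDiffAt (hΩ.mem_nhds hx))] at this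
  · exact ((contDiffOn_pds hΩ hs).contDiffAt (hΩ.mem_nhds hx)).continuousAt
  · exact ((contDiffOn_pdt hΩ hs).contDiffAt (hΩ.mem_nhds hx)).continuousAt
  · exact ((contDiffOn_pdt hΩ ht).contDiffAt (hΩ.mem_nhds hx)).continuousAt

/-- The rigid motion of the plane that rotates by the unit vector `(c, d)` and moves the origin
to `x₀`. -/
def rigid (c d : ℝ) (x₀ y : ℝ × ℝ) : ℝ × ℝ :=
  (x₀.1 + (c * y.1 - d * y.2), x₀.2 + (d * y.1 + c * y.2))

lemma continuous_rigid (c d : ℝ) (x₀ : ℝ × ℝ) : Continuous (rigid c d x₀) := by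
  unfold rigid; fun_prop

lemma rigid_rigid {c d : ℝ} (h : c ^ 2 + d ^ 2 = 1) (x₀ x : ℝ × ℝ) :
    rigid c d x₀ (rigid c (-d) 0 (x - x₀)) = x := by
  ext
  · simp only [rigid, Prod.fst_zero, Prod.snd_zero, Prod.fst_sub, Prod.snd_sub]
    linear_combination (x.1 - x₀.1) * h
  · simp only [rigid, Prod.fst_zero, Prod.snd_zero, Prod.fst_sub, Prod.snd_sub]
    linear_combination (x.2 - x₀.2) * h

lemma rigid_rigid' {c d : ℝ} (h : c ^ 2 + d ^ 2 = 1) (x₀ y : ℝ × ℝ) :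
    rigid c (-d) 0 (rigid c d x₀ y - x₀) = y := by
  ext
  · simp only [rigid, Prod.fst_zero, Prod.snd_zero, Prod.fst_sub, Prod.snd_sub]
    linear_combination y.1 * h
  · simp only [rigid, Prod.fst_zero, Prod.snd_zero, Prod.fst_sub, Prod.snd_sub]
    linear_combination y.2 * h

lemma hasFDerivAt_comp_rigid {c d : ℝ} {x₀ y : ℝ × ℝ} {f : ℝ × ℝ → ℝ} {p q : ℝ}
    (h : HasFDerivAt f (lin p q) (rigid c d x₀ y)) :
    HasFDerivAt (fun y => f (rigid c d x₀ y)) (lin (c * p + d * q) (-d * p + c * q)) y := by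
  have h1 : HasFDerivAt (rigid c d x₀) ((lin c (-d)).prod (lin d c)) y := by
    have e1 : HasFDerivAt (fun y : ℝ × ℝ => x₀.1 + (c * y.1 - d * y.2)) (lin c (-d)) y := by
      refine (((lin c (-d)).hasFDerivAt (x := y)).const_add x₀.1).congr_of_eventuallyEq
        (Eventually.of_forall fun z => ?_)
      simp only [lin_apply]; ring
    have e2 : HasFDerivAt (fun y : ℝ × ℝ => x₀.2 + (d * y.1 + c * y.2)) (lin d c) y := by
      refine (((lin d c).hasFDerivAt (x := y)).const_add x₀.2).congr_of_eventuallyEq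
        (Eventually.of_forall fun z => ?_)
      simp only [lin_apply]
    exact e1.prodMk e2
  refine (h.comp y h1).congr_fderiv ?_
  ext <;> simp <;> ring

namespace J2

/-- The jet of `f` in rotated and translated coordinates. -/
def rotate (g : J2) (c d : ℝ) (x₀ : ℝ × ℝ) (w₀ : ℝ) : J2 where
  f y := g.f (rigid c d x₀ y) - w₀
  s y := c * g.s (rigid c d x₀ y) + d * g.t (rigid c d x₀ y)
  t y := -d * g.s (rigid c d x₀ y) + c * g.t (rigid c d x₀ y)
  ss y := c ^ 2 * g.ss (rigid c d x₀ y) + 2 * c * d * g.st (rigid c d x₀ y)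
    + d ^ 2 * g.tt (rigid c d x₀ y)
  st y := -(c * d) * g.ss (rigid c d x₀ y) + (c ^ 2 - d ^ 2) * g.st (rigid c d x₀ y)
    + c * d * g.tt (rigid c d x₀ y)
  tt y := d ^ 2 * g.ss (rigid c d x₀ y) - 2 * c * d * g.st (rigid c d x₀ y)
    + c ^ 2 * g.tt (rigid c d x₀ y)

lemma On.rotate {g : J2} {Ω : Set (ℝ × ℝ)} (hg : g.On Ω) (c d : ℝ) (x₀ : ℝ × ℝ) (w₀ : ℝ) :
    (g.rotate c d x₀ w₀).On (rigid c d x₀ ⁻¹' Ω) := by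
  have hc := continuous_rigid c d x₀
  have hcc : ∀ {f : ℝ × ℝ → ℝ} {y : ℝ × ℝ}, ContinuousAt f (rigid c d x₀ y) →
      ContinuousAt (fun y => f (rigid c d x₀ y)) y := fun h =>
    ContinuousAt.comp (g := _) h hc.continuousAt
  refine ⟨fun y hy => ?_, fun y hy => ?_, fun y hy => ?_, fun y hy => ?_, fun y hy => ?_,
    fun y hy => ?_⟩
  · exact (hasFDerivAt_comp_rigid (hg.hf _ hy)).sub_const w₀
  · refine (((hasFDerivAt_comp_rigid (hg.hs _ hy)).const_mul c).add
      ((hasFDerivAt_comp_rigid (hg.ht _ hy)).const_mul d)).congr_fderiv ?_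
    ext <;> simp [J2.rotate] <;> ring
  · refine (((hasFDerivAt_comp_rigid (hg.hs _ hy)).const_mul (-d)).add
      ((hasFDerivAt_comp_rigid (hg.ht _ hy)).const_mul c)).congr_fderiv ?_
    ext <;> simp [J2.rotate] <;> ring
  all_goals
    have h1 := hcc (hg.css _ hy)
    have h2 := hcc (hg.cst _ hy)
    have h3 := hcc (hg.ctt _ hy)
    simp only [J2.rotate]
    fun_prop

end J2

lemma translator_rotate {c d s t ss st tt α β A B : ℝ} (h : c ^ 2 + d ^ 2 = 1) (hA : A = -d * α)
    (hB : B = c * α)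
    (hp : (1 + t ^ 2) * ss - 2 * s * t * st + (1 + s ^ 2) * tt
      = (1 + s ^ 2 + t ^ 2) * (β - s * A - t * B)) :
    (1 + (-d * s + c * t) ^ 2) * (c ^ 2 * ss + 2 * c * d * st + d ^ 2 * tt)
      - 2 * (c * s + d * t) * (-d * s + c * t) * (-(c * d) * ss + (c ^ 2 - d ^ 2) * st + c * d * tt)
      + (1 + (c * s + d * t) ^ 2) * (d ^ 2 * ss - 2 * c * d * st + c ^ 2 * tt)
      = (1 + (c * s + d * t) ^ 2 + (-d * s + c * t) ^ 2) * (β - α * (-d * s + c * t)) := by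
  have e1 : (1 + (-d * s + c * t) ^ 2) * (c ^ 2 * ss + 2 * c * d * st + d ^ 2 * tt)
      - 2 * (c * s + d * t) * (-d * s + c * t) * (-(c * d) * ss + (c ^ 2 - d ^ 2) * st + c * d * tt)
      + (1 + (c * s + d * t) ^ 2) * (d ^ 2 * ss - 2 * c * d * st + c ^ 2 * tt)
      = (c ^ 2 + d ^ 2) * (ss + tt)
        + (c ^ 2 + d ^ 2) ^ 2 * (t ^ 2 * ss - 2 * s * t * st + s ^ 2 * tt) := by ring
  have e2 : (1 + (c * s + d * t) ^ 2 + (-d * s + c * t) ^ 2)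
      = 1 + (c ^ 2 + d ^ 2) * (s ^ 2 + t ^ 2) := by ring
  rw [e1, e2, h]
  rw [hA, hB] at hp
  linear_combination hp

lemma exists_rotation (A B : ℝ) : ∃ c d : ℝ, c ^ 2 + d ^ 2 = 1 ∧ A = -d * √(A ^ 2 + B ^ 2) ∧
    B = c * √(A ^ 2 + B ^ 2) := by
  have hs : √(A ^ 2 + B ^ 2) ^ 2 = A ^ 2 + B ^ 2 := sq_sqrt (by positivity)
  rcases eq_or_ne √(A ^ 2 + B ^ 2) 0 with h0 | h0
  · rw [h0] at hs
    exact ⟨1, 0, by norm_num, by nlinarith [sq_nonneg B, sq_nonneg A],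
      by nlinarith [sq_nonneg B, sq_nonneg A]⟩
  · refine ⟨B / √(A ^ 2 + B ^ 2), -A / √(A ^ 2 + B ^ 2), ?_, ?_, ?_⟩
    · rw [div_pow, div_pow, hs]
      have : A ^ 2 + B ^ 2 ≠ 0 := hs ▸ pow_ne_zero 2 h0
      field_simp; ring
    · field_simp
    · field_simp

lemma inner_e3 (x : E3) : ⟪e3, x⟫ = x 2 := by
  simp [e3, EuclideanSpace.inner_single_left]

lemma IsTranslatingGraph.orthonormal {a b v : E3} {Ω : Set (ℝ × ℝ)} {u : ℝ × ℝ → ℝ} {S : Set E3}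
    (h : IsTranslatingGraph a b v Ω u S) : Orthonormal ℝ ![a, b, v] := by
  have h1 := h.inner_ab
  have h2 := h.inner_av
  have h3 := h.inner_bv
  refine ⟨fun i => ?_, fun i j hij => ?_⟩
  · fin_cases i
    exacts [h.norm_a, h.norm_b, h.norm_v]
  · fin_cases i <;> fin_cases j <;> simp_all [real_inner_comm]

lemma orthonormal_rotate {a b v : E3} (h : Orthonormal ℝ ![a, b, v]) {c d : ℝ}
    (hcd : c ^ 2 + d ^ 2 = 1) : Orthonormal ℝ ![c • a + d • b, (-d) • a + c • b, v] := by
  have ha : ‖a‖ = 1 := h.1 0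
  have hb : ‖b‖ = 1 := h.1 1
  have hv : ‖v‖ = 1 := h.1 2
  have hab : ⟪a, b⟫ = 0 := h.2 (i := 0) (j := 1) (by decide)
  have hba : ⟪b, a⟫ = 0 := h.2 (i := 1) (j := 0) (by decide)
  have hav : ⟪a, v⟫ = 0 := h.2 (i := 0) (j := 2) (by decide)
  have hbv : ⟪b, v⟫ = 0 := h.2 (i := 1) (j := 2) (by decide)
  have n1 : ‖c • a + d • b‖ = 1 := by
    have := norm_frame_sq h c d 0
    rw [zero_smul, add_zero] at this
    rw [← sq_eq_sq₀ (norm_nonneg _) one_pos.le, this]; linarith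
  have n2 : ‖(-d) • a + c • b‖ = 1 := by
    have := norm_frame_sq h (-d) c 0
    rw [zero_smul, add_zero] at this
    rw [← sq_eq_sq₀ (norm_nonneg _) one_pos.le, this]; linarith
  have i1 : ⟪c • a + d • b, (-d) • a + c • b⟫ = 0 := by
    simp only [inner_add_left, inner_add_right, inner_smul_left, inner_smul_right, hab, hba,
      real_inner_self_eq_norm_sq, ha, hb]
    simp; ring
  have i2 : ⟪c • a + d • b, v⟫ = 0 := by
    simp [inner_add_left, inner_smul_left, hav, hbv]
  have i3 : ⟪(-d) • a + c • b, v⟫ = 0 := by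
    simp [inner_add_left, inner_smul_left, hav, hbv]
  refine ⟨fun i => ?_, fun i j hij => ?_⟩
  · fin_cases i
    exacts [n1, n2, hv]
  · fin_cases i <;> fin_cases j
    exacts [absurd rfl hij, i1, i2, (real_inner_comm _ _).trans i1, absurd rfl hij, i3,
      (real_inner_comm _ _).trans i2, (real_inner_comm _ _).trans i3, absurd rfl hij]

lemma exists_frame_basis {a b v : E3} (h : Orthonormal ℝ ![a, b, v]) :
    ∃ B : OrthonormalBasis (Fin 3) ℝ E3, ⇑B = ![a, b, v] := by
  let B := basisOfOrthonormalOfCardEqFinrank h (by simp)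
  have hB : ⇑B = ![a, b, v] := coe_basisOfOrthonormalOfCardEqFinrank h _
  exact ⟨B.toOrthonormalBasis (by rw [hB]; exact h), by simp [hB]⟩

lemma eq_frame {a b v : E3} (h : Orthonormal ℝ ![a, b, v]) (q : E3) :
    q = ⟪a, q⟫ • a + ⟪b, q⟫ • b + ⟪v, q⟫ • v := by
  obtain ⟨B, hB⟩ := exists_frame_basis h
  have := B.sum_repr' q
  rw [Fin.sum_univ_three, hB] at this
  exact this.symm

lemma frame_apply_two {a b v : E3} (h : Orthonormal ℝ ![a, b, v]) :
    a 2 ^ 2 + b 2 ^ 2 + v 2 ^ 2 = 1 := by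
  have hi : ∀ x : E3, ⟪x, e3⟫ = x 2 := fun x => (real_inner_comm _ _).trans (inner_e3 x)
  have h1 := norm_frame_sq h ⟪a, e3⟫ ⟪b, e3⟫ ⟪v, e3⟫
  rw [← eq_frame h e3, hi, hi, hi] at h1
  rw [← h1]
  simp [e3]

namespace IsTranslatingGraph

variable {a b v : E3} {Ω : Set (ℝ × ℝ)} {u : ℝ × ℝ → ℝ} {S : Set E3}

lemma graphMap_rotate {c d : ℝ} (h : Orthonormal ℝ ![a, b, v]) (q : E3) (y : ℝ × ℝ) (w : ℝ) :
    q + (y.1 • (c • a + d • b) + y.2 • ((-d) • a + c • b) + (w - ⟪v, q⟫) • v)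
      = (rigid c d (⟪a, q⟫, ⟪b, q⟫) y).1 • a + (rigid c d (⟪a, q⟫, ⟪b, q⟫) y).2 • b + w • v := by
  conv_lhs => rw [eq_frame h q]
  simp only [rigid]
  set x₁ := ⟪a, q⟫
  set x₂ := ⟪b, q⟫
  have h1 : ⟪v, x₁ • a + x₂ • b + ⟪v, q⟫ • v⟫ = ⟪v, q⟫ := by rw [← eq_frame h q]
  rw [h1]
  module

lemma eq_image_graphMap (hS : IsTranslatingGraph a b v Ω u S) {c d : ℝ}
    (hcd : c ^ 2 + d ^ 2 = 1) (q : E3) :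
    S = graphMap q (c • a + d • b) ((-d) • a + c • b) v
      ((jet u).rotate c d (⟪a, q⟫, ⟪b, q⟫) ⟪v, q⟫).f ''
        (rigid c d (⟪a, q⟫, ⟪b, q⟫) ⁻¹' Ω) := by
  have key : ∀ y, graphMap q (c • a + d • b) ((-d) • a + c • b) v
      ((jet u).rotate c d (⟪a, q⟫, ⟪b, q⟫) ⟪v, q⟫).f y
      = (rigid c d (⟪a, q⟫, ⟪b, q⟫) y).1 • a + (rigid c d (⟪a, q⟫, ⟪b, q⟫) y).2 • b
        + u (rigid c d (⟪a, q⟫, ⟪b, q⟫) y) • v :=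
    fun y => graphMap_rotate hS.orthonormal q y _
  rw [hS.graph_eq]
  ext p
  constructor
  · rintro ⟨x, hx, rfl⟩
    have hy := rigid_rigid hcd (⟪a, q⟫, ⟪b, q⟫) x
    exact ⟨_, by rw [Set.mem_preimage, hy]; exact hx, by rw [key, hy]⟩
  · rintro ⟨y, hy, rfl⟩
    exact ⟨_, hy, key y⟩

lemma tGraph_rotate (hS : IsTranslatingGraph a b v Ω u S) (hc : IsClosed S) {c d α : ℝ}
    (hcd : c ^ 2 + d ^ 2 = 1) (hA : a 2 = -d * α) (hB : b 2 = c * α) (q : E3) :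
    TGraph α (v 2) (rigid c d (⟪a, q⟫, ⟪b, q⟫) ⁻¹' Ω)
      ((jet u).rotate c d (⟪a, q⟫, ⟪b, q⟫) ⟪v, q⟫) where
  isOpen := hS.isOpen_dom.preimage (continuous_rigid c d _)
  on := (jet_on hS.isOpen_dom hS.smooth).rotate c d _ _
  pde y hy := by
    have := hS.pde _ hy
    simp only [inner_e3] at this
    exact translator_rotate hcd hA hB this
  closed := by
    have ho := orthonormal_rotate hS.orthonormal hcd
    have hcont : Continuous fun p : (ℝ × ℝ) × ℝ =>
        q + (p.1.1 • (c • a + d • b) + p.1.2 • ((-d) • a + c • b) + p.2 • v) := by fun_prop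
    convert hc.preimage hcont using 1
    ext p
    rw [Set.mem_preimage, hS.eq_image_graphMap hcd q]
    constructor
    · rintro ⟨h1, h2⟩
      exact ⟨p.1, h1, by rw [graphMap, h2]⟩
    · rintro ⟨y, hy, he⟩
      have h0 := norm_frame_sq ho (y.1 - p.1.1) (y.2 - p.1.2)
        (((jet u).rotate c d (⟪a, q⟫, ⟪b, q⟫) ⟪v, q⟫).f y - p.2)
      have hz : (y.1 - p.1.1) • (c • a + d • b) + (y.2 - p.1.2) • ((-d) • a + c • b)
          + (((jet u).rotate c d (⟪a, q⟫, ⟪b, q⟫) ⟪v, q⟫).f y - p.2) • v = 0 := by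
        rw [← sub_eq_zero, graphMap] at he
        rw [← he]
        module
      rw [hz, norm_zero] at h0
      have e1 : y.1 = p.1.1 := by nlinarith
      have e2 : y.2 = p.1.2 := by nlinarith
      have e : y = p.1 := Prod.ext e1 e2
      exact ⟨e ▸ hy, by rw [← e]; nlinarith⟩

end IsTranslatingGraph

lemma isPreconnected_preimage_rigid {c d : ℝ} (hcd : c ^ 2 + d ^ 2 = 1) (x₀ : ℝ × ℝ)
    {Ω : Set (ℝ × ℝ)} (hΩ : IsPreconnected Ω) : IsPreconnected (rigid c d x₀ ⁻¹' Ω) := by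
  have : rigid c d x₀ ⁻¹' Ω = (fun x => rigid c (-d) 0 (x - x₀)) '' Ω := by
    ext y
    constructor
    · exact fun hy => ⟨_, hy, rigid_rigid' hcd x₀ y⟩
    · rintro ⟨x, hx, rfl⟩
      rw [Set.mem_preimage, rigid_rigid hcd]
      exact hx
  rw [this]
  exact hΩ.image _ ((continuous_rigid c (-d) 0).comp
    (continuous_id.sub continuous_const)).continuousOn

lemma IsTranslatingGraph.lintegral_inter_ball_le {a b v : E3} {Ω : Set (ℝ × ℝ)}
    {u : ℝ × ℝ → ℝ} {S : Set E3} (hS : IsTranslatingGraph a b v Ω u S) (hc : IsClosed S)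
    (q : E3) {r : ℝ} (hr : 0 < r) :
    ∫⁻ p in S ∩ ball q r, ENNReal.ofReal (exp (p 2)) ∂μH[2]
      ≤ ∫⁻ p in sphere q r, ENNReal.ofReal (exp (p 2)) ∂μH[2] := by
  obtain ⟨c, d, hcd, hA, hB⟩ := exists_rotation (a 2) (b 2)
  have h1 := frame_apply_two hS.orthonormal
  set α := √(a 2 ^ 2 + b 2 ^ 2) with hα
  have hα2 : α ^ 2 = a 2 ^ 2 + b 2 ^ 2 := sq_sqrt (by positivity)
  rw [hS.eq_image_graphMap hcd q]
  refine (hS.tGraph_rotate hc hcd hA hB q).lintegral_graph_inter_ball_le (sqrt_nonneg _)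
    (by rw [hα2, h1]) (isPreconnected_preimage_rigid hcd _ hS.isConnected_dom.isPreconnected)
    (orthonormal_rotate hS.orthonormal hcd) ?_ ?_ rfl q hr
  · simp only [PiLp.add_apply, PiLp.smul_apply, smul_eq_mul]
    rw [hA, hB]; ring
  · simp only [PiLp.add_apply, PiLp.smul_apply, smul_eq_mul]
    rw [hA, hB]; linear_combination α * hcd

end

/-- local weighted (Ilmanen) area bound for complete connected translating
graphs: the `e^z`-weighted area inside a ball is bounded by that of the boundary sphere. -/
theorem stmt3 (a b v : E3) (Ω : Set (ℝ × ℝ)) (u : ℝ × ℝ → ℝ) (S : Set E3)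
    (hgraph : IsTranslatingGraph a b v Ω u S) (hcomplete : IsClosed S) :
    ∀ (q : E3) (r : ℝ), 0 < r →
      (∫⁻ p in S ∩ Metric.ball q r, ENNReal.ofReal (Real.exp (p 2)) ∂(μH[2]))
        ≤ ∫⁻ p in Metric.sphere q r, ENNReal.ofReal (Real.exp (p 2)) ∂(μH[2]) :=
  fun q _ hr => hgraph.lintegral_inter_ball_le hcomplete q hr
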